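/- (Doubling of elliptic measure) In the same setting, there exists C such that for every ball B centered on Γ, ω^X(2B ∩ Γ) ≤ C ω^X(B ∩ Γ) for all X ∈ Ω \ 4B. -/

import Mathlib

open MeasureTheory Metric Set Filter
open scoped ENNReal Topology

section Part1

section Ext
variable {α : Type*} [MeasurableSpace α]

/-- functions dominated by an integrable function -/
def domSub (μ : Measure α) : Submodule ℝ (α → ℝ) where
  carrier := {f | ∃ g : α → ℝ, Integrable g μ ∧ ∀ᵐ x ∂μ, |f x| ≤ g x}
  add_mem' := by
    rintro f₁ f₂ ⟨g₁, h₁, k₁⟩ ⟨g₂, h₂, k₂⟩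
    refine ⟨g₁ + g₂, h₁.add h₂, ?_⟩
    filter_upwards [k₁, k₂] with x a b
    exact (abs_add_le _ _).trans (add_le_add a b)
  zero_mem' := ⟨0, integrable_zero _ _ _, by simp⟩
  smul_mem' := by
    rintro c f ⟨g, h, k⟩
    refine ⟨fun x => |c| * g x, h.const_mul _, ?_⟩
    filter_upwards [k] with x a
    simp only [Pi.smul_apply, smul_eq_mul, abs_mul]
    gcongr

theorem exists_ext (μ : Measure α) : ∃ Λ : (α → ℝ) →ₗ[ℝ] ℝ,
    (∀ f, Integrable f μ → Λ f = ∫ x, f x ∂μ) ∧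
    (∀ f g : α → ℝ, (∀ᵐ x ∂μ, 0 ≤ f x) → (∀ᵐ x ∂μ, f x ≤ g x) → Integrable g μ → 0 ≤ Λ f) := by
  let V := domSub μ
  let I : Submodule ℝ V :=
    { carrier := {f | Integrable (f : α → ℝ) μ}
      add_mem' := fun {a b} ha hb => by simpa using Integrable.add ha hb
      zero_mem' := integrable_zero _ _ _
      smul_mem' := fun c f h => by simpa using Integrable.smul c h }
  let f0 : V →ₗ.[ℝ] ℝ :=
    { domain := I
      toFun :=
        { toFun := fun f => ∫ x, (f : α → ℝ) x ∂μ
          map_add' := fun a b => by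
            have := integral_add a.2 b.2
            simpa using this
          map_smul' := fun c f => by
            simp [integral_const_mul] } }
  let s : PointedCone ℝ V :=
    { carrier := {f | ∀ᵐ x ∂μ, 0 ≤ (f : α → ℝ) x}
      add_mem' := fun {a b} ha hb => by
        change ∀ᵐ x ∂μ, 0 ≤ (a : α → ℝ) x + (b : α → ℝ) x
        filter_upwards [ha, hb] with x h k
        simpa using add_nonneg h k
      zero_mem' := by simp
      smul_mem' := fun c f h => by
        change ∀ᵐ x ∂μ, 0 ≤ (c : ℝ) * (f : α → ℝ) x
        filter_upwards [h] with x h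
        exact mul_nonneg c.2 h }
  obtain ⟨L, hL1, hL2⟩ := riesz_extension s f0 (fun x hx => integral_nonneg_of_ae hx) (by
    rintro ⟨y, g, hg, hy⟩
    refine ⟨⟨⟨g, |g|, hg.abs, by simp⟩, hg⟩, ?_⟩
    change ∀ᵐ x ∂μ, 0 ≤ g x + y x
    filter_upwards [hy] with x h
    linarith [neg_abs_le (y x)])
  obtain ⟨Λ, hΛ⟩ := L.exists_extend
  have key : ∀ v : V, Λ v = L v := fun v => by rw [← hΛ]; rfl
  refine ⟨Λ, fun f hf => ?_, fun f g h0 h1 hg => ?_⟩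
  · have hfV : f ∈ V := ⟨|f|, hf.abs, by simp⟩
    rw [key ⟨f, hfV⟩]
    exact hL1 ⟨⟨f, hfV⟩, hf⟩
  · have hfV : f ∈ V := ⟨g, hg, by
      filter_upwards [h0, h1] with x a b
      rwa [abs_of_nonneg a]⟩
    rw [key ⟨f, hfV⟩]
    exact hL2 _ h0

/-- positive linear extension of the integral to dominated functions -/
noncomputable def Lam (μ : Measure α) : (α → ℝ) →ₗ[ℝ] ℝ := (exists_ext μ).choose

theorem Lam_int {μ : Measure α} {f : α → ℝ} (hf : Integrable f μ) : Lam μ f = ∫ x, f x ∂μ :=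
  (exists_ext μ).choose_spec.1 f hf

theorem Lam_ge {μ : Measure α} {f g k : α → ℝ} (hg : Integrable g μ) (hk : Integrable k μ)
    (h : ∀ᵐ x ∂μ, g x ≤ f x) (h' : ∀ᵐ x ∂μ, f x ≤ k x) : ∫ x, g x ∂μ ≤ Lam μ f := by
  have := (exists_ext μ).choose_spec.2 (f - g) (k - g)
    (by filter_upwards [h] with x hx; simpa using hx)
    (by filter_upwards [h'] with x hx; simpa using hx) (hk.sub hg)
  change 0 ≤ Lam μ (f - g) at this
  rw [map_sub, Lam_int hg] at this
  linarith

theorem Lam_abs {μ : Measure α} {f g : α → ℝ} (hg : Integrable g μ)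
    (h : ∀ᵐ x ∂μ, |f x| ≤ g x) : |Lam μ f| ≤ ∫ x, g x ∂μ := by
  have h1 := Lam_ge (f := f) hg.neg hg (by filter_upwards [h] with x hx; exact (abs_le.1 hx).1)
    (by filter_upwards [h] with x hx; exact (abs_le.1 hx).2)
  have h2 := Lam_ge (f := -f) hg.neg hg
    (by filter_upwards [h] with x hx; simpa using (abs_le.1 hx).2)
    (by filter_upwards [h] with x hx; simpa using neg_le.1 (abs_le.1 hx).1)
  simp only [Pi.neg_apply, integral_neg, map_neg] at h1 h2
  exact abs_le.2 ⟨h1, by linarith⟩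
end Ext

end Part1

section Part2

abbrev EE (n : ℕ) := EuclideanSpace ℝ (Fin n)

/-- the geometric and elliptic data -/
structure Dat (n : ℕ) where
  d : ℝ
  C₀ : ℝ
  C₃ : ℝ
  hd0 : 0 ≤ d
  hd : d < (n : ℝ) - 1
  hC₀ : 0 < C₀
  hC₃ : 0 < C₃
  Γ : Set (EE n)
  hcl : IsClosed Γ
  hne : Γ.Nonempty
  hAR : ∀ x ∈ Γ, ∀ r : ℝ, 0 < r →
      ENNReal.ofReal (C₀⁻¹ * r ^ d) ≤ μH[d] (Γ ∩ ball x r) ∧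
      μH[d] (Γ ∩ ball x r) ≤ ENNReal.ofReal (C₀ * r ^ d)
  A : EE n → Matrix (Fin n) (Fin n) ℝ
  hell : ∀ X ∉ Γ, ∀ ξ ζ : EE n,
      C₃⁻¹ * Metric.infDist X Γ ^ (d + 1 - (n : ℝ)) * ‖ξ‖ ^ 2 ≤
          ∑ i, ∑ j, A X i j * ξ j * ξ i ∧
      |∑ i, ∑ j, A X i j * ξ j * ζ i| ≤
          C₃ * Metric.infDist X Γ ^ (d + 1 - (n : ℝ)) * ‖ξ‖ * ‖ζ‖

/-- volume of the unit ball -/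
noncomputable def vB (n : ℕ) : ℝ := (volume (ball (0 : EE n) 1)).toReal

theorem vB_pos (n : ℕ) : 0 < vB n :=
  ENNReal.toReal_pos (measure_ball_pos _ _ one_pos).ne' measure_ball_lt_top.ne

theorem vol_ball {n : ℕ} (x : EE n) {r : ℝ} (hr : 0 < r) :
    volume (ball x r) = ENNReal.ofReal (r ^ n * vB n) := by
  rw [Measure.addHaar_ball_of_pos _ _ hr, ENNReal.ofReal_mul (by positivity), vB,
    ENNReal.ofReal_toReal measure_ball_lt_top.ne]
  simp

namespace Dat
variable {n : ℕ} (D : Dat n)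

theorem hn2 (D : Dat n) : 2 ≤ n := by
  have := D.hd; have := D.hd0
  have h : (1 : ℝ) < n := by linarith
  exact_mod_cast h

theorem ntriv (D : Dat n) : Nontrivial (EE n) := by
  have := D.hn2
  have : Nontrivial (Fin n) := Fin.nontrivial_iff_two_le.2 this
  infer_instance

noncomputable def δ (X : EE n) : ℝ := infDist X D.Γ
noncomputable def β : ℝ := D.d + 1 - n
noncomputable def w (X : EE n) : ℝ := D.δ X ^ D.β
noncomputable def ν : Measure (EE n) := volume.withDensity fun X => ENNReal.ofReal (D.w X)
noncomputable def μ : Measure (EE n) := (μH[D.d]).restrict D.Γ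

theorem β_neg : D.β < 0 := by have := D.hd; unfold β; linarith
theorem δ_nonneg (X) : 0 ≤ D.δ X := infDist_nonneg
theorem δ_pos {X} (h : X ∉ D.Γ) : 0 < D.δ X :=
  (D.hcl.notMem_iff_infDist_pos D.hne).1 h
theorem δ_cont : Continuous D.δ := continuous_infDist_pt _
theorem δ_meas : Measurable D.δ := D.δ_cont.measurable
theorem w_meas : Measurable D.w := D.δ_meas.pow_const _
theorem w_nonneg (X) : 0 ≤ D.w X := Real.rpow_nonneg (D.δ_nonneg X) _
theorem w_pos {X} (h : X ∉ D.Γ) : 0 < D.w X := Real.rpow_pos_of_pos (D.δ_pos h) _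
theorem δ_le {X y} (h : y ∈ D.Γ) : D.δ X ≤ dist X y := infDist_le_dist_of_mem h
theorem δ_lip (X Y) : D.δ X ≤ D.δ Y + dist X Y := infDist_le_infDist_add_dist
theorem exists_near (X) : ∃ y ∈ D.Γ, D.δ X = dist X y := D.hcl.exists_infDist_eq_dist D.hne X

theorem μ_ball (x : EE n) (r : ℝ) : D.μ (ball x r) = μH[D.d] (D.Γ ∩ ball x r) := by
  rw [μ, Measure.restrict_apply measurableSet_ball, inter_comm]

theorem μ_le (Z : EE n) {r : ℝ} (hr : 0 < r) :
    D.μ (ball Z r) ≤ ENNReal.ofReal (D.C₀ * (2 * r) ^ D.d) := by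
  rw [μ_ball]
  rcases (D.Γ ∩ ball Z r).eq_empty_or_nonempty with h | ⟨y, hy, hyr⟩
  · rw [h]; simp
  · refine le_trans (measure_mono ?_) (D.hAR y hy (2 * r) (by linarith)).2
    refine inter_subset_inter_right _ (ball_subset_ball' ?_)
    rw [mem_ball] at hyr
    rw [dist_comm]; linarith

theorem μ_ge {Z : EE n} {r : ℝ} (hr : D.δ Z < r) :
    ENNReal.ofReal (D.C₀⁻¹ * r ^ D.d) ≤ D.μ (ball Z (2 * r)) := by
  obtain ⟨y, hy, hZ⟩ := D.exists_near Z
  have h0 := D.δ_nonneg Z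
  rw [μ_ball]
  refine le_trans (D.hAR y hy r (by linarith)).1 (measure_mono ?_)
  refine inter_subset_inter_right _ (ball_subset_ball' ?_)
  rw [dist_comm]; linarith

theorem μ_zero {Z : EE n} {r : ℝ} (hr : r ≤ D.δ Z) : D.μ (ball Z r) = 0 := by
  rw [μ_ball]
  convert measure_empty (μ := μH[D.d])
  ext y
  simp only [mem_inter_iff, mem_ball, mem_empty_iff_false, iff_false, not_and, not_lt]
  intro hy
  rw [dist_comm]
  exact hr.trans (D.δ_le hy)

instance : IsLocallyFiniteMeasure D.μ :=
  ⟨fun x => ⟨ball x 1, ball_mem_nhds _ one_pos,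
    (D.μ_le x one_pos).trans_lt ENNReal.ofReal_lt_top⟩⟩

theorem vol_nbhd : ∃ K : ℝ, 0 < K ∧ ∀ (Y : EE n) (ε R : ℝ), 0 < ε → 0 < R →
    volume ({Z | D.δ Z < ε} ∩ ball Y R) ≤
      ENNReal.ofReal (K * (ε ^ ((n : ℝ) - D.d) * (R + 2 * ε) ^ D.d)) := by
  have hC := D.hC₀
  have hv := vB_pos n
  refine ⟨D.C₀ * D.C₀ * 2 ^ D.d * 2 ^ n * vB n, by positivity, fun Y ε R hε hR => ?_⟩
  set S := {Z | D.δ Z < ε} ∩ ball Y R with hS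
  have hSm : MeasurableSet S := (measurableSet_lt D.δ_meas measurable_const).inter measurableSet_ball
  have h1 : ENNReal.ofReal (D.C₀⁻¹ * ε ^ D.d) * volume S ≤
      ENNReal.ofReal (D.C₀ * (2 * (R + 2 * ε)) ^ D.d) *
        ENNReal.ofReal ((2 * ε) ^ n * vB n) := by
    calc ENNReal.ofReal (D.C₀⁻¹ * ε ^ D.d) * volume S
        = ∫⁻ Z in S, ENNReal.ofReal (D.C₀⁻¹ * ε ^ D.d) := by simp
      _ ≤ ∫⁻ Z in S, ∫⁻ y, (ball Y (R + 2 * ε)).indicator 1 y *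
            (ball (0 : EE n) (2 * ε)).indicator (1 : EE n → ℝ≥0∞) (Z - y) ∂D.μ := by
          refine setLIntegral_mono' hSm fun Z hZ => (D.μ_ge hZ.1).trans ?_
          rw [← lintegral_indicator_one measurableSet_ball]
          refine lintegral_mono fun y => ?_
          by_cases hy : y ∈ ball Z (2 * ε)
          · have h2 : y ∈ ball Y (R + 2 * ε) := by
              have := hZ.2
              rw [mem_ball] at *
              linarith [dist_triangle y Z Y]
            have h3 : Z - y ∈ ball (0 : EE n) (2 * ε) := by
              rw [mem_ball_zero_iff, ← dist_eq_norm, dist_comm]; exact hy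
            simp [indicator_of_mem hy, indicator_of_mem h2, indicator_of_mem h3]
          · simp [indicator_of_notMem hy]
      _ ≤ ∫⁻ Z, ∫⁻ y, (ball Y (R + 2 * ε)).indicator 1 y *
            (ball (0 : EE n) (2 * ε)).indicator (1 : EE n → ℝ≥0∞) (Z - y) ∂D.μ :=
          setLIntegral_le_lintegral _ _
      _ = ∫⁻ y, (∫⁻ Z, (ball Y (R + 2 * ε)).indicator 1 y *
            (ball (0 : EE n) (2 * ε)).indicator (1 : EE n → ℝ≥0∞) (Z - y)) ∂D.μ := by
          refine lintegral_lintegral_swap (Measurable.aemeasurable ?_)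
          refine Measurable.mul ?_ ?_
          · exact (measurable_one.indicator measurableSet_ball).comp measurable_snd
          · exact (measurable_one.indicator measurableSet_ball).comp
              (measurable_fst.sub measurable_snd)
      _ = ∫⁻ y, (ball Y (R + 2 * ε)).indicator 1 y * volume (ball (0 : EE n) (2 * ε)) ∂D.μ := by
          refine lintegral_congr fun y => ?_
          have hm : Measurable fun Z : EE n =>
              (ball (0 : EE n) (2 * ε)).indicator (1 : EE n → ℝ≥0∞) (Z - y) :=
            (measurable_one.indicator measurableSet_ball).comp (measurable_id.sub_const y)
          rw [lintegral_const_mul _ hm, lintegral_sub_right_eq_self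
            (fun Z => (ball (0 : EE n) (2 * ε)).indicator (1 : EE n → ℝ≥0∞) Z) y,
            lintegral_indicator_one measurableSet_ball]
      _ = D.μ (ball Y (R + 2 * ε)) * volume (ball (0 : EE n) (2 * ε)) := by
          rw [lintegral_mul_const _ (measurable_one.indicator measurableSet_ball),
            lintegral_indicator_one measurableSet_ball]
      _ ≤ _ := by
          rw [vol_ball _ (by positivity)]
          gcongr
          exact D.μ_le Y (by positivity)
  have h2 : volume S ≤ (ENNReal.ofReal (D.C₀⁻¹ * ε ^ D.d))⁻¹ *
      (ENNReal.ofReal (D.C₀ * (2 * (R + 2 * ε)) ^ D.d) *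
        ENNReal.ofReal ((2 * ε) ^ n * vB n)) := by
    rw [mul_comm] at h1
    rw [mul_comm, ← div_eq_mul_inv]
    exact (ENNReal.le_div_iff_mul_le (Or.inl (by simp; positivity)) (Or.inl (by simp))).2 h1
  refine h2.trans (le_of_eq ?_)
  rw [← ENNReal.ofReal_inv_of_pos (by positivity), ← ENNReal.ofReal_mul (by positivity),
    ← ENNReal.ofReal_mul (by positivity)]
  congr 1
  rw [Real.rpow_sub hε, Real.rpow_natCast, Real.mul_rpow (by norm_num) (by positivity), mul_pow]
  field_simp

theorem vol_Γ : volume D.Γ = 0 := by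
  obtain ⟨K, hK, h⟩ := D.vol_nbhd
  have hd := D.hd
  have key : ∀ R : ℝ, 0 < R → volume (D.Γ ∩ ball 0 R) = 0 := fun R hR => by
    have ht : Tendsto (fun ε : ℝ => ENNReal.ofReal (K * (ε ^ ((n : ℝ) - D.d) *
        (R + 2 * ε) ^ D.d))) (𝓝[>] 0) (𝓝 (ENNReal.ofReal 0)) := by
      refine ENNReal.tendsto_ofReal ?_
      have hc : ContinuousAt (fun ε : ℝ => K * (ε ^ ((n : ℝ) - D.d) * (R + 2 * ε) ^ D.d)) 0 := by
        refine continuousAt_const.mul (ContinuousAt.mul ?_ ?_)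
        · exact Real.continuousAt_rpow_const _ _ (Or.inr (by linarith))
        · exact ContinuousAt.rpow_const (by fun_prop) (Or.inl (by simp; positivity))
      have := hc.tendsto
      simp only [Real.zero_rpow (show (n : ℝ) - D.d ≠ 0 by linarith), zero_mul, mul_zero] at this
      exact this.mono_left nhdsWithin_le_nhds
    rw [ENNReal.ofReal_zero] at ht
    refine le_antisymm (ge_of_tendsto ht ?_) bot_le
    filter_upwards [self_mem_nhdsWithin] with ε hε
    refine (measure_mono (inter_subset_inter_left _ fun y hy => ?_)).trans (h 0 ε R hε hR)
    exact lt_of_le_of_lt (D.δ_le hy) (by simpa using hε)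
  have : D.Γ = ⋃ k : ℕ, D.Γ ∩ ball 0 ((k : ℝ) + 1) := by
    rw [← inter_iUnion]
    refine (inter_eq_left.2 fun y _ => ?_).symm
    obtain ⟨k, hk⟩ := exists_nat_gt ‖y‖
    exact mem_iUnion.2 ⟨k, by rw [mem_ball_zero_iff]; linarith⟩
  rw [this]
  exact measure_iUnion_null fun k => key _ (by positivity)

theorem ae_notΓ : ∀ᵐ X : EE n, X ∉ D.Γ := by
  simpa [ae_iff] using D.vol_Γ

theorem ν_ac : D.ν ≪ volume := withDensity_absolutelyContinuous _ _

theorem ac_ν : (volume : Measure (EE n)) ≪ D.ν := by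
  refine withDensity_absolutelyContinuous' D.w_meas.ennreal_ofReal.aemeasurable ?_
  filter_upwards [D.ae_notΓ] with X hX
  simpa using D.w_pos hX

theorem ν_ball : ∃ K : ℝ, 0 < K ∧ ∀ y ∈ D.Γ, ∀ R : ℝ, 0 < R →
    D.ν (ball y R) ≤ ENNReal.ofReal (K * R ^ (D.d + 1)) := by
  obtain ⟨K, hK, h⟩ := D.vol_nbhd
  have hd := D.hd
  have hd0 := D.hd0
  refine ⟨K * 2 ^ (-D.β) * 3 ^ D.d * 2, by positivity, fun y hy R hR => ?_⟩
  let r : ℕ → ℝ := fun k => R * (2⁻¹) ^ k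
  have hr : ∀ k, 0 < r k := fun k => by positivity
  let S : ℕ → Set (EE n) := fun k => {Z | r k / 2 ≤ D.δ Z} ∩ ({Z | D.δ Z < r k} ∩ ball y R)
  have hcov : ball y R ⊆ D.Γ ∪ ⋃ k, S k := by
    intro Z hZ
    by_cases hΓ : Z ∈ D.Γ
    · exact Or.inl hΓ
    right
    have hp := D.δ_pos hΓ
    have hlt : D.δ Z < R := lt_of_le_of_lt (D.δ_le hy) hZ
    obtain ⟨k, hk1, hk2⟩ := exists_nat_pow_near_of_lt_one (div_pos hp hR)
      ((div_le_one hR).2 hlt.le) (show (0 : ℝ) < 2⁻¹ by norm_num) (by norm_num)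
    rw [div_le_iff₀ hR] at hk2
    rw [lt_div_iff₀ hR] at hk1
    rcases hk2.lt_or_eq with h3 | h3
    · refine mem_iUnion.2 ⟨k, ?_, ?_, hZ⟩
      · simp only [mem_ofPred_eq, r]; rw [pow_succ] at hk1; linarith
      · simp only [mem_ofPred_eq, r]; linarith
    · rcases k with _ | k
      · simp at h3; linarith
      · refine mem_iUnion.2 ⟨k, ?_, ?_, hZ⟩
        · simp only [mem_ofPred_eq, r]; rw [pow_succ] at h3; linarith
        · simp only [mem_ofPred_eq, r]
          rw [pow_succ] at h3
          have : 0 < (2⁻¹ : ℝ) ^ k * R := by positivity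
          linarith
  have hS : ∀ k, D.ν (S k) ≤ ENNReal.ofReal (K * 2 ^ (-D.β) * 3 ^ D.d * R ^ (D.d + 1)) *
      (2⁻¹ : ℝ≥0∞) ^ k := fun k => by
    have hm : MeasurableSet (S k) := (measurableSet_le measurable_const D.δ_meas).inter
      ((measurableSet_lt D.δ_meas measurable_const).inter measurableSet_ball)
    rw [ν, withDensity_apply _ hm]
    calc ∫⁻ X in S k, ENNReal.ofReal (D.w X) ≤ ∫⁻ X in S k, ENNReal.ofReal ((r k / 2) ^ D.β) := by
          refine setLIntegral_mono' hm fun X hX => ENNReal.ofReal_le_ofReal ?_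
          exact Real.rpow_le_rpow_of_nonpos (by have := hr k; positivity) hX.1 D.β_neg.le
      _ ≤ ENNReal.ofReal ((r k / 2) ^ D.β) *
            ENNReal.ofReal (K * ((r k) ^ ((n : ℝ) - D.d) * (R + 2 * r k) ^ D.d)) := by
          rw [setLIntegral_const]
          gcongr
          exact (measure_mono inter_subset_right).trans (h y _ R (hr k) hR)
      _ ≤ ENNReal.ofReal (K * 2 ^ (-D.β) * 3 ^ D.d * R ^ (D.d + 1) * (2⁻¹) ^ k) := by
          have := hr k
          rw [← ENNReal.ofReal_mul (by positivity)]
          refine ENNReal.ofReal_le_ofReal ?_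
          have h3 : (R + 2 * r k) ^ D.d ≤ (3 * R) ^ D.d := by
            refine Real.rpow_le_rpow (by positivity) ?_ hd0
            have : r k ≤ R := mul_le_of_le_one_right hR.le (pow_le_one₀ (by norm_num) (by norm_num))
            linarith
          have h4 : (r k / 2) ^ D.β * (r k) ^ ((n : ℝ) - D.d) = 2 ^ (-D.β) * r k := by
            rw [Real.div_rpow this.le (by norm_num), Real.rpow_neg (by norm_num), div_mul_eq_mul_div,
              ← Real.rpow_add this, show D.β + ((n : ℝ) - D.d) = 1 by unfold β; ring, Real.rpow_one]
            ring
          calc (r k / 2) ^ D.β * (K * (r k ^ ((n : ℝ) - D.d) * (R + 2 * r k) ^ D.d))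
              = K * ((r k / 2) ^ D.β * r k ^ ((n : ℝ) - D.d)) * (R + 2 * r k) ^ D.d := by ring
            _ ≤ K * ((r k / 2) ^ D.β * r k ^ ((n : ℝ) - D.d)) * (3 * R) ^ D.d := by gcongr
            _ = _ := by
              rw [h4, Real.mul_rpow (by norm_num) hR.le, Real.rpow_add_one hR.ne']
              simp only [r]; ring
      _ = _ := by
          rw [ENNReal.ofReal_mul (by positivity), ENNReal.ofReal_pow (by norm_num),
            ENNReal.ofReal_inv_of_pos (by norm_num)]
          simp
  calc D.ν (ball y R) ≤ D.ν D.Γ + ∑' k, D.ν (S k) :=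
        (measure_mono hcov).trans ((measure_union_le _ _).trans (by gcongr; exact measure_iUnion_le _))
    _ ≤ 0 + ∑' k, ENNReal.ofReal (K * 2 ^ (-D.β) * 3 ^ D.d * R ^ (D.d + 1)) *
          (2⁻¹ : ℝ≥0∞) ^ k := by
        gcongr with k
        · exact (D.ν_ac D.vol_Γ).le
        · exact hS k
    _ = _ := by
        rw [zero_add, ENNReal.tsum_mul_left, ENNReal.tsum_geometric, ENNReal.one_sub_inv_two, inv_inv,
          show K * 2 ^ (-D.β) * 3 ^ D.d * 2 * R ^ (D.d + 1) =
            K * 2 ^ (-D.β) * 3 ^ D.d * R ^ (D.d + 1) * 2 by ring,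
          ENNReal.ofReal_mul (p := _ * R ^ (D.d + 1)) (by positivity)]
        simp

theorem ν_ball_lt (X : EE n) (R : ℝ) : D.ν (ball X R) < ⊤ := by
  obtain ⟨K, hK, h⟩ := D.ν_ball
  obtain ⟨y, hy, -⟩ := D.exists_near X
  refine lt_of_le_of_lt ((measure_mono (ball_subset_ball' (ε₂ := |R| + dist X y + 1) ?_)).trans
    (h y hy _ (by positivity))) ENNReal.ofReal_lt_top
  linarith [le_abs_self R]

instance : IsLocallyFiniteMeasure D.ν :=
  ⟨fun x => ⟨ball x 1, ball_mem_nhds _ one_pos, D.ν_ball_lt x 1⟩⟩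
end Dat

end Part2

section Part3

theorem lint_homothety {n : ℕ} (y : EE n) {τ : ℝ} (hτ : 0 < τ) {h : EE n → ℝ≥0∞}
    (hh : Measurable h) :
    ∫⁻ X, h (y + τ • (X - y)) = (ENNReal.ofReal (τ ^ n))⁻¹ * ∫⁻ Z, h Z := by
  have h1 : ∫⁻ X, h (y + τ • (X - y)) = ∫⁻ X, h (y + τ • X) :=
    lintegral_sub_right_eq_self (fun X => h (y + τ • X)) y
  have h2 : ∫⁻ X, h (y + τ • X) = ∫⁻ Z, h (y + Z) ∂(Measure.map (τ • ·) (volume : Measure (EE n))) :=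
    (lintegral_map (f := fun Z => h (y + Z)) (hh.comp (measurable_const_add y))
      (measurable_const_smul τ)).symm
  rw [h1, h2, Measure.map_addHaar_smul _ hτ.ne', lintegral_smul_measure,
    lintegral_add_left_eq_self h y, abs_of_pos (by positivity),
    ENNReal.ofReal_inv_of_pos (by positivity)]
  simp

noncomputable def kap {n : ℕ} (μ : Measure (EE n)) (R : ℝ) (Z : EE n) : ℝ≥0∞ :=
  ∫⁻ τ in Ioo (0 : ℝ) 1, (ENNReal.ofReal (τ ^ n))⁻¹ * μ (ball Z (2 * R * τ))

theorem kexists (n : ℕ) (R : ℝ) : ∃ k : EE n → EE n → ℝ → ℝ≥0∞,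
      (Measurable fun p : EE n × EE n × ℝ => k p.1 p.2.1 p.2.2) ∧
      (∀ Z y τ, dist Z y < 2 * R * τ → k Z y τ = 1) ∧
      (∀ Z y τ, ¬ dist Z y < 2 * R * τ → k Z y τ = 0) := by
  refine ⟨fun Z y τ => (ball (0 : ℝ) 1).indicator 1 (max 0 (dist Z y - 2 * R * τ + 1)), ?_, ?_, ?_⟩
  · exact (measurable_one.indicator measurableSet_ball).comp
      (by fun_prop : Measurable fun p : EE n × EE n × ℝ => max 0 (dist p.1 p.2.1 - 2 * R * p.2.2 + 1))
  · intro Z y τ h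
    refine indicator_of_mem ?_ _
    rw [mem_ball_zero_iff, Real.norm_of_nonneg (le_max_left _ _)]
    exact max_lt one_pos (by linarith)
  · intro Z y τ h
    refine indicator_of_notMem ?_ _
    rw [mem_ball_zero_iff, Real.norm_of_nonneg (le_max_left _ _), not_lt]
    exact le_max_of_le_right (by linarith)

theorem seg_key {n : ℕ} {f : EE n → ℝ} (hf : ContDiff ℝ 1 f) (c : EE n) (R : ℝ)
    (g : EE n → ℝ≥0∞) (hg1 : ∀ Z ∈ ball c R, g Z = ‖fderiv ℝ f Z‖ₑ)
    (k : EE n → EE n → ℝ → ℝ≥0∞) (hk1 : ∀ Z y τ, dist Z y < 2 * R * τ → k Z y τ = 1) :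
    ∀ X ∈ ball c R, ∀ y ∈ ball c R, ‖f X - f y‖ₑ ≤
      ENNReal.ofReal (2 * R) * ∫⁻ τ in Ioo (0 : ℝ) 1,
        g (y + τ • (X - y)) * k (y + τ • (X - y)) y τ := by
    intro X hX y hy
    have hd1 : ∀ τ : ℝ, HasDerivAt (fun τ : ℝ => y + τ • (X - y)) (X - y) τ := fun τ => by
      simpa using ((hasDerivAt_id τ).smul_const (X - y)).const_add y
    have hsm : ContDiff ℝ 1 fun τ : ℝ => f (y + τ • (X - y)) := by
      refine hf.comp ?_; fun_prop
    have h1 := enorm_sub_le_lintegral_deriv_of_contDiffOn_Icc (a := 0) (b := 1)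
      (f := fun τ : ℝ => f (y + τ • (X - y))) hsm.contDiffOn zero_le_one
    simp only [one_smul, zero_smul, add_zero, add_sub_cancel] at h1
    refine h1.trans ?_
    rw [restrict_Ioo_eq_restrict_Icc.symm, ← lintegral_const_mul']
    swap
    · exact ENNReal.ofReal_ne_top
    refine setLIntegral_mono' measurableSet_Ioo fun τ hτ => ?_
    have hz : y + τ • (X - y) ∈ ball c R := by
      have := (convex_ball c R) hy hX (sub_nonneg.2 hτ.2.le) hτ.1.le (by ring)
      convert this using 1
      module
    have hXy : ‖X - y‖ < 2 * R := by
      rw [← dist_eq_norm]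
      rw [mem_ball] at hX hy
      linarith [dist_triangle_right X y c]
    have hkk : k (y + τ • (X - y)) y τ = 1 := by
      apply hk1
      rw [dist_eq_norm, add_sub_cancel_left, norm_smul, Real.norm_of_nonneg hτ.1.le, mul_comm]
      exact mul_lt_mul_of_pos_right hXy hτ.1
    rw [hkk, mul_one, hg1 _ hz]
    have : deriv (fun τ : ℝ => f (y + τ • (X - y))) τ = fderiv ℝ f (y + τ • (X - y)) (X - y) :=
      (((hf.differentiable one_ne_zero) _).hasFDerivAt.comp_hasDerivAt τ (hd1 τ)).deriv
    rw [this]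
    refine (ContinuousLinearMap.le_opENorm _ _).trans ?_
    rw [mul_comm]
    gcongr
    rw [← ofReal_norm]
    exact ENNReal.ofReal_le_ofReal hXy.le

theorem seg_poincare {n : ℕ} (μ : Measure (EE n)) [SFinite μ] {f : EE n → ℝ} (hf : ContDiff ℝ 1 f)
    (c : EE n) (R : ℝ) :
    ∫⁻ X in ball c R, (∫⁻ y in ball c R, ‖f X - f y‖ₑ ∂μ) ≤
      ENNReal.ofReal (2 * R) * ∫⁻ Z in ball c R, ‖fderiv ℝ f Z‖ₑ * kap μ R Z := by
  obtain ⟨g, hgm, hg1, hg0⟩ : ∃ g : EE n → ℝ≥0∞, Measurable g ∧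
      (∀ Z ∈ ball c R, g Z = ‖fderiv ℝ f Z‖ₑ) ∧ (∀ Z ∉ ball c R, g Z = 0) :=
    ⟨_, ((hf.continuous_fderiv one_ne_zero).enorm.measurable).indicator measurableSet_ball,
      fun Z hZ => indicator_of_mem hZ _, fun Z hZ => indicator_of_notMem hZ _⟩
  obtain ⟨k, hkm, hk1, hk0⟩ := kexists n R
  have hkm1 : ∀ y τ, Measurable fun Z : EE n => k Z y τ := fun y τ =>
    hkm.comp (by fun_prop : Measurable fun Z : EE n => (Z, y, τ))
  have key := seg_key hf c R g hg1 k hk1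
  have m1 : Measurable fun p : EE n × EE n × ℝ =>
      g (p.2.1 + p.2.2 • (p.1 - p.2.1)) * k (p.2.1 + p.2.2 • (p.1 - p.2.1)) p.2.1 p.2.2 := by
    refine Measurable.mul (hgm.comp (by fun_prop)) ?_
    exact hkm.comp (by fun_prop : Measurable fun p : EE n × EE n × ℝ =>
      (p.2.1 + p.2.2 • (p.1 - p.2.1), p.2.1, p.2.2))
  calc ∫⁻ X in ball c R, (∫⁻ y in ball c R, ‖f X - f y‖ₑ ∂μ)
      ≤ ∫⁻ X in ball c R, (∫⁻ y in ball c R, (ENNReal.ofReal (2 * R) * ∫⁻ τ in Ioo (0 : ℝ) 1,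
        g (y + τ • (X - y)) * k (y + τ • (X - y)) y τ) ∂μ) :=
        setLIntegral_mono' measurableSet_ball fun X hX =>
          setLIntegral_mono' measurableSet_ball fun y hy => key X hX y hy
    _ ≤ ∫⁻ X, (∫⁻ y, (ENNReal.ofReal (2 * R) * ∫⁻ τ in Ioo (0 : ℝ) 1,
        g (y + τ • (X - y)) * k (y + τ • (X - y)) y τ) ∂μ) :=
        (setLIntegral_le_lintegral _ _).trans
          (lintegral_mono fun X => setLIntegral_le_lintegral _ _)
    _ = ENNReal.ofReal (2 * R) * ∫⁻ X, (∫⁻ y, (∫⁻ τ in Ioo (0 : ℝ) 1,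
        g (y + τ • (X - y)) * k (y + τ • (X - y)) y τ) ∂μ) := by
        rw [← lintegral_const_mul' _ _ ENNReal.ofReal_ne_top]
        refine lintegral_congr fun X => ?_
        rw [← lintegral_const_mul' _ _ ENNReal.ofReal_ne_top]
    _ = ENNReal.ofReal (2 * R) * ∫⁻ X, (∫⁻ p : EE n × ℝ, 
        g (p.1 + p.2 • (X - p.1)) * k (p.1 + p.2 • (X - p.1)) p.1 p.2
          ∂(μ.prod (volume.restrict (Ioo (0 : ℝ) 1)))) := by
        congr 1
        refine lintegral_congr fun X => ?_
        rw [lintegral_prod]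
        exact (m1.comp (measurable_const.prodMk measurable_id)).aemeasurable
    _ = ENNReal.ofReal (2 * R) * ∫⁻ p : EE n × ℝ, (∫⁻ X, 
        g (p.1 + p.2 • (X - p.1)) * k (p.1 + p.2 • (X - p.1)) p.1 p.2)
          ∂(μ.prod (volume.restrict (Ioo (0 : ℝ) 1))) := by
        rw [lintegral_lintegral_swap]
        exact m1.aemeasurable
    _ = ENNReal.ofReal (2 * R) * ∫⁻ p : EE n × ℝ, (∫⁻ Z, 
        (ENNReal.ofReal (p.2 ^ n))⁻¹ * (g Z * k Z p.1 p.2))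
          ∂(μ.prod (volume.restrict (Ioo (0 : ℝ) 1))) := by
        congr 1
        refine lintegral_congr_ae ?_
        have : ∀ᵐ p : EE n × ℝ ∂(μ.prod (volume.restrict (Ioo (0 : ℝ) 1))), p.2 ∈ Ioo (0 : ℝ) 1 :=
          Measure.quasiMeasurePreserving_snd.ae (ae_restrict_mem measurableSet_Ioo)
        filter_upwards [this] with p hp
        have hm : Measurable fun Z => g Z * k Z p.1 p.2 := hgm.mul (hkm1 _ _)
        rw [lintegral_const_mul _ hm]
        exact lint_homothety p.1 hp.1 hm
    _ = ENNReal.ofReal (2 * R) * ∫⁻ Z, (∫⁻ p : EE n × ℝ,  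
        (ENNReal.ofReal (p.2 ^ n))⁻¹ * (g Z * k Z p.1 p.2)
          ∂(μ.prod (volume.restrict (Ioo (0 : ℝ) 1)))) := by
        rw [lintegral_lintegral_swap]
        refine Measurable.aemeasurable ?_
        refine Measurable.mul (by fun_prop) (Measurable.mul (hgm.comp measurable_snd) ?_)
        exact hkm.comp (by fun_prop : Measurable fun p : (EE n × ℝ) × EE n =>
          (p.2, p.1.1, p.1.2))
    _ = ENNReal.ofReal (2 * R) * ∫⁻ Z, g Z * kap μ R Z := by
        congr 1
        refine lintegral_congr fun Z => ?_
        have hgt : g Z ≠ ⊤ := by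
          by_cases hZ : Z ∈ ball c R
          · rw [hg1 _ hZ]; exact enorm_ne_top
          · rw [hg0 _ hZ]; exact ENNReal.zero_ne_top
        have hm : Measurable fun p : EE n × ℝ => k Z p.1 p.2 :=
          hkm.comp (by fun_prop : Measurable fun p : EE n × ℝ => (Z, p.1, p.2))
        rw [kap, ← lintegral_const_mul' _ _ hgt, lintegral_prod_symm]
        swap
        · exact (Measurable.mul (by fun_prop) (measurable_const.mul hm)).aemeasurable
        refine lintegral_congr fun τ => ?_
        simp only
        have hm2 : Measurable fun y : EE n => k Z y τ :=
          hm.comp (by fun_prop : Measurable fun y : EE n => (y, τ))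
        rw [lintegral_const_mul _ (hm2.const_mul _), lintegral_const_mul _ hm2]
        have : ∫⁻ y, k Z y τ ∂μ = μ (ball Z (2 * R * τ)) := by
          rw [← lintegral_indicator_one measurableSet_ball]
          refine lintegral_congr fun y => ?_
          by_cases h : dist Z y < 2 * R * τ
          · rw [indicator_of_mem (by rwa [mem_ball']), hk1 _ _ _ h]; rfl
          · rw [indicator_of_notMem (by rwa [mem_ball']), hk0 _ _ _ h]
        rw [this]; ring
    _ = ENNReal.ofReal (2 * R) * ∫⁻ Z in ball c R, ‖fderiv ℝ f Z‖ₑ * kap μ R Z := by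
        congr 1
        rw [← lintegral_indicator measurableSet_ball]
        refine lintegral_congr fun Z => ?_
        by_cases hZ : Z ∈ ball c R
        · rw [hg1 _ hZ, indicator_of_mem hZ]
        · rw [hg0 _ hZ, indicator_of_notMem hZ, zero_mul]

end Part3

section Part4

theorem kap_vol {n : ℕ} {R : ℝ} (hR : 0 < R) (Z : EE n) :
    kap volume R Z ≤ ENNReal.ofReal ((2 * R) ^ n * vB n) := by
  have h : ∀ τ ∈ Ioo (0 : ℝ) 1, (ENNReal.ofReal (τ ^ n))⁻¹ * volume (ball Z (2 * R * τ)) ≤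
      ENNReal.ofReal ((2 * R) ^ n * vB n) := by
    intro τ hτ
    have h0 : 0 < τ := hτ.1
    rw [vol_ball Z (by positivity), ← ENNReal.ofReal_inv_of_pos (by positivity),
      ← ENNReal.ofReal_mul (by positivity)]
    apply ENNReal.ofReal_le_ofReal
    rw [mul_pow]; field_simp; rfl
  refine (setLIntegral_mono' measurableSet_Ioo h).trans ?_
  simp

theorem poincare_vol {n : ℕ} {f : EE n → ℝ} (hf : ContDiff ℝ 1 f) (c : EE n) {R : ℝ} (hR : 0 < R) :
    ∫⁻ X in ball c R, (∫⁻ y in ball c R, ‖f X - f y‖ₑ) ≤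
      ENNReal.ofReal ((2 * R) ^ (n + 1) * vB n) * ∫⁻ Z in ball c R, ‖fderiv ℝ f Z‖ₑ := by
  have hv := vB_pos n
  refine (seg_poincare volume hf c R).trans ?_
  calc _ ≤ ENNReal.ofReal (2 * R) * ∫⁻ Z in ball c R, ‖fderiv ℝ f Z‖ₑ *
        ENNReal.ofReal ((2 * R) ^ n * vB n) := by
        gcongr; exact kap_vol hR _
    _ = _ := by
        rw [lintegral_mul_const' _ _ ENNReal.ofReal_ne_top, mul_comm (lintegral _ _), ← mul_assoc,
          ← ENNReal.ofReal_mul (by positivity)]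
        ring_nf

namespace Dat
variable {n : ℕ} (D : Dat n)

theorem kap_le : ∃ K : ℝ, 0 < K ∧ ∀ R : ℝ, 0 < R → ∀ Z ∉ D.Γ,
    kap D.μ R Z ≤ ENNReal.ofReal (K * R ^ ((n : ℝ) - 1) * D.w Z) := by
  have hC := D.hC₀
  have hβ := D.β_neg
  refine ⟨D.C₀ * 4 ^ D.d * 2⁻¹ ^ D.β / (-D.β), by have := neg_pos.2 hβ; positivity, fun R hR Z hZ => ?_⟩
  have hδ := D.δ_pos hZ
  set t0 := D.δ Z / (2 * R) with ht0
  have ht : 0 < t0 := by positivity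
  have h : ∀ τ ∈ Ioo (0 : ℝ) 1, (ENNReal.ofReal (τ ^ n))⁻¹ * D.μ (ball Z (2 * R * τ)) ≤
      (Ioi t0).indicator (fun τ => ENNReal.ofReal (D.C₀ * (4 * R) ^ D.d * τ ^ (D.d - n))) τ := by
    intro τ hτ
    have h0 : 0 < τ := hτ.1
    by_cases hm : τ ∈ Ioi t0
    · rw [indicator_of_mem hm]
      refine (mul_le_mul_right (D.μ_le Z (by positivity)) _).trans ?_
      rw [← ENNReal.ofReal_inv_of_pos (by positivity), ← ENNReal.ofReal_mul (by positivity)]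
      apply ENNReal.ofReal_le_ofReal
      rw [Real.rpow_sub h0, Real.rpow_natCast, show 2 * (2 * R * τ) = (4 * R) * τ by ring,
        Real.mul_rpow (by positivity) h0.le]
      apply le_of_eq
      field_simp
    · rw [indicator_of_notMem hm, D.μ_zero]
      · simp
      · simp only [mem_Ioi, not_lt, ht0] at hm
        rw [le_div_iff₀ (by positivity)] at hm
        linarith
  refine (setLIntegral_mono' measurableSet_Ioo h).trans ((setLIntegral_le_lintegral _ _).trans ?_)
  rw [lintegral_indicator measurableSet_Ioi]
  have ha : D.d - n < -1 := by have := D.hd; linarith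
  rw [← ofReal_integral_eq_lintegral_ofReal, integral_const_mul, integral_Ioi_rpow_of_lt ha ht]
  · apply ENNReal.ofReal_le_ofReal
    have e : D.d - n + 1 = D.β := by unfold β; ring
    rw [e, w, ht0, Real.div_rpow hδ.le (by positivity), Real.mul_rpow (by norm_num) hR.le,
      Real.mul_rpow (by norm_num) hR.le, Real.inv_rpow (by norm_num)]
    have e2 : R ^ ((n : ℝ) - 1) = R ^ D.d / R ^ D.β := by
      rw [← Real.rpow_sub hR]; congr 1; unfold β; ring
    rw [e2]
    have := neg_pos.2 hβ
    apply le_of_eq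
    have p1 : (0:ℝ) < R ^ D.β := by positivity
    have p2 : (0:ℝ) < 2 ^ D.β := by positivity
    field_simp
  · exact (integrableOn_Ioi_rpow_of_lt ha ht).const_mul _
  · filter_upwards [ae_restrict_mem measurableSet_Ioi] with τ hτ
    have : 0 < τ := ht.trans hτ
    positivity

theorem lint_ν {h : EE n → ℝ≥0∞} {S : Set (EE n)} (hh : AEMeasurable h) (hS : MeasurableSet S) :
    ∫⁻ Z in S, h Z ∂D.ν = ∫⁻ Z in S, h Z * ENNReal.ofReal (D.w Z) := by
  rw [ν, restrict_withDensity hS, lintegral_withDensity_eq_lintegral_mul₀]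
  · exact lintegral_congr fun Z => mul_comm _ _
  · exact D.w_meas.ennreal_ofReal.aemeasurable
  · exact hh.restrict

/-- Poincare inequality with zero trace on `Γ` -/
theorem tp : ∃ K : ℝ, 0 < K ∧ ∀ (f : EE n → ℝ), ContDiff ℝ 1 f → ∀ y ∈ D.Γ, ∀ R : ℝ, 0 < R →
    (∀ z ∈ D.Γ, z ∈ ball y R → f z = 0) →
    ∫⁻ X in ball y R, ‖f X‖ₑ ≤
      ENNReal.ofReal (K * R ^ ((n : ℝ) - D.d)) * ∫⁻ Z in ball y R, ‖fderiv ℝ f Z‖ₑ ∂D.ν := by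
  obtain ⟨K, hK, hk⟩ := D.kap_le
  have hC := D.hC₀
  refine ⟨D.C₀ * 2 * K, by positivity, fun f hf y hy R hR hz => ?_⟩
  have h1 := seg_poincare D.μ hf y R
  have h2 : ∀ X, ∫⁻ y in ball y R, ‖f X - f y‖ₑ ∂D.μ = ‖f X‖ₑ * D.μ (ball y R) := by
    intro X
    rw [← setLIntegral_const]
    refine lintegral_congr_ae ?_
    have : ∀ᵐ z ∂D.μ, z ∈ D.Γ := ae_restrict_mem D.hcl.measurableSet
    filter_upwards [ae_restrict_mem measurableSet_ball, ae_restrict_of_ae this] with z h3 h4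
    rw [hz z h4 h3, sub_zero]
  have hμ : ENNReal.ofReal (D.C₀⁻¹ * R ^ D.d) ≤ D.μ (ball y R) := by
    rw [μ_ball]; exact (D.hAR y hy R hR).1
  have hm : Measurable fun Z => ‖fderiv ℝ f Z‖ₑ :=
    (hf.continuous_fderiv one_ne_zero).enorm.measurable
  have h3 : (∫⁻ X in ball y R, ‖f X‖ₑ) * ENNReal.ofReal (D.C₀⁻¹ * R ^ D.d) ≤
      ENNReal.ofReal (2 * R) * (ENNReal.ofReal (K * R ^ ((n : ℝ) - 1)) *
        ∫⁻ Z in ball y R, ‖fderiv ℝ f Z‖ₑ ∂D.ν) := by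
    simp_rw [h2] at h1
    rw [lintegral_mul_const _ (by have := hf.continuous; fun_prop)] at h1
    refine ((mul_le_mul_right hμ _).trans h1).trans ?_
    gcongr
    rw [D.lint_ν hm.aemeasurable measurableSet_ball, ← lintegral_const_mul' _ _ ENNReal.ofReal_ne_top]
    refine lintegral_mono_ae (ae_restrict_of_ae ?_)
    filter_upwards [D.ae_notΓ] with Z hZ
    have hw := D.w_nonneg Z
    refine (mul_le_mul_right (hk R hR Z hZ) _).trans ?_
    rw [ENNReal.ofReal_mul (by positivity)]
    apply le_of_eq; ring
  have hpos : 0 < D.C₀⁻¹ * R ^ D.d := by positivity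
  have h4 : ENNReal.ofReal (D.C₀ * 2 * K * R ^ ((n : ℝ) - D.d)) =
      (ENNReal.ofReal (D.C₀⁻¹ * R ^ D.d))⁻¹ * (ENNReal.ofReal (2 * R) *
        ENNReal.ofReal (K * R ^ ((n : ℝ) - 1))) := by
    rw [← ENNReal.ofReal_inv_of_pos hpos, ← ENNReal.ofReal_mul (by positivity),
      ← ENNReal.ofReal_mul (by positivity)]
    congr 1
    rw [Real.rpow_sub hR, Real.rpow_sub hR, Real.rpow_one]
    field_simp
  rw [h4, mul_assoc, mul_assoc, ← ENNReal.mul_le_iff_le_inv, mul_comm]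
  · exact h3
  · simpa using hpos
  · exact ENNReal.ofReal_ne_top

end Dat

end Part4

section Part5

section grad
variable {n : ℕ} {f g : EE n → ℝ}

theorem gr_norm (f : EE n → ℝ) (X : EE n) : ‖gradient f X‖ = ‖fderiv ℝ f X‖ := by
  simp [gradient]

theorem gr_enorm (f : EE n → ℝ) (X : EE n) : ‖gradient f X‖ₑ = ‖fderiv ℝ f X‖ₑ := by
  rw [← ofReal_norm, ← ofReal_norm, gr_norm]

theorem gr_cont (hf : ContDiff ℝ 1 f) : Continuous (gradient f) :=
  (InnerProductSpace.toDual ℝ (EE n)).symm.continuous.comp (hf.continuous_fderiv one_ne_zero)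

theorem gr_mul (hf : ContDiff ℝ 1 f) (hg : ContDiff ℝ 1 g) (X : EE n) :
    gradient (fun X => f X * g X) X = f X • gradient g X + g X • gradient f X := by
  simp only [gradient]
  rw [fderiv_fun_mul (hf.differentiable one_ne_zero X) (hg.differentiable one_ne_zero X)]
  simp

theorem gr_add (hf : ContDiff ℝ 1 f) (hg : ContDiff ℝ 1 g) (X : EE n) :
    gradient (fun X => f X + g X) X = gradient f X + gradient g X := by
  simp only [gradient]
  rw [fderiv_fun_add (hf.differentiable one_ne_zero X) (hg.differentiable one_ne_zero X)]
  simp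

theorem gr_comp (hf : ContDiff ℝ 1 f) {K : ℝ → ℝ} (hK : ContDiff ℝ 1 K) (X : EE n) :
    gradient (fun X => K (f X)) X = deriv K (f X) • gradient f X := by
  simp only [gradient]
  have := (hK.differentiable one_ne_zero (f X)).hasDerivAt.comp_hasFDerivAt X
    (hf.differentiable one_ne_zero X).hasFDerivAt
  have h2 : fderiv ℝ (fun X => K (f X)) X = deriv K (f X) • fderiv ℝ f X := this.fderiv
  rw [h2]
  simp

theorem gr_apply (f : EE n → ℝ) (X : EE n) (i : Fin n) :
    gradient f X i = fderiv ℝ f X (EuclideanSpace.single i 1) := by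
  have h : (fderiv ℝ f X) (EuclideanSpace.single i 1) =
      inner ℝ (gradient f X) (EuclideanSpace.single i (1 : ℝ)) := by
    rw [← toDual_gradient]; simp
  rw [h, real_inner_comm, EuclideanSpace.inner_single_left]; simp

end grad

namespace Dat
variable {n : ℕ} (D : Dat n)

theorem int_ν_iff {h : EE n → ℝ} : Integrable h D.ν ↔ Integrable (fun X => D.w X * h X) := by
  rw [ν, integrable_withDensity_iff_integrable_smul' D.w_meas.ennreal_ofReal (by simp)]
  simp only [ENNReal.toReal_ofReal (D.w_nonneg _), smul_eq_mul]

theorem int_ν (h : EE n → ℝ) : ∫ X, h X ∂D.ν = ∫ X, D.w X * h X := by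
  rw [ν, integral_withDensity_eq_integral_toReal_smul D.w_meas.ennreal_ofReal (by simp)]
  simp only [ENNReal.toReal_ofReal (D.w_nonneg _), smul_eq_mul]

/-- the energy form -/
noncomputable def a (F G : EE n → EE n) : ℝ :=
  Lam volume (fun X => ∑ i, ∑ j, D.A X i j * F X j * G X i)

theorem a_add_left (F F' G : EE n → EE n) : D.a (fun X => F X + F' X) G = D.a F G + D.a F' G := by
  unfold a
  rw [← map_add]; congr 1; ext X
  simp [mul_add, add_mul, Finset.sum_add_distrib]

theorem a_add_right (F G G' : EE n → EE n) : D.a F (fun X => G X + G' X) = D.a F G + D.a F G' := by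
  unfold a
  rw [← map_add]; congr 1; ext X
  simp [mul_add, Finset.sum_add_distrib]

theorem a_smul_left (c : ℝ) (F G : EE n → EE n) : D.a (fun X => c • F X) G = c * D.a F G := by
  unfold a
  rw [← smul_eq_mul, ← map_smul]; congr 1; ext X
  simp only [PiLp.smul_apply, smul_eq_mul, Pi.smul_apply, Finset.mul_sum]
  refine Finset.sum_congr rfl fun i _ => Finset.sum_congr rfl fun j _ => by ring

theorem a_smul_right (c : ℝ) (F G : EE n → EE n) : D.a F (fun X => c • G X) = c * D.a F G := by
  unfold a
  rw [← smul_eq_mul, ← map_smul]; congr 1; ext X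
  simp only [PiLp.smul_apply, smul_eq_mul, Pi.smul_apply, Finset.mul_sum]
  refine Finset.sum_congr rfl fun i _ => Finset.sum_congr rfl fun j _ => by ring

theorem a_le {F G : EE n → EE n} {k : EE n → ℝ} (hk : Integrable k D.ν)
    (h : ∀ᵐ X, ‖F X‖ * ‖G X‖ ≤ k X) : |D.a F G| ≤ D.C₃ * ∫ X, k X ∂D.ν := by
  rw [int_ν, ← integral_const_mul]
  refine Lam_abs ((D.int_ν_iff.1 hk).const_mul _) ?_
  filter_upwards [h, D.ae_notΓ] with X hX hΓ
  refine (D.hell X hΓ (F X) (G X)).2.trans ?_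
  have := D.w_nonneg X
  have := D.hC₃
  have e : infDist X D.Γ ^ (D.d + 1 - (n : ℝ)) = D.w X := rfl
  rw [e]
  calc D.C₃ * D.w X * ‖F X‖ * ‖G X‖ = D.C₃ * (D.w X * (‖F X‖ * ‖G X‖)) := by ring
    _ ≤ _ := by gcongr

theorem a_ge {F : EE n → EE n} {ψ : EE n → ℝ} (h0 : ∀ᵐ X, 0 ≤ ψ X)
    (hk : Integrable (fun X => ψ X * ‖F X‖ ^ 2) D.ν) :
    D.C₃⁻¹ * ∫ X, ψ X * ‖F X‖ ^ 2 ∂D.ν ≤ D.a F (fun X => ψ X • F X) := by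
  rw [int_ν, ← integral_const_mul]
  refine Lam_ge ((D.int_ν_iff.1 hk).const_mul _) ((D.int_ν_iff.1 hk).const_mul D.C₃) ?_ ?_
  · filter_upwards [h0, D.ae_notΓ] with X hX hΓ
    have h1 := (D.hell X hΓ (F X) (F X)).1
    have e : infDist X D.Γ ^ (D.d + 1 - (n : ℝ)) = D.w X := rfl
    rw [e] at h1
    calc D.C₃⁻¹ * (D.w X * (ψ X * ‖F X‖ ^ 2)) = ψ X * (D.C₃⁻¹ * D.w X * ‖F X‖ ^ 2) := by ring
      _ ≤ ψ X * ∑ i, ∑ j, D.A X i j * F X j * F X i := by gcongr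
      _ = _ := by
        simp only [PiLp.smul_apply, smul_eq_mul, Finset.mul_sum]
        refine Finset.sum_congr rfl fun i _ => Finset.sum_congr rfl fun j _ => by ring
  · filter_upwards [h0, D.ae_notΓ] with X hX hΓ
    have h1 := (D.hell X hΓ (F X) (ψ X • F X)).2
    have e : infDist X D.Γ ^ (D.d + 1 - (n : ℝ)) = D.w X := rfl
    rw [e, norm_smul, Real.norm_of_nonneg hX] at h1
    refine (le_abs_self _).trans (h1.trans (le_of_eq ?_))
    ring

theorem a_congr {F F' G G' : EE n → EE n} (h : F =ᵐ[volume] F') (h' : G =ᵐ[volume] G') :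
    D.a F G = D.a F' G' := by
  unfold a
  rw [← sub_eq_zero, ← map_sub, ← abs_nonpos_iff]
  refine (Lam_abs (g := 0) (integrable_zero _ _ _) ?_).trans (by simp)
  filter_upwards [h, h'] with X h1 h2
  simp [h1, h2]

/-- L² norm -/
noncomputable def N (F : EE n → EE n) : ℝ := (eLpNorm F 2 D.ν).toReal

theorem mul_int {F G : EE n → EE n} (hF : MemLp F 2 D.ν) (hG : MemLp G 2 D.ν) :
    Integrable (fun X => ‖F X‖ * ‖G X‖) D.ν := MemLp.integrable_mul hF.norm hG.norm

theorem mul_int_le {F G : EE n → EE n} (hF : MemLp F 2 D.ν) (hG : MemLp G 2 D.ν) :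
    ∫ X, ‖F X‖ * ‖G X‖ ∂D.ν ≤ D.N F * D.N G := by
  have h := eLpNorm_smul_le_mul_eLpNorm (p := 2) (q := 2) (r := 1) (μ := D.ν) (f := fun X => ‖G X‖)
    (φ := fun X => ‖F X‖) hG.norm.1 hF.norm.1
  rw [eLpNorm_norm, eLpNorm_norm] at h
  have h2 : ∫ X, ‖F X‖ * ‖G X‖ ∂D.ν = (eLpNorm (fun X => ‖F X‖ * ‖G X‖) 1 D.ν).toReal := by
    rw [eLpNorm_one_eq_lintegral_enorm, ← integral_norm_eq_lintegral_enorm (D.mul_int hF hG).1]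
    refine integral_congr_ae (Eventually.of_forall fun X => ?_)
    simp
  rw [h2, N, N, ← ENNReal.toReal_mul]
  exact ENNReal.toReal_mono (ENNReal.mul_ne_top hF.2.ne hG.2.ne) h

theorem a_bound {F G : EE n → EE n} (hF : MemLp F 2 D.ν) (hG : MemLp G 2 D.ν) :
    |D.a F G| ≤ D.C₃ * (D.N F * D.N G) :=
  (D.a_le (D.mul_int hF hG) (Eventually.of_forall fun _ => le_rfl)).trans
    (mul_le_mul_of_nonneg_left (D.mul_int_le hF hG) D.hC₃.le)

theorem N_sq {F : EE n → EE n} (hF : MemLp F 2 D.ν) : D.N F ^ 2 = ∫ X, ‖F X‖ ^ 2 ∂D.ν := by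
  rw [N, hF.eLpNorm_eq_integral_rpow_norm (by norm_num) (by norm_num), ENNReal.toReal_ofReal
    (by positivity)]
  have : 0 ≤ ∫ X, ‖F X‖ ^ 2 ∂D.ν := by positivity
  simp only [ENNReal.toReal_ofNat, Real.rpow_two]
  rw [← Real.rpow_natCast, ← Real.rpow_mul this]; norm_num

/-- multiplication by bounded a.e. convergent sequences -/
theorem conv_mul {F : ℕ → EE n → EE n} {G : EE n → EE n} {b : ℕ → EE n → ℝ} {c : EE n → ℝ} {M : ℝ}
    (hF : ∀ j, MemLp (F j) 2 D.ν) (hG : MemLp G 2 D.ν)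
    (hFG : Tendsto (fun j => eLpNorm (fun X => F j X - G X) 2 D.ν) atTop (𝓝 0))
    (hbm : ∀ j, AEStronglyMeasurable (b j) D.ν) (hb : ∀ j X, |b j X| ≤ M)
    (hbc : ∀ᵐ X ∂D.ν, Tendsto (fun j => b j X) atTop (𝓝 (c X))) :
    MemLp (fun X => c X • G X) 2 D.ν ∧ (∀ j, MemLp (fun X => b j X • F j X) 2 D.ν) ∧
    Tendsto (fun j => eLpNorm (fun X => b j X • F j X - c X • G X) 2 D.ν) atTop (𝓝 0) := by
  have hM : 0 ≤ M := (abs_nonneg _).trans (hb 0 0)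
  have hcm : AEStronglyMeasurable c D.ν := aestronglyMeasurable_of_tendsto_ae atTop hbm hbc
  have hc : ∀ᵐ X ∂D.ν, |c X| ≤ M := by
    filter_upwards [hbc] with X hX
    exact le_of_tendsto hX.abs (Eventually.of_forall fun j => hb j X)
  have hcG : MemLp (fun X => c X • G X) 2 D.ν := by
    refine hG.of_le_mul (c := M) (hcm.smul hG.1) ?_
    filter_upwards [hc] with X hX
    rw [norm_smul]; gcongr; exact hX
  have hbF : ∀ j, MemLp (fun X => b j X • F j X) 2 D.ν := fun j => by
    refine (hF j).of_le_mul (c := M) ((hbm j).smul (hF j).1) (Eventually.of_forall fun X => ?_)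
    rw [norm_smul]; gcongr; exact hb j X
  refine ⟨hcG, hbF, ?_⟩
  have t1 : Tendsto (fun j => ENNReal.ofReal M * eLpNorm (fun X => F j X - G X) 2 D.ν) atTop (𝓝 0) := by
    simpa using ENNReal.Tendsto.const_mul hFG (Or.inr ENNReal.ofReal_ne_top)
  have t2 : Tendsto (fun j => eLpNorm (fun X => (b j X - c X) • G X) 2 D.ν) atTop (𝓝 0) := by
    have hm : ∀ j, AEStronglyMeasurable (fun X => (b j X - c X) • G X) D.ν := fun j =>
      ((hbm j).sub hcm).smul hG.1
    simp_rw [eLpNorm_eq_lintegral_rpow_enorm_toReal (p := 2) (by norm_num) (by norm_num)]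
    have t3 : Tendsto (fun j => ∫⁻ X, ‖(b j X - c X) • G X‖ₑ ^ (2 : ℝ≥0∞).toReal ∂D.ν) atTop
        (𝓝 (∫⁻ X, 0 ∂D.ν)) := by
      refine tendsto_lintegral_of_dominated_convergence'
        (fun X => (ENNReal.ofReal (2 * M) * ‖G X‖ₑ) ^ (2 : ℝ≥0∞).toReal)
        (fun j => (hm j).enorm.pow_const _) ?_ ?_ ?_
      · intro j
        filter_upwards [hc] with X hX
        refine ENNReal.rpow_le_rpow ?_ (by norm_num)
        rw [enorm_smul]
        gcongr
        rw [← ofReal_norm]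
        refine ENNReal.ofReal_le_ofReal ((norm_sub_le _ _).trans ?_)
        have := hb j X
        simp only [Real.norm_eq_abs]; linarith
      · have := hG.const_smul (2 * M)
        have h2 := lintegral_rpow_enorm_lt_top_of_eLpNorm_lt_top (by norm_num) (by norm_num) this.2
        refine ne_of_lt (lt_of_le_of_lt (lintegral_mono fun X => ?_) h2)
        simp only [Pi.smul_apply, enorm_smul]
        rw [← ofReal_norm (2 * M), Real.norm_of_nonneg (by positivity)]
      · filter_upwards [hbc] with X hX
        have h1 : Tendsto (fun j => (b j X - c X) • G X) atTop (𝓝 ((c X - c X) • G X)) :=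
          (hX.sub_const _).smul_const _
        have h2 := (ENNReal.continuous_rpow_const (y := (2 : ℝ≥0∞).toReal)).tendsto _ |>.comp h1.enorm
        simpa [Function.comp_def] using h2
    have := ((ENNReal.continuous_rpow_const (y := (1 / (2 : ℝ≥0∞).toReal))).tendsto _).comp t3
    simpa [Function.comp_def] using this
  refine tendsto_of_tendsto_of_tendsto_of_le_of_le tendsto_const_nhds (by simpa using t1.add t2)
    (fun j => zero_le) fun j => ?_
  have e : (fun X => b j X • F j X - c X • G X) =
      (fun X => b j X • (F j X - G X)) + fun X => (b j X - c X) • G X := by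
    ext1 X; simp only [Pi.add_apply]; module
  show eLpNorm _ _ _ ≤ _
  rw [e]
  refine (eLpNorm_add_le ((hbm j).smul ((hF j).1.sub hG.1)) (((hbm j).sub hcm).smul hG.1)
    (by norm_num)).trans ?_
  refine add_le_add ?_ le_rfl
  refine eLpNorm_le_mul_eLpNorm_of_ae_le_mul (Eventually.of_forall fun X => ?_) _
  show ‖b j X • (F j X - G X)‖ ≤ _
  rw [norm_smul]; gcongr; exact hb j X

end Dat

end Part5

section Part6

/-- approximation of a function with data `g` -/
structure App0 {n : ℕ} (D : Dat n) (u : EE n → ℝ) (G : EE n → EE n) (g : EE n → ℝ)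
    (v : ℕ → EE n → ℝ) : Prop where
  hg : ContDiff ℝ 1 g
  hv : ∀ j, ContDiff ℝ 1 (v j)
  hK : ∀ j, ∃ K : Set (EE n), IsCompact K ∧ K ⊆ D.Γᶜ ∧ ∀ X ∉ K, v j X = g X
  hl : ∀ᵐ X, Tendsto (fun j => v j X) atTop (𝓝 (u X))
  hG : MemLp G 2 D.ν
  hvG : ∀ j, MemLp (gradient (v j)) 2 D.ν
  hc : Tendsto (fun j => eLpNorm (fun X => gradient (v j) X - G X) 2 D.ν) atTop (𝓝 0)

structure App {n : ℕ} (D : Dat n) (u : EE n → ℝ) (G : EE n → EE n) (g : EE n → ℝ)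
    (v : ℕ → EE n → ℝ) : Prop extends App0 D u G g v where
  hb : ∃ M : ℝ, ∀ j X, |v j X| ≤ M

variable {n : ℕ} {D : Dat n} {u u' g g' : EE n → ℝ} {G G' : EE n → EE n} {v v' : ℕ → EE n → ℝ}

theorem App0.comp (h : App0 D u G g v) {K : ℝ → ℝ} (hK : ContDiff ℝ 1 K) {M : ℝ}
    (hM : ∀ j X, |K (v j X)| ≤ M ∧ |deriv K (v j X)| ≤ M) :
    App D (fun X => K (u X)) (fun X => deriv K (u X) • G X) (fun X => K (g X))
      (fun j X => K (v j X)) := by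
  have hdK : Continuous (deriv K) := hK.continuous_deriv le_rfl
  have := D.conv_mul h.hvG h.hG h.hc (b := fun j X => deriv K (v j X)) (c := fun X => deriv K (u X))
    (M := M) (fun j => (hdK.comp (h.hv j).continuous).aestronglyMeasurable) (fun j X => (hM j X).2)
    (by
      refine D.ν_ac.ae_le ?_
      filter_upwards [h.hl] with X hX
      exact (hdK.tendsto _).comp hX)
  have e : ∀ j, gradient (fun X => K (v j X)) = fun X => deriv K (v j X) • gradient (v j) X :=
    fun j => funext fun X => gr_comp (h.hv j) hK X
  refine ⟨⟨hK.comp h.hg, fun j => hK.comp (h.hv j), fun j => ?_, ?_, this.1, fun j => ?_, ?_⟩,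
    M, fun j X => (hM j X).1⟩
  · obtain ⟨S, h1, h2, h3⟩ := h.hK j
    exact ⟨S, h1, h2, fun X hX => by rw [h3 X hX]⟩
  · filter_upwards [h.hl] with X hX
    exact (hK.continuous.tendsto _).comp hX
  · rw [e]; exact this.2.1 j
  · simp_rw [e]; exact this.2.2

theorem App.comp (h : App D u G g v) {K : ℝ → ℝ} (hK : ContDiff ℝ 1 K) :
    App D (fun X => K (u X)) (fun X => deriv K (u X) • G X) (fun X => K (g X))
      (fun j X => K (v j X)) := by
  obtain ⟨M, hM⟩ := h.hb
  obtain ⟨B, hB⟩ := (isCompact_Icc (a := -M) (b := M)).exists_bound_of_continuousOn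
    hK.continuous.continuousOn
  obtain ⟨B', hB'⟩ := (isCompact_Icc (a := -M) (b := M)).exists_bound_of_continuousOn
    (hK.continuous_deriv le_rfl).continuousOn
  exact h.toApp0.comp hK (M := max B B') fun j X =>
    ⟨(hB _ (abs_le.1 (hM j X))).trans (le_max_left _ _),
      (hB' _ (abs_le.1 (hM j X))).trans (le_max_right _ _)⟩

theorem App0.aem (h : App0 D u G g v) : AEStronglyMeasurable u volume :=
  aestronglyMeasurable_of_tendsto_ae atTop (fun j => (h.hv j).continuous.aestronglyMeasurable) h.hl

theorem App.mul (h : App D u G g v) (h' : App D u' G' g' v') :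
    App D (fun X => u X * u' X) (fun X => u X • G' X + u' X • G X) (fun X => g X * g' X)
      (fun j X => v j X * v' j X) := by
  obtain ⟨M, hM⟩ := h.hb
  obtain ⟨M', hM'⟩ := h'.hb
  have c1 := D.conv_mul h'.hvG h'.hG h'.hc (b := v) (c := u) (M := M)
    (fun j => (h.hv j).continuous.aestronglyMeasurable) hM (D.ν_ac.ae_le h.hl)
  have c2 := D.conv_mul h.hvG h.hG h.hc (b := v') (c := u') (M := M')
    (fun j => (h'.hv j).continuous.aestronglyMeasurable) hM' (D.ν_ac.ae_le h'.hl)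
  have e : ∀ j, gradient (fun X => v j X * v' j X) =
      fun X => v j X • gradient (v' j) X + v' j X • gradient (v j) X :=
    fun j => funext fun X => gr_mul (h.hv j) (h'.hv j) X
  refine ⟨⟨h.hg.mul h'.hg, fun j => (h.hv j).mul (h'.hv j), fun j => ?_, ?_, c1.1.add c2.1,
    fun j => ?_, ?_⟩, M * M', fun j X => ?_⟩
  · obtain ⟨S, h1, h2, h3⟩ := h.hK j
    obtain ⟨S', h1', h2', h3'⟩ := h'.hK j
    refine ⟨S ∪ S', h1.union h1', union_subset h2 h2', fun X hX => ?_⟩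
    rw [h3 X fun h => hX (Or.inl h), h3' X fun h => hX (Or.inr h)]
  · filter_upwards [h.hl, h'.hl] with X hX hX'
    exact hX.mul hX'
  · rw [e]; exact (c1.2.1 j).add (c2.2.1 j)
  · simp_rw [e]
    refine tendsto_of_tendsto_of_tendsto_of_le_of_le tendsto_const_nhds
      (by simpa using c1.2.2.add c2.2.2) (fun j => zero_le) fun j => ?_
    refine le_trans (le_of_eq ?_) (eLpNorm_add_le ((c1.2.1 j).1.sub c1.1.1)
      ((c2.2.1 j).1.sub c2.1.1) (by norm_num))
    congr 1; ext1 X; simp only [Pi.add_apply]; abel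
  · rw [abs_mul]
    exact mul_le_mul (hM j X) (hM' j X) (abs_nonneg _) ((abs_nonneg _).trans (hM j X))

theorem App.add (h : App D u G g v) (h' : App D u' G' g' v') :
    App D (fun X => u X + u' X) (fun X => G X + G' X) (fun X => g X + g' X)
      (fun j X => v j X + v' j X) := by
  obtain ⟨M, hM⟩ := h.hb
  obtain ⟨M', hM'⟩ := h'.hb
  have e : ∀ j, gradient (fun X => v j X + v' j X) =
      fun X => gradient (v j) X + gradient (v' j) X :=
    fun j => funext fun X => gr_add (h.hv j) (h'.hv j) X
  refine ⟨⟨h.hg.add h'.hg, fun j => (h.hv j).add (h'.hv j), fun j => ?_, ?_, h.hG.add h'.hG,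
    fun j => ?_, ?_⟩, M + M', fun j X => ?_⟩
  · obtain ⟨S, h1, h2, h3⟩ := h.hK j
    obtain ⟨S', h1', h2', h3'⟩ := h'.hK j
    refine ⟨S ∪ S', h1.union h1', union_subset h2 h2', fun X hX => ?_⟩
    rw [h3 X fun h => hX (Or.inl h), h3' X fun h => hX (Or.inr h)]
  · filter_upwards [h.hl, h'.hl] with X hX hX'
    exact hX.add hX'
  · rw [e]; exact (h.hvG j).add (h'.hvG j)
  · simp_rw [e]
    refine tendsto_of_tendsto_of_tendsto_of_le_of_le tendsto_const_nhds
      (by simpa using h.hc.add h'.hc) (fun j => zero_le) fun j => ?_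
    refine le_trans (le_of_eq ?_) (eLpNorm_add_le ((h.hvG j).1.sub h.hG.1)
      ((h'.hvG j).1.sub h'.hG.1) (by norm_num))
    congr 1; ext1 X; simp only [Pi.add_apply]; abel
  · exact (abs_add_le _ _).trans (add_le_add (hM j X) (hM' j X))

theorem gr_memLp {η : EE n → ℝ} (hη : ContDiff ℝ 1 η) (hs : HasCompactSupport η) :
    MemLp (gradient η) 2 D.ν := by
  refine (gr_cont hη).memLp_of_hasCompactSupport ?_
  refine (hs.fderiv (𝕜 := ℝ)).comp_left
    (g := (InnerProductSpace.toDual ℝ (EE n)).symm) (map_zero _)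

theorem App.cut {η : EE n → ℝ} (hη : ContDiff ℝ 1 η) (hs : HasCompactSupport η) :
    App D η (gradient η) η (fun _ => η) := by
  refine ⟨⟨hη, fun _ => hη, fun j => ⟨∅, isCompact_empty, empty_subset _, fun X _ => rfl⟩,
    Eventually.of_forall fun X => tendsto_const_nhds, gr_memLp hη hs, fun j => gr_memLp hη hs,
    by simp⟩, ?_⟩
  obtain ⟨C, hC⟩ := hs.exists_bound_of_continuous hη.continuous
  exact ⟨C, fun j X => hC X⟩

theorem App.congr (h : App D u G g v) (hu : u =ᵐ[volume] u') (hG : G =ᵐ[volume] G') :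
    App D u' G' g v := by
  have hG' : G =ᵐ[D.ν] G' := D.ν_ac.ae_eq hG
  refine ⟨⟨h.hg, h.hv, h.hK, ?_, h.hG.ae_eq hG', h.hvG, ?_⟩, h.hb⟩
  · filter_upwards [h.hl, hu] with X h1 h2
    rwa [← h2]
  · convert h.hc using 2 with j
    refine eLpNorm_congr_ae ?_
    filter_upwards [hG'] with X hX
    rw [hX]

def Wk (D : Dat n) (G : EE n → EE n) : Prop :=
  ∀ φ : EE n → ℝ, ContDiff ℝ 1 φ → HasCompactSupport φ → tsupport φ ⊆ D.Γᶜ → D.a G (gradient φ) = 0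

def Sol (D : Dat n) (u : EE n → ℝ) (G : EE n → EE n) (g : EE n → ℝ) : Prop :=
  (∃ v, App D u G g v) ∧ Wk D G

theorem test0 (hWk : Wk D G) (hG : MemLp G 2 D.ν) {f k : EE n → ℝ} {F : EE n → EE n}
    {v : ℕ → EE n → ℝ} (h : App0 D f F k v)
    (hk : ∃ K : Set (EE n), IsCompact K ∧ K ⊆ D.Γᶜ ∧ ∀ X ∉ K, k X = 0) : D.a G F = 0 := by
  obtain ⟨K0, h1, h2, h3⟩ := hk
  have hz : ∀ j, D.a G (gradient (v j)) = 0 := by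
    intro j
    obtain ⟨K, h1', h2', h3'⟩ := h.hK j
    have hs : Function.support (v j) ⊆ K0 ∪ K := by
      intro X hX
      by_contra hn
      refine hX ?_
      rw [h3' X fun h => hn (Or.inr h), h3 X fun h => hn (Or.inl h)]
    refine hWk _ (h.hv j) (HasCompactSupport.of_support_subset_isCompact (h1.union h1') hs) ?_
    exact (closure_minimal hs (h1.union h1').isClosed).trans (union_subset h2 h2')
  have hb : ∀ j, |D.a G F| ≤ D.C₃ * (D.N G * D.N (fun X => gradient (v j) X - F X)) := by
    intro j
    have e : D.a G (fun X => gradient (v j) X - F X) = - D.a G F := by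
      have e1 : (fun X => gradient (v j) X - F X) =
        fun X => gradient (v j) X + (-1 : ℝ) • F X := by ext1 X; module
      rw [e1, D.a_add_right, D.a_smul_right, hz]; ring
    rw [← abs_neg, ← e]
    exact D.a_bound hG ((h.hvG j).sub h.hG)
  have ht : Tendsto (fun j => D.C₃ * (D.N G * D.N (fun X => gradient (v j) X - F X))) atTop (𝓝 0) := by
    have := (ENNReal.tendsto_toReal ENNReal.zero_ne_top).comp h.hc
    simpa [Dat.N] using (this.const_mul (D.N G)).const_mul D.C₃
  have := ge_of_tendsto' ht hb
  exact abs_nonpos_iff.1 this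

theorem Sol.test (hS : Sol D u G g) {f k : EE n → ℝ} {F : EE n → EE n} {v : ℕ → EE n → ℝ}
    (h : App D f F k v)
    (hk : ∃ K : Set (EE n), IsCompact K ∧ K ⊆ D.Γᶜ ∧ ∀ X ∉ K, k X = 0) : D.a G F = 0 :=
  test0 hS.2 hS.1.choose_spec.hG h.toApp0 hk

theorem Sol.aem (hS : Sol D u G g) : AEStronglyMeasurable u volume := hS.1.choose_spec.aem
theorem Sol.memLp (hS : Sol D u G g) : MemLp G 2 D.ν := hS.1.choose_spec.hG
theorem Sol.cd (hS : Sol D u G g) : ContDiff ℝ 1 g := hS.1.choose_spec.hg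

theorem Sol.affine (hS : Sol D u G g) (c e : ℝ) :
    Sol D (fun X => c * u X + e) (fun X => c • G X) (fun X => c * g X + e) := by
  obtain ⟨⟨v, hv⟩, h2⟩ := hS
  refine ⟨⟨fun j X => c * v j X + e, ?_⟩, fun φ h3 h4 h5 => by rw [D.a_smul_left, h2 φ h3 h4 h5, mul_zero]⟩
  have := hv.comp (K := fun t => c * t + e) (by fun_prop)
  have hd : ∀ t, deriv (fun t : ℝ => c * t + e) t = c := fun t => by simp
  simpa only [hd] using this

theorem Sol.add (hS : Sol D u G g) (hS' : Sol D u' G' g') :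
    Sol D (fun X => u X + u' X) (fun X => G X + G' X) (fun X => g X + g' X) :=
  ⟨⟨_, hS.1.choose_spec.add hS'.1.choose_spec⟩, fun φ h3 h4 h5 => by
    rw [D.a_add_left, hS.2 φ h3 h4 h5, hS'.2 φ h3 h4 h5, add_zero]⟩

end Part6

section Part7

variable {n : ℕ} {D : Dat n} {u u' g g' : EE n → ℝ} {G G' : EE n → EE n} {v v' : ℕ → EE n → ℝ}

theorem Sol.bd (hS : Sol D u G g) {K : ℝ → ℝ} (hK : Continuous K) :
    ∃ B : ℝ, 0 ≤ B ∧ ∀ᵐ X, |K (u X)| ≤ B := by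
  obtain ⟨v, hv⟩ := hS.1
  obtain ⟨M, hM⟩ := hv.hb
  obtain ⟨B, hB⟩ := (isCompact_Icc (a := -M) (b := M)).exists_bound_of_continuousOn hK.continuousOn
  refine ⟨max B 0, le_max_right _ _, ?_⟩
  filter_upwards [hv.hl] with X hX
  have := le_of_tendsto hX.abs (Eventually.of_forall fun j => hM j X)
  exact (hB _ (abs_le.1 this)).trans (le_max_left _ _)

theorem int_bdd_mul {b k : EE n → ℝ} {μ : Measure (EE n)} (hk : Integrable k μ)
    (hb : AEStronglyMeasurable b μ) {B : ℝ} (hB : ∀ᵐ X ∂μ, |b X| ≤ B) :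
    Integrable (fun X => b X * k X) μ := hk.bdd_mul hb hB

theorem Sol.cacc (hS : Sol D u G g) {η : EE n → ℝ} (hη : ContDiff ℝ 1 η) (hs : HasCompactSupport η)
    {P q h : ℝ → ℝ} (hP : ContDiff ℝ 1 P) (hq : Continuous q) (hh : Continuous h)
    (hae : ∀ᵐ X, η X ≠ 0 → q (u X) ^ 2 ≤ deriv P (u X) ∧ |P (u X)| ≤ |q (u X)| * h (u X))
    (hk : ∃ K : Set (EE n), IsCompact K ∧ K ⊆ D.Γᶜ ∧ ∀ X ∉ K, η X ^ 2 * P (g X) = 0) :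
    Integrable (fun X => η X ^ 2 * q (u X) ^ 2 * ‖G X‖ ^ 2) D.ν ∧
    Integrable (fun X => h (u X) ^ 2 * ‖gradient η X‖ ^ 2) D.ν ∧
    ∫ X, η X ^ 2 * q (u X) ^ 2 * ‖G X‖ ^ 2 ∂D.ν ≤
      4 * D.C₃ ^ 4 * ∫ X, h (u X) ^ 2 * ‖gradient η X‖ ^ 2 ∂D.ν := by
  have hC := D.hC₃
  obtain ⟨C, hCη⟩ := hs.exists_bound_of_continuous hη.continuous
  have hum : AEStronglyMeasurable u D.ν := hS.aem.mono_ac D.ν_ac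
  have hdP : Continuous (deriv P) := hP.continuous_deriv le_rfl
  have hG2 : Integrable (fun X => ‖G X‖ ^ 2) D.ν := (memLp_two_iff_integrable_sq_norm hS.memLp.1).1 hS.memLp
  have hE2 : Integrable (fun X => ‖gradient η X‖ ^ 2) D.ν :=
    (memLp_two_iff_integrable_sq_norm (gr_cont hη).aestronglyMeasurable).1 (gr_memLp hη hs)
  have bη : ∀ K : ℝ → ℝ, Continuous K → Integrable (fun X => η X ^ 2 * K (u X) * ‖G X‖ ^ 2) D.ν := by
    intro K hK
    obtain ⟨B, hB0, hB⟩ := hS.bd hK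
    refine int_bdd_mul hG2 (((hη.continuous.pow 2).aestronglyMeasurable).mul
      (hK.comp_aestronglyMeasurable hum)) (B := C ^ 2 * B) ?_
    filter_upwards [D.ν_ac.ae_le hB] with X hX
    rw [abs_mul, abs_pow]
    gcongr
    exact hCη X
  have i1 := bη (fun t => q t ^ 2) (hq.pow 2)
  have i2 := bη (deriv P) hdP
  have i3 : Integrable (fun X => h (u X) ^ 2 * ‖gradient η X‖ ^ 2) D.ν := by
    obtain ⟨B, hB0, hB⟩ := hS.bd (hh.pow 2)
    exact int_bdd_mul hE2 ((hh.pow 2).comp_aestronglyMeasurable hum) (D.ν_ac.ae_le hB)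
  refine ⟨i1, i3, ?_⟩
  obtain ⟨v, hv⟩ := hS.1
  have t0 := hS.test (((App.cut hη hs).mul (App.cut hη hs)).mul (hv.comp hP)) (by
    obtain ⟨K, h1, h2, h3⟩ := hk
    refine ⟨K, h1, h2, fun X hX => ?_⟩
    rw [← h3 X hX]; ring)
  have e : (fun X => (η X * η X) • deriv P (u X) • G X + P (u X) • (η X • gradient η X + η X • gradient η X))
      = fun X => (η X ^ 2 * deriv P (u X)) • G X + (2 * η X * P (u X)) • gradient η X := by
    ext1 X; module
  rw [e, D.a_add_right] at t0
  have t1 := D.a_ge (F := G) (ψ := fun X => η X ^ 2 * deriv P (u X)) (by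
    filter_upwards [hae] with X hX
    by_cases h0 : η X = 0
    · simp [h0]
    · have := (sq_nonneg _).trans (hX h0).1
      positivity) i2
  have t2 := D.a_le (F := G) (G := fun X => (2 * η X * P (u X)) • gradient η X)
    ((i1.const_mul (2⁻¹ * D.C₃⁻¹ ^ 2)).add (i3.const_mul (2 * D.C₃ ^ 2))) (by
    filter_upwards [hae] with X hX
    simp only [Pi.add_apply, norm_smul, norm_mul, Real.norm_eq_abs]
    by_cases h0 : η X = 0
    · simp only [h0, abs_zero]
      have : 0 ≤ 2 * D.C₃ ^ 2 * (h (u X) ^ 2 * ‖gradient η X‖ ^ 2) := by positivity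
      simpa using this
    · have h1 := (hX h0).2
      set x := |η X| * |q (u X)| * ‖G X‖
      set y := h (u X) * ‖gradient η X‖
      have hx : ‖G X‖ * (|2| * |η X| * |P (u X)| * ‖gradient η X‖) ≤ 2 * x * y := by
        calc ‖G X‖ * (|2| * |η X| * |P (u X)| * ‖gradient η X‖)
            ≤ ‖G X‖ * (|2| * |η X| * (|q (u X)| * h (u X)) * ‖gradient η X‖) := by gcongr
          _ = _ := by simp only [x, y, abs_two]; ring
      have hxy : 2 * x * y ≤ 2⁻¹ * D.C₃⁻¹ ^ 2 * x ^ 2 + 2 * D.C₃ ^ 2 * y ^ 2 := by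
        have := sq_nonneg (D.C₃⁻¹ * x - 2 * D.C₃ * y)
        have e3 : D.C₃⁻¹ * D.C₃ = 1 := inv_mul_cancel₀ hC.ne'
        have e4 : (D.C₃⁻¹ * x - 2 * D.C₃ * y) ^ 2 =
          D.C₃⁻¹ ^ 2 * x ^ 2 - 4 * (D.C₃⁻¹ * D.C₃) * x * y + 4 * D.C₃ ^ 2 * y ^ 2 := by ring
        rw [e4, e3] at this
        linarith
      refine hx.trans (hxy.trans (le_of_eq ?_))
      simp only [x, y, mul_pow, sq_abs])
  rw [integral_add' (i1.const_mul _) (i3.const_mul _), integral_const_mul, integral_const_mul] at t2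
  have t3 : ∫ X, η X ^ 2 * q (u X) ^ 2 * ‖G X‖ ^ 2 ∂D.ν ≤
      ∫ X, η X ^ 2 * deriv P (u X) * ‖G X‖ ^ 2 ∂D.ν := by
    refine integral_mono_ae i1 i2 ?_
    filter_upwards [D.ν_ac.ae_le hae] with X hX
    by_cases h0 : η X = 0
    · simp [h0]
    · have := (hX h0).1
      gcongr
  set I := ∫ X, η X ^ 2 * q (u X) ^ 2 * ‖G X‖ ^ 2 ∂D.ν
  set J := ∫ X, h (u X) ^ 2 * ‖gradient η X‖ ^ 2 ∂D.ν
  have t4 : D.C₃⁻¹ * I ≤ D.C₃ * (2⁻¹ * D.C₃⁻¹ ^ 2 * I + 2 * D.C₃ ^ 2 * J) := by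
    refine (mul_le_mul_of_nonneg_left t3 (by positivity)).trans (t1.trans (le_trans ?_ t2))
    rw [← eq_neg_iff_add_eq_zero] at t0
    rw [t0]
    exact neg_le_abs _
  have e5 : D.C₃ * (2⁻¹ * D.C₃⁻¹ ^ 2 * I + 2 * D.C₃ ^ 2 * J) =
    D.C₃⁻¹ * (2⁻¹ * I + 2 * D.C₃ ^ 4 * J) := by field_simp
  rw [e5] at t4
  have := le_of_mul_le_mul_left t4 (by positivity)
  linarith

end Part7

section Part8

theorem sT_deriv : ∃ L : ℝ, 0 < L ∧ (∀ t, |deriv Real.smoothTransition t| ≤ L) ∧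
    ∀ t ≤ 0, deriv Real.smoothTransition t = 0 := by
  have hz : ∀ t ≤ 0, deriv Real.smoothTransition t = 0 := fun t ht =>
    IsLocalMin.deriv_eq_zero (Eventually.of_forall fun s => by
      rw [Real.smoothTransition.zero_of_nonpos ht]; exact Real.smoothTransition.nonneg s)
  have h1 : ∀ t, 1 ≤ t → deriv Real.smoothTransition t = 0 := fun t ht =>
    IsLocalMax.deriv_eq_zero (Eventually.of_forall fun s => by
      rw [Real.smoothTransition.one_of_one_le ht]; exact Real.smoothTransition.le_one s)
  obtain ⟨B, hB⟩ := (isCompact_Icc (a := (0 : ℝ)) (b := 1)).exists_bound_of_continuousOn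
    ((Real.smoothTransition.contDiff (n := 1)).continuous_deriv le_rfl).continuousOn
  refine ⟨max B 1, by positivity, fun t => ?_, hz⟩
  rcases le_or_gt t 0 with h | h
  · rw [hz t h]; simp
  rcases le_or_gt 1 t with h' | h'
  · rw [h1 t h']; simp
  · exact (hB t ⟨h.le, h'.le⟩).trans (le_max_left _ _)

noncomputable def Lc : ℝ := 2 * sT_deriv.choose
theorem Lc_pos : 0 < Lc := mul_pos two_pos sT_deriv.choose_spec.1

theorem cutoff {n : ℕ} (P : EE n) {a b : ℝ} (ha : 0 ≤ a) (hab : a < b) :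
    ∃ η : EE n → ℝ, ContDiff ℝ 1 η ∧ HasCompactSupport η ∧ (∀ X, 0 ≤ η X ∧ η X ≤ 1) ∧
      (∀ X, dist X P ≤ a → η X = 1) ∧ (∀ X, b ≤ dist X P → η X = 0 ∧ gradient η X = 0) ∧
      ∀ X, ‖gradient η X‖ ≤ Lc / (b - a) := by
  obtain ⟨hL, hd, hz⟩ := sT_deriv.choose_spec
  set L := sT_deriv.choose
  have hb : 0 < b := ha.trans_lt hab
  have hba : 0 < b ^ 2 - a ^ 2 := by nlinarith
  set T : EE n → ℝ := fun X => (b ^ 2 - ‖X - P‖ ^ 2) / (b ^ 2 - a ^ 2) with hT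
  have hTc : ContDiff ℝ 1 T := by
    refine ContDiff.div_const (contDiff_const.sub ?_) _
    exact (contDiff_id.sub contDiff_const).norm_sq ℝ
  have hTd : ∀ X, ‖gradient T X‖ = 2 * ‖X - P‖ / (b ^ 2 - a ^ 2) := by
    intro X
    rw [gr_norm]
    have h1 : HasFDerivAt (fun X : EE n => ‖X - P‖ ^ 2) (2 • (innerSL ℝ (X - P))) X := by
      simpa using ((hasFDerivAt_id X).sub_const P).norm_sq
    have h2 : fderiv ℝ T X = -((b ^ 2 - a ^ 2)⁻¹ • (2 • (innerSL ℝ (X - P)))) := by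
      have h3 := (h1.const_sub (b ^ 2)).mul_const (b ^ 2 - a ^ 2)⁻¹
      have h4 := h3.fderiv
      rw [hT]
      simp only [div_eq_mul_inv]
      rw [h4, smul_neg]
    rw [h2, norm_neg, norm_smul, ← Nat.cast_smul_eq_nsmul ℝ, norm_smul, innerSL_apply_norm,
      norm_inv, Real.norm_of_nonneg hba.le]
    simp; ring
  have hTb : ∀ X, b ≤ dist X P → T X ≤ 0 := fun X hX => by
    rw [dist_eq_norm] at hX
    exact div_nonpos_of_nonpos_of_nonneg (by nlinarith) hba.le
  have hgr : ∀ X, gradient (fun X => Real.smoothTransition (T X)) X =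
      deriv Real.smoothTransition (T X) • gradient T X := fun X =>
    gr_comp hTc (Real.smoothTransition.contDiff) X
  have hg0 : ∀ X, b ≤ dist X P → gradient (fun X => Real.smoothTransition (T X)) X = 0 :=
    fun X hX => by rw [hgr, hz _ (hTb X hX), zero_smul]
  refine ⟨fun X => Real.smoothTransition (T X), Real.smoothTransition.contDiff.comp hTc, ?_,
    fun X => ⟨Real.smoothTransition.nonneg _, Real.smoothTransition.le_one _⟩, ?_, ?_, ?_⟩
  · refine HasCompactSupport.of_support_subset_isCompact (isCompact_closedBall P b) fun X hX => ?_
    by_contra h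
    rw [mem_closedBall, not_le] at h
    exact hX (Real.smoothTransition.zero_of_nonpos (hTb X h.le))
  · intro X hX
    refine Real.smoothTransition.one_of_one_le ?_
    rw [dist_eq_norm] at hX
    rw [hT]; simp only
    rw [le_div_iff₀ hba]
    nlinarith [norm_nonneg (X - P)]
  · exact fun X hX => ⟨Real.smoothTransition.zero_of_nonpos (hTb X hX), hg0 X hX⟩
  · intro X
    have hp : 0 < Lc / (b - a) := div_pos Lc_pos (by linarith)
    rcases le_or_gt b (dist X P) with h | h
    · rw [hg0 X h]; simpa using hp.le
    · rw [hgr, norm_smul, hTd]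
      rw [dist_eq_norm] at h
      calc ‖deriv Real.smoothTransition (T X)‖ * (2 * ‖X - P‖ / (b ^ 2 - a ^ 2))
          ≤ L * (2 * (b + a) / (b ^ 2 - a ^ 2)) := by
            gcongr
            · exact hd _
            · linarith
        _ = Lc / (b - a) := by
            have e : b ^ 2 - a ^ 2 = (b - a) * (b + a) := by ring
            have h1 : b - a ≠ 0 := by linarith
            have h2 : b + a ≠ 0 := by linarith
            rw [e, Lc]; field_simp; simp only [L]

variable {n : ℕ} {D : Dat n} {u u' g g' : EE n → ℝ} {G G' : EE n → EE n} {v v' : ℕ → EE n → ℝ}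

/-- comparability of the weight on Whitney balls -/
theorem Dat.w_whit (D : Dat n) {P Z : EE n} {R : ℝ} (hR : 0 < R) (hP : 2 * R ≤ D.δ P)
    (hZ : dist Z P ≤ R) : 2 ^ D.β * D.w P ≤ D.w Z ∧ D.w Z ≤ 2⁻¹ ^ D.β * D.w P := by
  have h1 := D.δ_lip P Z
  have h2 := D.δ_lip Z P
  rw [dist_comm] at h1
  have hp : 0 < D.δ P := by linarith
  have hz : 0 < D.δ Z := by linarith
  unfold Dat.w
  rw [← Real.mul_rpow (by norm_num) hp.le, ← Real.mul_rpow (by norm_num) hp.le]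
  exact ⟨Real.rpow_le_rpow_of_nonpos hz (by linarith) D.β_neg.le,
    Real.rpow_le_rpow_of_nonpos (by positivity) (by linarith) D.β_neg.le⟩

theorem Dat.lint_whit (D : Dat n) {P : EE n} {R : ℝ} (hR : 0 < R) (hP : 2 * R ≤ D.δ P)
    {S : Set (EE n)} (hS : MeasurableSet S) (hSP : S ⊆ closedBall P R) {h : EE n → ℝ≥0∞}
    (hh : AEMeasurable h) :
    ENNReal.ofReal (2 ^ D.β * D.w P) * ∫⁻ X in S, h X ≤ ∫⁻ X in S, h X ∂D.ν ∧
    ∫⁻ X in S, h X ∂D.ν ≤ ENNReal.ofReal (2⁻¹ ^ D.β * D.w P) * ∫⁻ X in S, h X := by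
  rw [D.lint_ν hh hS, ← lintegral_const_mul' _ _ ENNReal.ofReal_ne_top,
    ← lintegral_const_mul' _ _ ENNReal.ofReal_ne_top]
  constructor
  · refine setLIntegral_mono' hS fun X hX => ?_
    rw [mul_comm]; gcongr; exact (D.w_whit hR hP (hSP hX)).1
  · refine setLIntegral_mono' hS fun X hX => ?_
    rw [mul_comm]; gcongr; exact (D.w_whit hR hP (hSP hX)).2

/-- the error in `L¹(S, ν)` -/
theorem App0.err (h : App0 D u G g v) {S : Set (EE n)} (hSf : D.ν S ≠ ⊤) :
    Tendsto (fun j => ∫⁻ X in S, ‖gradient (v j) X - G X‖ₑ ∂D.ν) atTop (𝓝 0) := by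
  have h1 : ∀ j, ∫⁻ X in S, ‖gradient (v j) X - G X‖ₑ ∂D.ν ≤
      eLpNorm (fun X => gradient (v j) X - G X) 2 D.ν * D.ν S ^ (1 / (1:ℝ≥0∞).toReal - 1 / (2:ℝ≥0∞).toReal) := by
    intro j
    rw [← eLpNorm_one_eq_lintegral_enorm]
    refine (eLpNorm_le_eLpNorm_mul_rpow_measure_univ (p := 1) (q := 2) (by norm_num)
      (((h.hvG j).1.sub h.hG.1).restrict)).trans ?_
    rw [Measure.restrict_apply_univ]
    gcongr
    exact eLpNorm_mono_measure _ Measure.restrict_le_self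
  refine tendsto_of_tendsto_of_tendsto_of_le_of_le tendsto_const_nhds ?_ (fun j => zero_le) h1
  have hne : D.ν S ^ (1 / (1:ℝ≥0∞).toReal - 1 / (2:ℝ≥0∞).toReal) ≠ ⊤ :=
    ENNReal.rpow_ne_top_of_nonneg (by norm_num) hSf
  simpa using ENNReal.Tendsto.mul_const h.hc (Or.inr hne)

theorem App0.grad_le (_h : App0 D u G g v) (S : Set (EE n)) (ρ : Measure (EE n)) (hρ : ρ ≪ volume) (j : ℕ) :
    ∫⁻ X in S, ‖gradient (v j) X‖ₑ ∂ρ ≤ ∫⁻ X in S, ‖G X‖ₑ ∂ρ +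
      ∫⁻ X in S, ‖gradient (v j) X - G X‖ₑ ∂ρ := by
  have hm : AEMeasurable (fun X => ‖G X‖ₑ) (ρ.restrict S) :=
    (((_h.hG.1.mono_ac D.ac_ν).mono_ac hρ).restrict).enorm
  rw [← lintegral_add_left' hm]
  refine lintegral_mono fun X => ?_
  calc ‖gradient (v j) X‖ₑ = ‖G X + (gradient (v j) X - G X)‖ₑ := by congr 1; abel
    _ ≤ _ := enorm_add_le _ _

/-- error in `L¹(S, vol)` on Whitney balls -/
theorem App0.err_vol (h : App0 D u G g v) {P : EE n} {R : ℝ} (hR : 0 < R) (hP : 2 * R ≤ D.δ P)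
    {S : Set (EE n)} (hS : MeasurableSet S) (hSP : S ⊆ closedBall P R) :
    Tendsto (fun j => ∫⁻ X in S, ‖gradient (v j) X - G X‖ₑ) atTop (𝓝 0) := by
  have hw : 0 < 2 ^ D.β * D.w P := mul_pos (by positivity)
    (Real.rpow_pos_of_pos (by linarith) _)
  have hfin : D.ν S ≠ ⊤ := ne_top_of_le_ne_top (isCompact_closedBall P R).measure_lt_top.ne
    (measure_mono hSP)
  have h1 := h.err hfin
  have hc : (ENNReal.ofReal (2 ^ D.β * D.w P))⁻¹ ≠ ⊤ := by
    simpa using hw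
  refine tendsto_of_tendsto_of_tendsto_of_le_of_le tendsto_const_nhds
    (by simpa using ENNReal.Tendsto.const_mul h1 (Or.inr hc)) (fun j => zero_le) fun j => ?_
  simp only
  rw [← ENNReal.mul_le_iff_le_inv (by simpa using hw) ENNReal.ofReal_ne_top]
  exact (D.lint_whit hR hP hS hSP (((gr_cont (h.hv j)).aestronglyMeasurable.sub
    (h.hG.1.mono_ac D.ac_ν)).enorm)).1

theorem lim_le {α : Type*} [MeasurableSpace α] {μ : Measure α} {f : ℕ → α → ℝ≥0∞} {f0 : α → ℝ≥0∞}
    (hm : ∀ j, AEMeasurable (f j) μ) (hl : ∀ᵐ x ∂μ, Tendsto (fun j => f j x) atTop (𝓝 (f0 x)))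
    {b : ℕ → ℝ≥0∞} {b0 : ℝ≥0∞} (hb : ∀ j, ∫⁻ x, f j x ∂μ ≤ b j) (hbl : Tendsto b atTop (𝓝 b0)) :
    ∫⁻ x, f0 x ∂μ ≤ b0 := by
  calc ∫⁻ x, f0 x ∂μ = ∫⁻ x, liminf (fun j => f j x) atTop ∂μ := by
        refine lintegral_congr_ae ?_
        filter_upwards [hl] with x hx
        exact hx.liminf_eq.symm
    _ ≤ liminf (fun j => ∫⁻ x, f j x ∂μ) atTop := lintegral_liminf_le' hm
    _ ≤ liminf b atTop := liminf_le_liminf (Eventually.of_forall hb)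
    _ = b0 := hbl.liminf_eq

theorem tpApp (D : Dat n) : ∃ K : ℝ, 0 < K ∧ ∀ (u : EE n → ℝ) (G : EE n → EE n) (g : EE n → ℝ)
    (v : ℕ → EE n → ℝ), App0 D u G g v → ∀ y ∈ D.Γ, ∀ R : ℝ, 0 < R →
    (∀ z ∈ D.Γ, z ∈ ball y R → g z = 0) →
    ∫⁻ X in ball y R, ‖u X‖ₑ ≤
      ENNReal.ofReal (K * R ^ ((n : ℝ) - D.d)) * ∫⁻ Z in ball y R, ‖G Z‖ₑ ∂D.ν := by
  obtain ⟨K, hK, h⟩ := D.tp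
  refine ⟨K, hK, fun u G g v hA y hy R hR hz => ?_⟩
  set c := ENNReal.ofReal (K * R ^ ((n : ℝ) - D.d))
  refine lim_le (f := fun j X => ‖v j X‖ₑ) (b := fun j => c * (∫⁻ Z in ball y R, ‖G Z‖ₑ ∂D.ν +
    ∫⁻ X in ball y R, ‖gradient (v j) X - G X‖ₑ ∂D.ν))
    (fun j => (hA.hv j).continuous.enorm.aemeasurable) ?_ (fun j => ?_) ?_
  · filter_upwards [ae_restrict_of_ae hA.hl] with X hX using hX.enorm
  · refine (h (v j) (hA.hv j) y hy R hR fun z hz1 hz2 => ?_).trans ?_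
    · obtain ⟨S, h1, h2, h3⟩ := hA.hK j
      rw [h3 z fun h => h2 h hz1, hz z hz1 hz2]
    · gcongr
      simp_rw [← gr_enorm]
      exact hA.grad_le _ _ D.ν_ac j
  · refine ENNReal.Tendsto.const_mul ?_ (Or.inr ENNReal.ofReal_ne_top)
    simpa using tendsto_const_nhds.add (hA.err (S := ball y R) (measure_ball_lt_top).ne)

/-- interior Poincare inequality -/
theorem App0.poin (hA : App0 D u G g v) {P : EE n} {R : ℝ} (hR : 0 < R) (hP : 2 * R ≤ D.δ P)
    {E : Set (EE n)} (hE : MeasurableSet E) (hEP : E ⊆ ball P R) (hz : ∀ᵐ X, X ∈ E → u X = 0) :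
    volume E * ∫⁻ X in ball P R, ‖u X‖ₑ ≤
      ENNReal.ofReal ((2 * R) ^ (n + 1) * vB n) * ∫⁻ Z in ball P R, ‖G Z‖ₑ := by
  set c := ENNReal.ofReal ((2 * R) ^ (n + 1) * vB n)
  have hm : ∀ j, Measurable fun p : EE n × EE n => ‖v j p.1 - v j p.2‖ₑ := fun j => by
    have := (hA.hv j).continuous
    fun_prop
  have key : ∫⁻ p : EE n × EE n, ‖u p.1 - u p.2‖ₑ
      ∂((volume.restrict (ball P R)).prod (volume.restrict E)) ≤ c * ∫⁻ Z in ball P R, ‖G Z‖ₑ := by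
    refine lim_le (f := fun j p => ‖v j p.1 - v j p.2‖ₑ) (b := fun j => c * ((∫⁻ Z in ball P R, ‖G Z‖ₑ) +
      ∫⁻ X in ball P R, ‖gradient (v j) X - G X‖ₑ))
      (fun j => (hm j).aemeasurable) ?_ (fun j => ?_) ?_
    · have h1 := (Measure.quasiMeasurePreserving_fst (μ := volume.restrict (ball P R))
        (ν := volume.restrict E)).ae (ae_restrict_of_ae hA.hl)
      have h2 := (Measure.quasiMeasurePreserving_snd (μ := volume.restrict (ball P R))
        (ν := volume.restrict E)).ae (ae_restrict_of_ae hA.hl)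
      filter_upwards [h1, h2] with p h1 h2 using (h1.sub h2).enorm
    · rw [lintegral_prod _ (hm j).aemeasurable]
      refine (lintegral_mono fun X => lintegral_mono_set hEP).trans ?_
      refine (poincare_vol (hA.hv j) P hR).trans ?_
      gcongr
      simp_rw [← gr_enorm]
      exact hA.grad_le _ _ Measure.AbsolutelyContinuous.rfl j
    · refine ENNReal.Tendsto.const_mul ?_ (Or.inr ENNReal.ofReal_ne_top)
      simpa using tendsto_const_nhds.add (hA.err_vol hR hP measurableSet_ball ball_subset_closedBall)
  refine le_trans (le_of_eq ?_) key
  have hum : AEMeasurable (fun p : EE n × EE n => ‖u p.1‖ₑ)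
      ((volume.restrict (ball P R)).prod (volume.restrict E)) :=
    hA.aem.restrict.enorm.comp_quasiMeasurePreserving Measure.quasiMeasurePreserving_fst
  have h3 : ∫⁻ p : EE n × EE n, ‖u p.1 - u p.2‖ₑ
      ∂((volume.restrict (ball P R)).prod (volume.restrict E)) = ∫⁻ p : EE n × EE n, ‖u p.1‖ₑ
      ∂((volume.restrict (ball P R)).prod (volume.restrict E)) := by
    refine lintegral_congr_ae ?_
    have h2 := (Measure.quasiMeasurePreserving_snd (μ := volume.restrict (ball P R))
        (ν := volume.restrict E)).ae ((ae_restrict_iff' hE).2 hz)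
    filter_upwards [h2] with p hp
    rw [hp, sub_zero]
  rw [h3, lintegral_prod _ hum]
  simp only [lintegral_const, Measure.restrict_apply_univ]
  rw [lintegral_mul_const'' _ hA.aem.restrict.enorm, mul_comm]

/-- Sobolev inequality -/
theorem App0.sob (hn : 2 ≤ n) : ∃ C : ℝ, 0 < C ∧ ∀ (D : Dat n) (u : EE n → ℝ) (G : EE n → EE n)
    (g : EE n → ℝ) (v : ℕ → EE n → ℝ), App0 D u G g v → ∀ (P : EE n) (R : ℝ), 0 < R → 2 * R ≤ D.δ P →
    (∀ j X, R ≤ dist X P → v j X = 0 ∧ gradient (v j) X = 0) →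
    ∫⁻ X, ‖u X‖ₑ ^ ((n : ℝ) / (n - 1)) ≤
      ENNReal.ofReal C * (∫⁻ X in closedBall P R, ‖G X‖ₑ) ^ ((n : ℝ) / (n - 1)) := by
  have hn1 : (1 : ℝ) < n := by exact_mod_cast hn
  set p : ℝ := (n : ℝ) / (n - 1)
  have hp : Real.HolderConjugate (Module.finrank ℝ (EE n)) p := by
    rw [finrank_euclideanSpace_fin]
    exact Real.HolderConjugate.conjExponent hn1
  have hp0 : 0 < p := hp.symm.pos
  set C0 := lintegralPowLePowLIntegralFDerivConst (volume : Measure (EE n)) p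
  refine ⟨C0 + 1, by positivity, fun D u G g v hA P R hR hP hs => ?_⟩
  have hle : (C0 : ℝ≥0∞) ≤ ENNReal.ofReal (C0 + 1) := by
    rw [← ENNReal.ofReal_coe_nnreal]; exact ENNReal.ofReal_le_ofReal (by linarith)
  refine lim_le (f := fun j X => ‖v j X‖ₑ ^ p) (b := fun j => ENNReal.ofReal (C0 + 1) *
      ((∫⁻ Z in closedBall P R, ‖G Z‖ₑ) + ∫⁻ X in closedBall P R, ‖gradient (v j) X - G X‖ₑ) ^ p)
      (fun j => ((hA.hv j).continuous.enorm.aemeasurable.pow_const _)) ?_ (fun j => ?_) ?_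
  · filter_upwards [hA.hl] with X hX
    exact ((ENNReal.continuous_rpow_const (y := p)).tendsto _).comp hX.enorm
  · have hcs : HasCompactSupport (v j) :=
      HasCompactSupport.of_support_subset_isCompact (isCompact_closedBall P R) fun X hX => by
        by_contra h
        rw [mem_closedBall, not_le] at h
        exact hX (hs j X h.le).1
    refine (lintegral_pow_le_pow_lintegral_fderiv volume (hA.hv j) hcs hp).trans ?_
    gcongr
    refine le_trans (le_of_eq ?_) (hA.grad_le (closedBall P R) _ Measure.AbsolutelyContinuous.rfl j)
    simp_rw [← gr_enorm]
    rw [← lintegral_indicator measurableSet_closedBall]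
    refine lintegral_congr fun X => ?_
    by_cases h : X ∈ closedBall P R
    · rw [indicator_of_mem h]
    · rw [indicator_of_notMem h]
      rw [mem_closedBall, not_le] at h
      rw [(hs j X h.le).2]; simp
  · refine ENNReal.Tendsto.const_mul ?_ (Or.inr ENNReal.ofReal_ne_top)
    refine ((ENNReal.continuous_rpow_const (y := p)).tendsto _).comp ?_
    simpa using tendsto_const_nhds.add (hA.err_vol hR hP measurableSet_closedBall subset_rfl)

end Part8

section Part9

theorem hd_max (m : ℕ) (x : ℝ) :
    HasDerivAt (fun x : ℝ => max x 0 ^ (m + 2)) ((m + 2 : ℝ) * max x 0 ^ (m + 1)) x := by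
  rcases lt_trichotomy x 0 with h | h | h
  · rw [max_eq_right h.le]
    simp only [ne_eq, Nat.add_eq_zero_iff, one_ne_zero, and_false, not_false_eq_true, zero_pow, mul_zero]
    refine (hasDerivAt_const x (0:ℝ)).congr_of_eventuallyEq ?_
    filter_upwards [eventually_lt_nhds h] with y hy
    rw [max_eq_right hy.le]; simp
  · subst h
    simp only [max_self, ne_eq, Nat.add_eq_zero_iff, one_ne_zero, and_false, not_false_eq_true, zero_pow,
      mul_zero]
    have : HasFDerivAt (fun x : ℝ => max x 0 ^ (m + 2)) (0 : ℝ →L[ℝ] ℝ) 0 := by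
      refine Asymptotics.IsBigO.hasFDerivAt (n := m + 2) (Asymptotics.IsBigO.of_bound 1 ?_) (by omega)
      refine Eventually.of_forall fun y => ?_
      simp only [sub_zero, one_mul, norm_pow, norm_norm]
      gcongr
      rw [Real.norm_eq_abs, Real.norm_eq_abs, abs_of_nonneg (le_max_right _ _)]
      exact max_le (le_abs_self _) (abs_nonneg _)
    simpa using this.hasDerivAt
  · rw [max_eq_left h.le]
    have := hasDerivAt_pow (m + 2) x
    push_cast at this
    refine this.congr_of_eventuallyEq ?_
    filter_upwards [eventually_gt_nhds h] with y hy
    rw [max_eq_left hy.le]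

theorem cd1 {f f' : ℝ → ℝ} (h : ∀ x, HasDerivAt f (f' x) x) (hc : Continuous f') : ContDiff ℝ 1 f := by
  rw [contDiff_one_iff_deriv]
  refine ⟨fun x => (h x).differentiableAt, ?_⟩
  rwa [funext fun x => (h x).deriv]

/-- the logarithmic test function -/
theorem exF (C : ℝ) : ∃ (c : ℝ) (F F' F'' : ℝ → ℝ), 0 < c ∧ (∀ t, HasDerivAt F (F' t) t) ∧
    (∀ t, HasDerivAt F' (F'' t) t) ∧ Continuous F'' ∧ (∀ t, 0 ≤ F t) ∧
    (∀ t, 1 / 2 ≤ t → F t = 0 ∧ F' t = 0) ∧ (∀ t, 0 ≤ t → F' t ^ 2 ≤ F'' t) ∧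
    ∀ t, 0 ≤ t → F t ≤ C → c ≤ t := by
  obtain ⟨ε, hε, hε2, hεC⟩ : ∃ ε : ℝ, 0 < ε ∧ ε ≤ 1 / 2 ∧ 2 * ε ≤ Real.exp (-C) :=
    ⟨min (1 / 2) (Real.exp (-C) / 2), lt_min (by norm_num) (by positivity), min_le_left _ _, by
      have := min_le_right (1 / 2) (Real.exp (-C) / 2); linarith⟩
  set τ : ℝ := ε / 26 with hτ
  have hτ0 : 0 < τ := by positivity
  set ρ : ℝ → ℝ := fun t => t + (1 / τ ^ 2) * max (-t) 0 ^ 3 with hρ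
  set ρ1 : ℝ → ℝ := fun t => 1 - (1 / τ ^ 2) * (3 * max (-t) 0 ^ 2) with hρ1
  set ρ2 : ℝ → ℝ := fun t => (1 / τ ^ 2) * (6 * max (-t) 0) with hρ2
  have dρ : ∀ t, HasDerivAt ρ (ρ1 t) t := fun t => by
    have := (hasDerivAt_id t).add (((hd_max 1 (-t)).comp t (hasDerivAt_neg t)).const_mul (1 / τ ^ 2))
    refine this.congr_deriv ?_
    simp only [hρ1]; push_cast; ring
  have dρ1 : ∀ t, HasDerivAt ρ1 (ρ2 t) t := fun t => by
    have := ((((hd_max 0 (-t)).comp t (hasDerivAt_neg t)).const_mul 3).const_mul (1 / τ ^ 2)).const_sub 1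
    refine this.congr_deriv ?_
    simp only [hρ2]; push_cast; ring
  have hρge : ∀ t, -τ ≤ ρ t := fun t => by
    simp only [hρ]
    rcases le_total (-τ) t with h | h
    · have : 0 ≤ 1 / τ ^ 2 * max (-t) 0 ^ 3 := by positivity
      linarith
    · have h1 : τ ≤ -t := by linarith
      rw [max_eq_left (by linarith)]
      have h2 : τ ^ 2 * (-t) ≤ (-t) ^ 3 := by
        have : τ ^ 2 ≤ (-t) ^ 2 := by gcongr
        nlinarith
      have h3 : -t ≤ 1 / τ ^ 2 * (-t) ^ 3 := by
        rw [one_div, ← div_eq_inv_mul, le_div_iff₀ (by positivity)]; linarith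
      linarith
  set k : ℝ → ℝ := fun t => 1 - (1 - ε) * max (1 - 2 * ρ t) 0 ^ 3 with hk
  set k1 : ℝ → ℝ := fun t => (1 - ε) * (6 * max (1 - 2 * ρ t) 0 ^ 2 * ρ1 t) with hk1
  set k2 : ℝ → ℝ := fun t => (1 - ε) * (-24 * max (1 - 2 * ρ t) 0 * ρ1 t ^ 2 +
    6 * max (1 - 2 * ρ t) 0 ^ 2 * ρ2 t) with hk2
  have dl : ∀ t, HasDerivAt (fun t => 1 - 2 * ρ t) (-(2 * ρ1 t)) t := fun t =>
    ((dρ t).const_mul 2).const_sub 1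
  have dk : ∀ t, HasDerivAt k (k1 t) t := fun t => by
    have := (((hd_max 1 _).comp t (dl t)).const_mul (1 - ε)).const_sub 1
    refine this.congr_deriv ?_
    simp only [hk1]; push_cast; ring
  have dk1 : ∀ t, HasDerivAt k1 (k2 t) t := fun t => by
    have := (((((hd_max 0 _).comp t (dl t)).const_mul 6).mul (dρ1 t)).const_mul (1 - ε))
    refine this.congr_deriv ?_
    simp only [hk2]; push_cast; simp only [Function.comp]; ring
  have kpos : ∀ t, 0 < k t := fun t => by
    have h1 : max (1 - 2 * ρ t) 0 ≤ 1 + 2 * τ := max_le (by linarith [hρge t]) (by positivity)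
    have h2 : max (1 - 2 * ρ t) 0 ^ 3 ≤ (1 + 2 * τ) ^ 3 := by gcongr
    have h3 : (1 + 2 * τ) ^ 3 ≤ 1 + ε := by
      have : τ ≤ 1 / 52 := by rw [hτ]; linarith
      have e : ε = 26 * τ := by rw [hτ]; ring
      rw [e]; nlinarith [sq_nonneg τ]
    simp only [hk]
    have h4 : (1 - ε) * max (1 - 2 * ρ t) 0 ^ 3 ≤ (1 - ε) * (1 + ε) :=
      mul_le_mul_of_nonneg_left (h2.trans h3) (by linarith)
    nlinarith [sq_nonneg ε]
  have kle : ∀ t, k t ≤ 1 := fun t => by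
    simp only [hk]
    have : 0 ≤ (1 - ε) * max (1 - 2 * ρ t) 0 ^ 3 := mul_nonneg (by linarith) (by positivity)
    linarith
  have ρc : Continuous ρ := continuous_iff_continuousAt.2 fun t => (dρ t).continuousAt
  have ρ1c : Continuous ρ1 := continuous_iff_continuousAt.2 fun t => (dρ1 t).continuousAt
  have ρ2c : Continuous ρ2 := by simp only [hρ2]; fun_prop
  have kc : Continuous k := continuous_iff_continuousAt.2 fun t => (dk t).continuousAt
  have k1c : Continuous k1 := continuous_iff_continuousAt.2 fun t => (dk1 t).continuousAt
  have k2c : Continuous k2 := by simp only [hk2]; fun_prop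
  have hρt : ∀ t, 0 ≤ t → ρ t = t ∧ ρ1 t = 1 ∧ ρ2 t = 0 := fun t ht => by
    simp [hρ, hρ1, hρ2, max_eq_right (neg_nonpos.2 ht)]
  refine ⟨ε / 6, fun t => -Real.log (k t), fun t => -(k1 t / k t),
    fun t => -((k2 t * k t - k1 t * k1 t) / k t ^ 2), by positivity,
    fun t => ((dk t).log (kpos t).ne').neg, fun t => ((dk1 t).div (dk t) (kpos t).ne').neg, ?_,
    fun t => ?_, fun t ht => ?_, fun t ht => ?_, fun t ht htC => ?_⟩
  · exact (((k2c.mul kc).sub (k1c.mul k1c)).div (kc.pow 2) fun t => (pow_pos (kpos t) 2).ne').neg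
  · have := Real.log_nonpos (kpos t).le (kle t)
    linarith
  · have h : max (1 - 2 * ρ t) 0 = 0 := by rw [(hρt t (by linarith)).1]; exact max_eq_right (by linarith)
    simp [hk, hk1, h]
  · obtain ⟨h1, h2, h3⟩ := hρt t ht
    have : k2 t ≤ 0 := by
      simp only [hk2, h2, h3]
      have : 0 ≤ max (1 - 2 * ρ t) 0 := le_max_right _ _
      nlinarith
    have hp := kpos t
    show (-(k1 t / k t)) ^ 2 ≤ -((k2 t * k t - k1 t * k1 t) / k t ^ 2)
    rw [neg_sq, div_pow, ← neg_div]
    gcongr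
    nlinarith
  · have h1 : Real.exp (-C) ≤ k t := by
      rw [← Real.le_log_iff_exp_le (kpos t)]; linarith
    by_contra hlt
    push Not at hlt
    have h2 : max (1 - 2 * ρ t) 0 = 1 - 2 * t := by rw [(hρt t ht).1]; exact max_eq_left (by linarith)
    simp only [hk, h2] at h1
    have h3 : 1 - 6 * t ≤ (1 - 2 * t) ^ 3 := by nlinarith [sq_nonneg t, mul_nonneg ht (sq_nonneg t)]
    have h4 : (1 - ε) * (1 - 6 * t) ≤ (1 - ε) * (1 - 2 * t) ^ 3 :=
      mul_le_mul_of_nonneg_left h3 (by linarith)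
    nlinarith [mul_nonneg hε.le ht]

end Part9

section Part10
variable {n : ℕ} {D : Dat n} {u u' g g' : EE n → ℝ} {G G' : EE n → EE n} {v v' : ℕ → EE n → ℝ}

/-- the output of `cutoff` -/
structure Cut (η : EE n → ℝ) (P : EE n) (a b Λ : ℝ) : Prop where
  cd : ContDiff ℝ 1 η
  hs : HasCompactSupport η
  h01 : ∀ X, 0 ≤ η X ∧ η X ≤ 1
  h1 : ∀ X, dist X P ≤ a → η X = 1
  h0 : ∀ X, b ≤ dist X P → η X = 0 ∧ gradient η X = 0
  hΛ : ∀ X, ‖gradient η X‖ ≤ Λ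

theorem exCut (P : EE n) {a b : ℝ} (ha : 0 ≤ a) (hab : a < b) :
    ∃ η : EE n → ℝ, Cut η P a b (Lc / (b - a)) := by
  obtain ⟨η, h1, h2, h3, h4, h5, h6⟩ := cutoff P ha hab
  exact ⟨η, h1, h2, h3, h4, h5, h6⟩

theorem Cut.sqle {η : EE n → ℝ} {P : EE n} {a b Λ : ℝ} (hη : Cut η P a b Λ) (X : EE n) {c : EE n → ℝ} (hc : ∀ X, 0 ≤ c X) :
    ENNReal.ofReal (c X * ‖gradient η X‖ ^ 2) ≤
      (ball P b).indicator (fun X => ENNReal.ofReal (Λ ^ 2) * ENNReal.ofReal (c X)) X := by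
  by_cases h : X ∈ ball P b
  · rw [indicator_of_mem h, ← ENNReal.ofReal_mul (by positivity), mul_comm]
    have := hη.hΛ X
    have := hc X
    gcongr
  · rw [mem_ball, not_lt] at h
    rw [(hη.h0 X h).2]; simp

theorem Dat.cB (D : Dat n) {P : EE n} {b : ℝ} (hb : 0 < b) (hP : 2 * b ≤ D.δ P) :
    closedBall P b ⊆ D.Γᶜ := fun X hX hX' => by
  have h1 := D.δ_lip P X
  have h2 : D.δ X = 0 := infDist_zero_of_mem hX'
  rw [mem_closedBall, dist_comm] at hX
  linarith

theorem Sol.cacc2 (hS : Sol D u G g) {η : EE n → ℝ} {P₀ : EE n} {a b Λ : ℝ} (hη : Cut η P₀ a b Λ)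
    {P q h : ℝ → ℝ} (hP : ContDiff ℝ 1 P) (hq : Continuous q) (hh : Continuous h)
    (hae : ∀ᵐ X, X ∈ ball P₀ b → q (u X) ^ 2 ≤ deriv P (u X) ∧ |P (u X)| ≤ |q (u X)| * h (u X))
    (hk : ∃ K : Set (EE n), IsCompact K ∧ K ⊆ D.Γᶜ ∧ ∀ X ∉ K, η X ^ 2 * P (g X) = 0) :
    ∫⁻ X, ENNReal.ofReal (η X ^ 2 * q (u X) ^ 2 * ‖G X‖ ^ 2) ∂D.ν ≤
      ENNReal.ofReal (4 * D.C₃ ^ 4 * Λ ^ 2) * ∫⁻ X in ball P₀ b, ENNReal.ofReal (h (u X) ^ 2) ∂D.ν := by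
  have hC := D.hC₃
  obtain ⟨h1, h2, h3⟩ := hS.cacc hη.cd hη.hs hP hq hh (by
    filter_upwards [hae] with X hX h0
    refine hX ?_
    by_contra hc
    rw [mem_ball, not_lt] at hc
    exact h0 (hη.h0 X hc).1) hk
  rw [← ofReal_integral_eq_lintegral_ofReal h1 (Eventually.of_forall fun X => by positivity)]
  refine (ENNReal.ofReal_le_ofReal h3).trans ?_
  rw [ENNReal.ofReal_mul (by positivity),
    ofReal_integral_eq_lintegral_ofReal h2 (Eventually.of_forall fun X => by positivity),
    ENNReal.ofReal_mul (p := 4 * D.C₃ ^ 4) (q := Λ ^ 2) (by positivity), mul_assoc]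
  refine mul_le_mul_right ?_ _
  refine (lintegral_mono fun X => hη.sqle X (c := fun X => h (u X) ^ 2) fun X => sq_nonneg _).trans ?_
  rw [lintegral_indicator measurableSet_ball, lintegral_const_mul' _ _ ENNReal.ofReal_ne_top]

/-- the constant in the Whitney Caccioppoli inequality -/
noncomputable def Dat.K1 (D : Dat n) : ℝ := 4 * D.C₃ ^ 4 * (2⁻¹ ^ D.β / 2 ^ D.β)

theorem Dat.K1_pos (D : Dat n) : 0 < D.K1 := by
  have := D.hC₃; unfold Dat.K1; positivity

theorem Sol.cacc3 (hS : Sol D u G g) {η : EE n → ℝ} {P₀ : EE n} {a b Λ : ℝ} (hη : Cut η P₀ a b Λ)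
    (hb : 0 < b) (hδ : 2 * b ≤ D.δ P₀)
    {P q h : ℝ → ℝ} (hP : ContDiff ℝ 1 P) (hq : Continuous q) (hh : Continuous h)
    (hae : ∀ᵐ X, X ∈ ball P₀ b → q (u X) ^ 2 ≤ deriv P (u X) ∧ |P (u X)| ≤ |q (u X)| * h (u X)) :
    ∫⁻ X in closedBall P₀ b, ENNReal.ofReal (η X ^ 2 * q (u X) ^ 2 * ‖G X‖ ^ 2) ≤
      ENNReal.ofReal (D.K1 * Λ ^ 2) * ∫⁻ X in ball P₀ b, ENNReal.ofReal (h (u X) ^ 2) := by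
  have hC := D.hC₃
  have h1 := hS.cacc2 hη hP hq hh hae ⟨closedBall P₀ b, isCompact_closedBall _ _, D.cB hb hδ, fun X hX => by
    rw [mem_closedBall, not_le] at hX
    rw [(hη.h0 X hX.le).1]; ring⟩
  have hw : 0 < D.w P₀ := Real.rpow_pos_of_pos (by linarith) _
  have hGm : AEStronglyMeasurable G volume := hS.memLp.1.mono_ac D.ac_ν
  have m1 : AEMeasurable (fun X => ENNReal.ofReal (η X ^ 2 * q (u X) ^ 2 * ‖G X‖ ^ 2)) := by
    have m2 := (hη.cd.continuous.pow 2).aestronglyMeasurable (μ := volume)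
    have m3 := (hq.pow 2).comp_aestronglyMeasurable hS.aem
    exact ((m2.mul m3).mul (hGm.norm.pow 2)).aemeasurable.ennreal_ofReal
  have m2 : AEMeasurable (fun X => ENNReal.ofReal (h (u X) ^ 2)) :=
    ((hh.pow 2).comp_aestronglyMeasurable hS.aem).aemeasurable.ennreal_ofReal
  have e1 := (D.lint_whit hb hδ measurableSet_closedBall subset_rfl m1).1
  have e2 := (D.lint_whit hb hδ measurableSet_ball ball_subset_closedBall m2).2
  have hp : 0 < 2 ^ D.β * D.w P₀ := by positivity
  rw [← ENNReal.mul_le_mul_iff_right (a := ENNReal.ofReal (2 ^ D.β * D.w P₀)) (by simpa using hp)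
    ENNReal.ofReal_ne_top]
  refine (e1.trans (setLIntegral_le_lintegral _ _)).trans (h1.trans ?_)
  refine (mul_le_mul_right e2 _).trans (le_of_eq ?_)
  rw [← mul_assoc, ← mul_assoc, ← ENNReal.ofReal_mul (by positivity), ← ENNReal.ofReal_mul hp.le]
  congr 2
  have h2 : (2:ℝ) ^ D.β ≠ 0 := by positivity
  unfold Dat.K1
  generalize (2:ℝ) ^ D.β = x at *
  generalize (2⁻¹:ℝ) ^ D.β = y at *
  field_simp

theorem moser_step (D : Dat n) : ∃ C : ℝ, 1 ≤ C ∧ ∀ (u : EE n → ℝ) (G : EE n → EE n) (g : EE n → ℝ),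
    Sol D u G g → ∀ (W W' W'' : ℝ → ℝ), (∀ t, HasDerivAt W (W' t) t) → (∀ t, HasDerivAt W' (W'' t) t) →
    Continuous W'' → (∀ t, 1 ≤ W t) → (∀ t, 0 ≤ t → W' t ^ 2 ≤ W'' t) → ∀ (P : EE n) (a b : ℝ), 0 < a →
    a < b → 2 * b ≤ D.δ P → (∀ᵐ X, X ∈ ball P b → 0 ≤ u X) → ∀ s : ℝ, 1 ≤ s →
    ∫⁻ X in ball P a, ENNReal.ofReal (W (u X) ^ s) ^ ((n : ℝ) / (n - 1)) ≤ ENNReal.ofReal C *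
      (ENNReal.ofReal (1 / (b - a)) * ∫⁻ X in ball P b, ENNReal.ofReal (W (u X) ^ s)) ^ ((n : ℝ) / (n - 1)) := by
  have hn1 : (1 : ℝ) < n := by exact_mod_cast D.hn2
  set κ : ℝ := (n : ℝ) / (n - 1) with hκ
  have hκ0 : 0 < κ := div_pos (by linarith) (by linarith)
  obtain ⟨C1, hC1, hsob⟩ := App0.sob D.hn2
  have hK1 := D.K1_pos
  have hLc := Lc_pos
  refine ⟨C1 * ((3 + D.K1) * Lc) ^ κ + 1, by
    have : 0 ≤ C1 * ((3 + D.K1) * Lc) ^ κ := by positivity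
    linarith, ?_⟩
  intro u G g hS W W' W'' dW dW' cW'' W1 WW P a b ha hab hδ hu s hs
  have hb : 0 < b := ha.trans hab
  have hba : 0 < b - a := by linarith
  obtain ⟨η, hη⟩ := exCut P ha.le hab
  set Λ := Lc / (b - a) with hΛ
  have hΛ0 : 0 < Λ := by positivity
  have cW : Continuous W := continuous_iff_continuousAt.2 fun t => (dW t).continuousAt
  have cW' : Continuous W' := continuous_iff_continuousAt.2 fun t => (dW' t).continuousAt
  have W0 : ∀ t, 0 < W t := fun t => one_pos.trans_le (W1 t)
  have cWp : ∀ e : ℝ, Continuous fun t => W t ^ e := fun e =>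
    cW.rpow_const fun t => Or.inl (W0 t).ne'
  have dWp : ∀ e t, HasDerivAt (fun t => W t ^ e) (W' t * e * W t ^ (e - 1)) t := fun e t =>
    (dW t).rpow_const (Or.inl (W0 t).ne')
  have dP : ∀ t, HasDerivAt (fun t => s / 2 * (W t ^ (s - 1) * W' t))
      (s / 2 * (W' t * (s - 1) * W t ^ (s - 1 - 1) * W' t + W t ^ (s - 1) * W'' t)) t := fun t =>
    ((dWp (s - 1) t).mul (dW' t)).const_mul _
  have hrp : ∀ t, (W t ^ (s / 2 - 1)) ^ 2 = W t ^ (s - 1 - 1) := fun t => by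
    rw [← Real.rpow_natCast, ← Real.rpow_mul (W0 t).le]; congr 1; push_cast; ring
  have hrp2 : ∀ t, (W t ^ (s / 2)) ^ 2 = W t ^ s := fun t => by
    rw [← Real.rpow_natCast, ← Real.rpow_mul (W0 t).le]; congr 1; push_cast; ring
  have hrp3 : ∀ t, W t ^ (s - 1) = W t ^ (s / 2 - 1) * W t ^ (s / 2) := fun t => by
    rw [← Real.rpow_add (W0 t)]; congr 1; ring
  set q : ℝ → ℝ := fun t => s / 2 * (W t ^ (s / 2 - 1) * W' t) with hq
  have cac := hS.cacc3 hη hb hδ (P := fun t => s / 2 * (W t ^ (s - 1) * W' t))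
    (q := q) (h := fun t => W t ^ (s / 2))
    (cd1 dP (by
      have := cWp (s - 1); have := cWp (s - 1 - 1); fun_prop))
    (by have := cWp (s / 2 - 1); fun_prop) (cWp _) (by
      filter_upwards [hu] with X hX hXb
      have h0 := WW _ (hX hXb)
      rw [(dP _).deriv]
      set t := u X
      constructor
      · have h1 : W t ^ (s - 1 - 1) ≤ W t ^ (s - 1) :=
          Real.rpow_le_rpow_of_exponent_le (W1 t) (by linarith)
        have h2 : 0 ≤ W t ^ (s - 1 - 1) := Real.rpow_nonneg (W0 t).le _
        have h3 : W t ^ (s - 1 - 1) * W' t ^ 2 ≤ W t ^ (s - 1) * W'' t :=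
          mul_le_mul h1 h0 (sq_nonneg _) (h2.trans h1)
        calc (s / 2 * (W t ^ (s / 2 - 1) * W' t)) ^ 2 = s ^ 2 / 4 * ((W t ^ (s / 2 - 1)) ^ 2 * W' t ^ 2) := by ring
          _ = s ^ 2 / 4 * (W t ^ (s - 1 - 1) * W' t ^ 2) := by rw [hrp]
          _ ≤ s ^ 2 / 2 * (W t ^ (s - 1 - 1) * W' t ^ 2) := by gcongr; norm_num
          _ = s / 2 * (W' t * (s - 1) * W t ^ (s - 1 - 1) * W' t + W t ^ (s - 1 - 1) * W' t ^ 2) := by ring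
          _ ≤ _ := by gcongr
      · refine le_of_eq ?_
        simp only [hq]
        rw [hrp3 t, show s / 2 * (W t ^ (s / 2 - 1) * W t ^ (s / 2) * W' t) =
          (s / 2 * (W t ^ (s / 2 - 1) * W' t)) * W t ^ (s / 2) by ring, abs_mul,
          abs_of_pos (a := W t ^ (s / 2)) (Real.rpow_pos_of_pos (W0 t) _)])
  simp only [hrp2] at cac
  obtain ⟨v, hv⟩ := hS.1
  have hcQ : ContDiff ℝ 1 fun t => W t ^ s := cd1 (dWp s) (by have := cWp (s - 1); fun_prop)
  have hA := ((App.cut (D := D) hη.cd hη.hs).mul (App.cut hη.cd hη.hs)).mul (hv.comp hcQ)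
  have hsb := hsob D _ _ _ _ hA.toApp0 P b hb hδ (fun j X hX => by
    obtain ⟨h1, h2⟩ := hη.h0 X hX
    refine ⟨by simp [h1], ?_⟩
    rw [gr_mul (f := fun X => η X * η X) (g := fun X => W (v j X) ^ s) (hη.cd.mul hη.cd) (hcQ.comp (hv.hv j)), gr_mul hη.cd hη.cd]
    simp [h1, h2])
  have e1 : ∫⁻ X in ball P a, ENNReal.ofReal (W (u X) ^ s) ^ κ ≤ ∫⁻ X, ‖η X * η X * W (u X) ^ s‖ₑ ^ κ := by
    refine le_trans (setLIntegral_mono' measurableSet_ball fun X hX => ?_) (setLIntegral_le_lintegral (ball P a) _)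
    rw [hη.h1 X (mem_ball.1 hX).le, Real.enorm_eq_ofReal (by have := W0 (u X); positivity)]
    simp
  refine e1.trans (hsb.trans ?_)
  set I := ∫⁻ X in ball P b, ENNReal.ofReal (W (u X) ^ s) with hI
  have e2 : ∫⁻ X in closedBall P b, ‖(η X * η X) • (deriv (fun t => W t ^ s) (u X) • G X) +
      W (u X) ^ s • (η X • gradient η X + η X • gradient η X)‖ₑ ≤ ENNReal.ofReal ((3 + D.K1) * Λ) * I := by
    have e3 : ∀ X ∈ closedBall P b, ‖(η X * η X) • (deriv (fun t => W t ^ s) (u X) • G X) +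
      W (u X) ^ s • (η X • gradient η X + η X • gradient η X)‖ₑ ≤
      (ball P b).indicator (fun X => ENNReal.ofReal (3 * Λ) * ENNReal.ofReal (W (u X) ^ s)) X +
      ENNReal.ofReal Λ⁻¹ * ENNReal.ofReal (η X ^ 2 * q (u X) ^ 2 * ‖G X‖ ^ 2) := by
      intro X _
      by_cases hX : X ∈ ball P b
      · rw [indicator_of_mem hX, ← ENNReal.ofReal_mul (by positivity), ← ENNReal.ofReal_mul (by positivity),
          ← ENNReal.ofReal_add (by have := W0 (u X); positivity) (by positivity), ← ofReal_norm]
        refine ENNReal.ofReal_le_ofReal ((norm_add_le _ _).trans ?_)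
        rw [(dWp s _).deriv]
        set t := u X
        obtain ⟨g0, g1⟩ := hη.h01 X
        have hWs : 0 < W t ^ s := Real.rpow_pos_of_pos (W0 t) _
        have n1 : ‖W t ^ s • (η X • gradient η X + η X • gradient η X)‖ ≤ W t ^ s * (2 * Λ) := by
          rw [norm_smul, Real.norm_of_nonneg hWs.le, ← two_smul ℝ, norm_smul, norm_smul,
            Real.norm_of_nonneg g0]
          norm_num
          have := mul_le_mul g1 (hη.hΛ X) (norm_nonneg _) zero_le_one
          rw [one_mul] at this
          gcongr
        have n2 : ‖(η X * η X) • ((W' t * s * W t ^ (s - 1)) • G X)‖ =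
            2 * ((η X * W t ^ (s / 2)) * (η X * |q t| * ‖G X‖)) := by
          rw [norm_smul, norm_smul, Real.norm_of_nonneg (by positivity), Real.norm_eq_abs, hrp3 t,
            show W' t * s * (W t ^ (s / 2 - 1) * W t ^ (s / 2)) = 2 * q t * W t ^ (s / 2) by
              simp only [hq]; ring, abs_mul, abs_mul, abs_of_pos (Real.rpow_pos_of_pos (W0 t) (s / 2))]
          norm_num
          ring
        have n3 : 2 * ((η X * W t ^ (s / 2)) * (η X * |q t| * ‖G X‖)) ≤
            Λ * (η X * W t ^ (s / 2)) ^ 2 + Λ⁻¹ * (η X * |q t| * ‖G X‖) ^ 2 := by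
          set x := η X * W t ^ (s / 2)
          set y := η X * |q t| * ‖G X‖
          have : 0 ≤ Λ⁻¹ * (Λ * x - y) ^ 2 := by positivity
          have e : Λ⁻¹ * (Λ * x - y) ^ 2 = Λ * x ^ 2 + Λ⁻¹ * y ^ 2 - 2 * (x * y) := by field_simp; ring
          linarith
        have n4 : (η X * W t ^ (s / 2)) ^ 2 ≤ W t ^ s := by
          rw [mul_pow, hrp2]
          have : η X ^ 2 ≤ 1 := by nlinarith
          nlinarith
        have n5 : (η X * |q t| * ‖G X‖) ^ 2 = η X ^ 2 * q t ^ 2 * ‖G X‖ ^ 2 := by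
          rw [mul_pow, mul_pow, sq_abs]
        rw [n2]
        rw [n5] at n3
        have := mul_le_mul_of_nonneg_left n4 hΛ0.le
        nlinarith
      · rw [mem_ball, not_lt] at hX
        simp [(hη.h0 X hX).1]
    refine (setLIntegral_mono' measurableSet_closedBall e3).trans ?_
    rw [lintegral_add_left' ((((cWp s).comp_aestronglyMeasurable hS.aem).aemeasurable.ennreal_ofReal.const_mul
      _).indicator measurableSet_ball).restrict, lintegral_const_mul' _ _ ENNReal.ofReal_ne_top]
    have e4 : ∫⁻ X in closedBall P b, (ball P b).indicator
        (fun X => ENNReal.ofReal (3 * Λ) * ENNReal.ofReal (W (u X) ^ s)) X = ENNReal.ofReal (3 * Λ) * I := by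
      rw [lintegral_indicator measurableSet_ball, Measure.restrict_restrict measurableSet_ball,
        inter_eq_left.2 ball_subset_closedBall, lintegral_const_mul' _ _ ENNReal.ofReal_ne_top]
    rw [e4]
    refine (add_le_add_right (mul_le_mul_right cac _) _).trans (le_of_eq ?_)
    rw [← mul_assoc, ← ENNReal.ofReal_mul (by positivity), ← add_mul, ← ENNReal.ofReal_add (by positivity)
      (by positivity)]
    congr 2
    field_simp
  refine (mul_le_mul_right (ENNReal.rpow_le_rpow e2 hκ0.le) _).trans ?_
  have e5 : ENNReal.ofReal ((3 + D.K1) * Λ) * I = ENNReal.ofReal ((3 + D.K1) * Lc) *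
      (ENNReal.ofReal (1 / (b - a)) * I) := by
    rw [← mul_assoc, ← ENNReal.ofReal_mul (by positivity)]
    congr 2; rw [hΛ]; ring
  rw [e5, ENNReal.mul_rpow_of_nonneg _ _ hκ0.le, ← mul_assoc, ENNReal.ofReal_rpow_of_pos (by positivity),
    ← ENNReal.ofReal_mul hC1.le]
  gcongr
  linarith

end Part10

section Part11
variable {n : ℕ} {D : Dat n} {u u' g g' : EE n → ℝ} {G G' : EE n → EE n} {v v' : ℕ → EE n → ℝ}

theorem iter_seq {κ C : ℝ} (hκ : 1 < κ) (hC : 1 ≤ C) : ∃ A : ℝ, 1 ≤ A ∧ ∀ J : ℕ → ℝ, (∀ j, 0 ≤ J j) →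
    (∀ j, J (j + 1) ≤ (C * 2 ^ j * J j) ^ κ) → ∀ j, J j ≤ (A * J 0) ^ (κ ^ j) := by
  have hk : 0 < κ - 1 := by linarith
  set a := κ / (κ - 1) with ha
  set e := a / (κ - 1) with he
  have ha1 : a + κ = a * κ := by rw [ha]; field_simp; ring
  have he1 : a + e = e * κ := by rw [he]; field_simp; ring
  have ha0 : 0 < a := by positivity
  have he0 : 0 < e := by positivity
  have hC0 : 0 < C := by linarith
  set L : ℕ → ℝ := fun j => C ^ a * (2:ℝ) ^ (a * j + e) with hL
  have hL1 : ∀ j, 1 ≤ L j := fun j =>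
    one_le_mul_of_one_le_of_one_le (Real.one_le_rpow hC ha0.le) (Real.one_le_rpow (by norm_num) (by positivity))
  refine ⟨L 0, hL1 0, fun J hJ hs j => ?_⟩
  have key : ∀ j, L j * J j ≤ (L 0 * J 0) ^ (κ ^ j) := by
    intro j
    induction j with
    | zero => simp
    | succ j ih =>
      have e1 : L (j + 1) * (C * 2 ^ j * J j) ^ κ = (L j * J j) ^ κ := by
        simp only [hL]
        rw [Real.mul_rpow (by positivity) (hJ j), Real.mul_rpow (by positivity) (by positivity),
          Real.mul_rpow (by positivity) (hJ j), Real.mul_rpow (by positivity) (by positivity),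
          ← Real.rpow_natCast, ← Real.rpow_mul (by norm_num), ← Real.rpow_mul hC0.le, ← Real.rpow_mul (by norm_num),
          ← ha1, Real.rpow_add hC0, show (a * j + e) * κ = (a * ((j + 1 : ℕ):ℝ) + e) + j * κ by
            push_cast; linear_combination (j:ℝ) * (-ha1) - he1, Real.rpow_add two_pos (a * ((j + 1 : ℕ):ℝ) + e)]
        ring
      calc L (j + 1) * J (j + 1) ≤ L (j + 1) * (C * 2 ^ j * J j) ^ κ :=
            mul_le_mul_of_nonneg_left (hs j) (by linarith [hL1 (j + 1)])
        _ = (L j * J j) ^ κ := e1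
        _ ≤ ((L 0 * J 0) ^ (κ ^ j)) ^ κ :=
            Real.rpow_le_rpow (mul_nonneg (by linarith [hL1 j]) (hJ j)) ih (by linarith)
        _ = _ := by
            rw [← Real.rpow_mul (mul_nonneg (by linarith [hL1 0]) (hJ 0)), pow_succ]
  exact (le_mul_of_one_le_left (hJ j) (hL1 j)).trans (key j)

theorem moser (D : Dat n) : ∃ C : ℝ, 1 ≤ C ∧ ∀ (u : EE n → ℝ) (G : EE n → EE n) (g : EE n → ℝ),
    Sol D u G g → ∀ (W W' W'' : ℝ → ℝ), (∀ t, HasDerivAt W (W' t) t) → (∀ t, HasDerivAt W' (W'' t) t) →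
    Continuous W'' → (∀ t, 1 ≤ W t) → (∀ t, 0 ≤ t → W' t ^ 2 ≤ W'' t) → ∀ (P : EE n) (ρ m : ℝ), 0 < ρ →
    4 * ρ ≤ D.δ P → (∀ᵐ X, X ∈ ball P (2 * ρ) → 0 ≤ u X) → 0 ≤ m →
    ∫⁻ X in ball P (2 * ρ), ENNReal.ofReal (W (u X)) ≤ ENNReal.ofReal (m * ρ ^ n) →
    ∀ᵐ X, X ∈ ball P ρ → W (u X) ≤ C * m + 1 := by
  have hn1 : (1 : ℝ) < n := by exact_mod_cast D.hn2
  obtain ⟨C0, hC0, hstep⟩ := moser_step D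
  set κ : ℝ := (n : ℝ) / (n - 1) with hκ
  have hκ1 : 1 < κ := by rw [hκ, lt_div_iff₀] <;> linarith
  have hκn : ((n:ℝ) - 1) * κ = n := by rw [hκ]; field_simp [show (n:ℝ) - 1 ≠ 0 by linarith]
  obtain ⟨A, hA1, hA⟩ := iter_seq hκ1 (C := 2 * C0) (by linarith)
  refine ⟨A, hA1, ?_⟩
  intro u G g hS W W' W'' dW dW' cW'' W1 WW P ρ m hρ hδ hu hm hI
  have W0 : ∀ t, 0 < W t := fun t => one_pos.trans_le (W1 t)
  have cW : Continuous W := continuous_iff_continuousAt.2 fun t => (dW t).continuousAt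
  obtain ⟨B, hB0, hB⟩ := hS.bd cW
  set r : ℕ → ℝ := fun j => ρ * (1 + (1 / 2) ^ j) with hr
  have hrρ : ∀ j, ρ < r j := fun j => by
    simp only [hr]; have : (0:ℝ) < (1 / 2) ^ j := by positivity
    nlinarith
  have hr2 : ∀ j, r j ≤ 2 * ρ := fun j => by
    simp only [hr]; have : (1 / 2 : ℝ) ^ j ≤ 1 := pow_le_one₀ (by norm_num) (by norm_num)
    nlinarith
  have hrr : ∀ j, r j - r (j + 1) = ρ * (1 / 2) ^ (j + 1) := fun j => by simp only [hr]; ring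
  set I : ℕ → ℝ≥0∞ := fun j => ∫⁻ X in ball P (r j), ENNReal.ofReal (W (u X) ^ (κ ^ j)) with hIdef
  have hfin : ∀ j, I j ≠ ⊤ := fun j => by
    refine ((lintegral_mono_ae (g := fun _ => ENNReal.ofReal (B ^ (κ ^ j))) ?_).trans_lt ?_).ne
    · filter_upwards [ae_restrict_of_ae hB] with X hX
      exact ENNReal.ofReal_le_ofReal (Real.rpow_le_rpow (W0 _).le ((le_abs_self _).trans hX) (by positivity))
    · rw [lintegral_const, Measure.restrict_apply_univ]
      exact ENNReal.mul_lt_top ENNReal.ofReal_lt_top measure_ball_lt_top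
  set J : ℕ → ℝ := fun j => (I j).toReal / ρ ^ n with hJ
  have hρn : 0 < ρ ^ n := by positivity
  have hIJ : ∀ j, I j = ENNReal.ofReal (J j * ρ ^ n) := fun j => by
    simp only [hJ]
    rw [div_mul_cancel₀ _ hρn.ne', ENNReal.ofReal_toReal (hfin j)]
  have hJ0 : ∀ j, 0 ≤ J j := fun j => by positivity
  have hrec : ∀ j, J (j + 1) ≤ (2 * C0 * 2 ^ j * J j) ^ κ := by
    intro j
    have h1 := hstep u G g hS W W' W'' dW dW' cW'' W1 WW P (r (j + 1)) (r j) (hρ.trans (hrρ _)) (by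
      have := hrr j; have : 0 < ρ * (1 / 2) ^ (j + 1) := by positivity
      linarith) (by linarith [hr2 j]) (by
        filter_upwards [hu] with X hX hXb
        exact hX (ball_subset_ball (hr2 j) hXb)) (κ ^ j) (one_le_pow₀ hκ1.le)
    have h2 : ∫⁻ X in ball P (r (j + 1)), ENNReal.ofReal (W (u X) ^ (κ ^ j)) ^ κ = I (j + 1) := by
      refine lintegral_congr fun X => ?_
      rw [ENNReal.ofReal_rpow_of_pos (Real.rpow_pos_of_pos (W0 _) _), ← Real.rpow_mul (W0 _).le, pow_succ]
    rw [h2, hrr j] at h1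
    change I (j + 1) ≤ ENNReal.ofReal C0 * (ENNReal.ofReal (1 / (ρ * (1 / 2) ^ (j + 1))) * I j) ^ κ at h1
    rw [hIJ, hIJ j, ← ENNReal.ofReal_mul (by positivity), ENNReal.ofReal_rpow_of_nonneg (by
      have := hJ0 j; positivity) (by linarith), ← ENNReal.ofReal_mul (by linarith),
      ENNReal.ofReal_le_ofReal_iff (by have := hJ0 j; positivity)] at h1
    have h3 : 1 / (ρ * (1 / 2) ^ (j + 1)) * (J j * ρ ^ n) = (2 * 2 ^ j * J j) * ρ ^ ((n:ℝ) - 1) := by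
      rw [Real.rpow_sub hρ, Real.rpow_one, Real.rpow_natCast, one_div_pow, pow_succ]; field_simp
    rw [h3, Real.mul_rpow (by have := hJ0 j; positivity) (by positivity), ← Real.rpow_mul hρ.le, hκn,
      Real.rpow_natCast, ← mul_assoc] at h1
    have h4 := le_of_mul_le_mul_right h1 hρn
    refine h4.trans ?_
    rw [show 2 * C0 * 2 ^ j * J j = C0 * (2 * 2 ^ j * J j) by ring, Real.mul_rpow (x := C0) (by linarith) (by
      have := hJ0 j; positivity)]
    have h5 : C0 ≤ C0 ^ κ := Real.self_le_rpow_of_one_le hC0 hκ1.le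
    have := hJ0 j
    gcongr
  have hfinal := hA J hJ0 hrec
  have hJm : J 0 ≤ m := by
    have h1 : I 0 ≤ ENNReal.ofReal (m * ρ ^ n) := by
      refine le_trans (le_of_eq ?_) hI
      simp only [hIdef, hr]; norm_num [mul_comm]
    rw [hIJ, ENNReal.ofReal_le_ofReal_iff (by positivity)] at h1
    exact le_of_mul_le_mul_right h1 hρn
  set M := A * m with hM
  have hM0 : 0 ≤ M := by positivity
  set E : Set (EE n) := ball P ρ ∩ {X | M + 1 ≤ W (u X)} with hE
  have hEj : ∀ j, volume E ≤ ENNReal.ofReal (ρ ^ n * (M / (M + 1)) ^ (κ ^ j)) := by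
    intro j
    have hp : 0 < (M + 1) ^ (κ ^ j) := by positivity
    have h1 : ENNReal.ofReal ((M + 1) ^ (κ ^ j)) * volume E ≤ I j := by
      have hm : AEMeasurable (fun X => ENNReal.ofReal (W (u X) ^ (κ ^ j))) (volume.restrict (ball P (r j))) := by
        have := (cW.comp_aestronglyMeasurable hS.aem).aemeasurable
        exact ((this.pow_const (κ ^ j)).ennreal_ofReal).restrict
      refine le_trans ?_ (mul_meas_ge_le_lintegral₀ hm (ENNReal.ofReal ((M + 1) ^ (κ ^ j))))
      refine mul_le_mul_right (le_trans (measure_mono ?_) (Measure.le_restrict_apply _ _)) _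
      rintro X ⟨hX1, hX2⟩
      refine ⟨?_, ball_subset_ball (hrρ j).le hX1⟩
      exact ENNReal.ofReal_le_ofReal (Real.rpow_le_rpow (by positivity) hX2 (by positivity))
    rw [hIJ, mul_comm, ← ENNReal.le_div_iff_mul_le (Or.inl (by simpa using hp)) (Or.inl ENNReal.ofReal_ne_top),
      ← ENNReal.ofReal_div_of_pos hp] at h1
    refine h1.trans (ENNReal.ofReal_le_ofReal ?_)
    rw [Real.div_rpow hM0 (by positivity), mul_comm, mul_div_assoc]
    have : A * J 0 ≤ M := by rw [hM]; gcongr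
    have h2 := (hfinal j).trans (Real.rpow_le_rpow (by have := hJ0 0; positivity) this (by positivity))
    gcongr
  have hlim : Tendsto (fun j : ℕ => ENNReal.ofReal (ρ ^ n * (M / (M + 1)) ^ (κ ^ j))) atTop (𝓝 0) := by
    have h1 : Tendsto (fun j : ℕ => (M / (M + 1)) ^ (κ ^ j)) atTop (𝓝 0) :=
      (tendsto_rpow_atTop_of_base_lt_one _ (by have : 0 ≤ M / (M + 1) := by positivity
                                               linarith)
        (by rw [div_lt_one (by positivity)]; linarith)).comp (tendsto_pow_atTop_atTop_of_one_lt hκ1)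
    have := ENNReal.tendsto_ofReal (h1.const_mul (ρ ^ n))
    simpa using this
  have hE0 : volume E = 0 := le_antisymm (ge_of_tendsto' hlim hEj) zero_le
  filter_upwards [measure_eq_zero_iff_ae_notMem.1 hE0] with X hX hXb
  by_contra hc
  push Not at hc
  exact hX ⟨hXb, hc.le⟩

/-- Lemma M -/
theorem lemM (D : Dat n) (m : ℝ) : ∃ (c : ℝ) (F F' F'' : ℝ → ℝ), 0 < c ∧ (∀ t, HasDerivAt F (F' t) t) ∧
    (∀ t, HasDerivAt F' (F'' t) t) ∧ Continuous F'' ∧ (∀ t, 0 ≤ F t) ∧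
    (∀ t, 1 / 2 ≤ t → F t = 0 ∧ F' t = 0) ∧ (∀ t, 0 ≤ t → F' t ^ 2 ≤ F'' t) ∧
    ∀ (u : EE n → ℝ) (G : EE n → EE n) (g : EE n → ℝ), Sol D u G g → ∀ (P : EE n) (ρ : ℝ), 0 < ρ →
    4 * ρ ≤ D.δ P → (∀ᵐ X, X ∈ ball P (2 * ρ) → 0 ≤ u X) →
    ∫⁻ X in ball P (2 * ρ), ENNReal.ofReal (F (u X)) ≤ ENNReal.ofReal (m * ρ ^ n) →
    ∀ᵐ X, X ∈ ball P ρ → c ≤ u X := by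
  obtain ⟨C, hC, hmos⟩ := moser D
  have hv := vB_pos n
  set m' := 2 ^ n * vB n + max m 0 with hm'
  obtain ⟨c, F, F', F'', hc, d1, d2, hc2, h0, h1, h2, h3⟩ := exF (C * m')
  refine ⟨c, F, F', F'', hc, d1, d2, hc2, h0, h1, h2, ?_⟩
  intro u G g hS P ρ hρ hδ hu hI
  have := hmos u G g hS (fun t => 1 + F t) F' F'' (fun t => (d1 t).const_add 1) d2 hc2
    (fun t => by linarith [h0 t]) h2 P ρ m' hρ hδ hu (by positivity) (by
      simp_rw [ENNReal.ofReal_add zero_le_one (h0 _)]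
      rw [lintegral_add_left measurable_const, lintegral_const, Measure.restrict_apply_univ,
        vol_ball _ (by positivity), hm', add_mul, ENNReal.ofReal_add (by positivity) (by positivity)]
      refine add_le_add (le_of_eq ?_) (hI.trans (ENNReal.ofReal_le_ofReal ?_))
      · rw [ENNReal.ofReal_one, one_mul]; congr 1; ring
      · gcongr; exact le_max_left _ _)
  filter_upwards [this, hu] with X hX hXu hXb
  have hXu := hXu (ball_subset_ball (by linarith) hXb)
  exact h3 _ hXu (by linarith [hX hXb])

end Part11

section Part12
variable {n : ℕ} {D : Dat n} {u u' g g' : EE n → ℝ} {G G' : EE n → EE n} {v v' : ℕ → EE n → ℝ}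

theorem young_L1 {η : EE n → ℝ} {P : EE n} {a b Λ ρ : ℝ} (hη : Cut η P a b Λ) (hρ : 0 < ρ) (lam : Measure (EE n))
    (q : EE n → ℝ) {S T : Set (EE n)} (hS : MeasurableSet S) (hST : S ⊆ T) (hSa : S ⊆ closedBall P a) :
    ∫⁻ X in S, ‖q X • G X‖ₑ ∂lam ≤ ENNReal.ofReal (1 / ρ) * lam S +
      ENNReal.ofReal ρ * ∫⁻ X in T, ENNReal.ofReal (η X ^ 2 * q X ^ 2 * ‖G X‖ ^ 2) ∂lam := by
  have : ∀ X ∈ S, ‖q X • G X‖ₑ ≤ ENNReal.ofReal (1 / ρ) +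
      ENNReal.ofReal ρ * ENNReal.ofReal (η X ^ 2 * q X ^ 2 * ‖G X‖ ^ 2) := fun X hX => by
    rw [hη.h1 X (hSa hX), ← ENNReal.ofReal_mul hρ.le, ← ENNReal.ofReal_add (by positivity) (by positivity),
      ← ofReal_norm]
    refine ENNReal.ofReal_le_ofReal ?_
    rw [norm_smul, Real.norm_eq_abs, ← sq_abs (q X)]
    set x := |q X| * ‖G X‖ with hx
    have : 0 ≤ x := by positivity
    have h2 : 0 ≤ ρ⁻¹ * (ρ * x - 1) ^ 2 := by positivity
    have e : ρ⁻¹ * (ρ * x - 1) ^ 2 = 1 / ρ + ρ * (1 ^ 2 * |q X| ^ 2 * ‖G X‖ ^ 2) - 2 * x := by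
      rw [hx]; field_simp; ring
    linarith
  refine (setLIntegral_mono' hS this).trans ?_
  rw [lintegral_add_left measurable_const, lintegral_const, Measure.restrict_apply_univ,
    lintegral_const_mul' _ _ ENNReal.ofReal_ne_top]
  gcongr

/-- propagation of positivity in the interior -/
theorem IP (D : Dat n) : ∃ c : ℝ, 0 < c ∧ ∀ (u : EE n → ℝ) (G : EE n → EE n) (g : EE n → ℝ), Sol D u G g →
    ∀ (P : EE n) (ρ : ℝ), 0 < ρ → 16 * ρ ≤ D.δ P → (∀ᵐ X, X ∈ ball P (8 * ρ) → 0 ≤ u X) →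
    ∀ E : Set (EE n), MeasurableSet E → E ⊆ ball P (2 * ρ) → volume (ball P ρ) ≤ 2 * volume E →
    (∀ᵐ X, X ∈ E → 1 / 2 ≤ u X) → ∀ᵐ X, X ∈ ball P (2 * ρ) → c ≤ u X := by
  have hv := vB_pos n
  have hL := Lc_pos
  have hK := D.K1_pos
  set k1 : ℝ := 4 ^ n * vB n + D.K1 * (Lc / 4) ^ 2 * (8 ^ n * vB n) with hk1
  have hk1p : 0 < k1 := by positivity
  obtain ⟨c, F, F', F'', hc, d1, d2, hc2, h0, h1, h2, h3⟩ := lemM D (2 * 8 ^ (n + 1) * k1)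
  refine ⟨c, hc, fun u G g hS P ρ hρ hδ hu E hE hEP hEv hEu => ?_⟩
  have cF : Continuous F := continuous_iff_continuousAt.2 fun t => (d1 t).continuousAt
  have cF' : Continuous F' := continuous_iff_continuousAt.2 fun t => (d2 t).continuousAt
  refine h3 u G g hS P (2 * ρ) (by linarith) (by linarith) (by
    filter_upwards [hu] with X hX hXb
    exact hX (ball_subset_ball (by linarith) hXb)) ?_
  rw [show 2 * (2 * ρ) = 4 * ρ by ring]
  obtain ⟨η, hη⟩ := exCut P (a := 4 * ρ) (b := 8 * ρ) (by linarith) (by linarith)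
  have cac := hS.cacc3 hη (by linarith) (by linarith) (P := F') (q := F') (h := fun _ => 1)
    (cd1 d2 hc2) cF' continuous_const (by
      filter_upwards [hu] with X hX hXb
      rw [(d2 _).deriv]
      exact ⟨h2 _ (hX hXb), by simp⟩)
  simp only [one_pow, ENNReal.ofReal_one, lintegral_one, Measure.restrict_apply_univ] at cac
  obtain ⟨v, hv'⟩ := hS.1
  have po := (hv'.comp (cd1 d1 cF')).toApp0.poin (P := P) (R := 4 * ρ) (by linarith) (by linarith) hE
    (hEP.trans (ball_subset_ball (by linarith))) (by
      filter_upwards [hEu] with X hX hXE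
      exact (h1 _ (hX hXE)).1)
  simp only [(d1 _).deriv] at po
  have yo := young_L1 (G := G) hη hρ volume (fun X => F' (u X)) (S := ball P (4 * ρ)) (T := closedBall P (8 * ρ))
    measurableSet_ball (ball_subset_closedBall.trans (closedBall_subset_closedBall (by linarith)))
    ball_subset_closedBall
  have e1 : ∫⁻ X in ball P (4 * ρ), ‖F' (u X) • G X‖ₑ ≤ ENNReal.ofReal (k1 * ρ ^ n / ρ) := by
    refine yo.trans ((add_le_add_right (mul_le_mul_right cac _) _).trans (le_of_eq ?_))
    rw [vol_ball _ (by linarith), vol_ball _ (by linarith), ← ENNReal.ofReal_mul (by positivity),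
      ← ENNReal.ofReal_mul (by positivity), ← ENNReal.ofReal_mul (by positivity),
      ← ENNReal.ofReal_add (by positivity) (by positivity), hk1, mul_pow, mul_pow]
    congr 1
    field_simp
    ring
  have e2 : volume E * ∫⁻ X in ball P (4 * ρ), ENNReal.ofReal (F (u X)) ≤
      ENNReal.ofReal ((2 * (4 * ρ)) ^ (n + 1) * vB n) * ENNReal.ofReal (k1 * ρ ^ n / ρ) := by
    refine le_trans (le_of_eq ?_) (po.trans (mul_le_mul_right e1 _))
    simp only [Real.enorm_eq_ofReal (h0 _)]
  have hb := vol_ball P hρ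
  have hb0 : 0 < ρ ^ n * vB n := by positivity
  have e3 : volume (ball P ρ) * ∫⁻ X in ball P (4 * ρ), ENNReal.ofReal (F (u X)) ≤
      volume (ball P ρ) * ENNReal.ofReal (2 * 8 ^ (n + 1) * k1 * (2 * ρ) ^ n) := by
    refine (mul_le_mul_left hEv _).trans ?_
    rw [mul_assoc]
    refine (mul_le_mul_right e2 _).trans ?_
    rw [hb, ← ENNReal.ofReal_mul (by positivity), ← ENNReal.ofReal_mul (by positivity),
      show (2:ℝ≥0∞) = ENNReal.ofReal 2 by norm_num, ← ENNReal.ofReal_mul (by norm_num)]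
    refine ENNReal.ofReal_le_ofReal ?_
    have h2n : (1:ℝ) ≤ 2 ^ n := one_le_pow₀ (by norm_num)
    have : 2 * ((2 * (4 * ρ)) ^ (n + 1) * vB n * (k1 * ρ ^ n / ρ)) =
      ρ ^ n * vB n * (2 * 8 ^ (n + 1) * k1 * ρ ^ n) := by
      rw [show 2 * (4 * ρ) = 8 * ρ by ring, mul_pow, pow_succ ρ]; field_simp
    rw [this, mul_pow]
    have : ρ ^ n ≤ 2 ^ n * ρ ^ n := le_mul_of_one_le_left (by positivity) h2n
    gcongr
  rwa [ENNReal.mul_le_mul_iff_right (by rw [hb]; simpa using hb0) measure_ball_lt_top.ne] at e3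

/-- positivity near the boundary -/
theorem BD (D : Dat n) : ∃ c : ℝ, 0 < c ∧ ∀ (u : EE n → ℝ) (G : EE n → EE n) (g : EE n → ℝ), Sol D u G g →
    ∀ X₀ ∉ D.Γ, ∀ y ∈ D.Γ, dist X₀ y = D.δ X₀ → (∀ᵐ X, X ∈ ball y (4 * D.δ X₀) → 0 ≤ u X) →
    (∀ z ∈ D.Γ, z ∈ ball y (4 * D.δ X₀) → 1 ≤ g z) →
    ∀ᵐ X, X ∈ ball X₀ (D.δ X₀ / 4) → c ≤ u X := by
  have hL := Lc_pos
  have hC := D.hC₃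
  obtain ⟨K, hK, tp⟩ := tpApp D
  obtain ⟨K2, hK2, hν⟩ := D.ν_ball
  set k1 : ℝ := K * 4 ^ (n + 1) * K2 * (1 + 4 * D.C₃ ^ 4 * (2 * Lc) ^ 2) with hk1
  have hk1p : 0 < k1 := by positivity
  obtain ⟨c, F, F', F'', hc, d1, d2, hc2, h0, h1, h2, h3⟩ := lemM D (4 ^ n * k1)
  refine ⟨c, hc, fun u G g hS X₀ hX₀ y hy hXy hu hg => ?_⟩
  have hs : 0 < D.δ X₀ := D.δ_pos hX₀
  set s := D.δ X₀ with hsdef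
  have cF : Continuous F := continuous_iff_continuousAt.2 fun t => (d1 t).continuousAt
  have cF' : Continuous F' := continuous_iff_continuousAt.2 fun t => (d2 t).continuousAt
  have hsub : ball X₀ (2 * (s / 4)) ⊆ ball y (3 * s) := ball_subset_ball' (by rw [hXy]; linarith)
  refine h3 u G g hS X₀ (s / 4) (by linarith) (by linarith) (by
    filter_upwards [hu] with X hX hXb
    exact hX (ball_subset_ball (by linarith) (hsub hXb))) ?_
  obtain ⟨η, hη⟩ := exCut y (a := 3 * s) (b := 7 / 2 * s) (by linarith) (by linarith)
  have hgc := hS.cd.continuous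
  have cac := hS.cacc2 hη (P := F') (q := F') (h := fun _ => 1)
    (cd1 d2 hc2) cF' continuous_const (by
      filter_upwards [hu] with X hX hXb
      rw [(d2 _).deriv]
      exact ⟨h2 _ (hX (ball_subset_ball (by linarith) hXb)), by simp⟩)
    ⟨closedBall y (7 / 2 * s) ∩ {X | g X ≤ 1 / 2},
      (isCompact_closedBall _ _).inter_right (isClosed_le hgc continuous_const), fun X hX hXΓ => by
        have := hg X hXΓ (closedBall_subset_ball (by linarith) hX.1)
        have h : g X ≤ 1 / 2 := hX.2
        linarith, fun X hX => by
        by_cases h : X ∈ closedBall y (7 / 2 * s)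
        · have : ¬ g X ≤ 1 / 2 := fun h' => hX ⟨h, h'⟩
          rw [(h1 _ (not_le.1 this).le).2, mul_zero]
        · rw [mem_closedBall, not_le] at h
          rw [(hη.h0 X h.le).1]; ring⟩
  simp only [one_pow, ENNReal.ofReal_one, lintegral_one, Measure.restrict_apply_univ] at cac
  obtain ⟨v, hv'⟩ := hS.1
  have t1 := tp _ _ _ _ (hv'.comp (cd1 d1 cF')).toApp0 y hy (3 * s) (by linarith) (fun z hz hzb =>
    (h1 _ ((by norm_num : (1:ℝ) / 2 ≤ 1).trans (hg z hz (ball_subset_ball (by linarith) hzb)))).1)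
  simp only [(d1 _).deriv] at t1
  have yo := young_L1 (G := G) hη hs D.ν (fun X => F' (u X)) (S := ball y (3 * s)) (T := univ)
    measurableSet_ball (subset_univ _) ball_subset_closedBall
  rw [Measure.restrict_univ] at yo
  have b1 : ∀ b ≤ 4 * s, D.ν (ball y b) ≤ ENNReal.ofReal (K2 * (4 * s) ^ (D.d + 1)) := fun b hb =>
    (measure_mono (ball_subset_ball hb)).trans (hν y hy _ (by linarith))
  have e1 : ∫⁻ X in ball y (3 * s), ‖F' (u X) • G X‖ₑ ∂D.ν ≤
      ENNReal.ofReal (1 / s * (K2 * (4 * s) ^ (D.d + 1)) * (1 + 4 * D.C₃ ^ 4 * (2 * Lc) ^ 2)) := by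
    refine yo.trans ((add_le_add (mul_le_mul_right (b1 _ (by linarith)) _) (mul_le_mul_right (cac.trans
      (mul_le_mul_right (b1 _ (by linarith)) _)) _)).trans (le_of_eq ?_))
    rw [← ENNReal.ofReal_mul (by positivity), ← ENNReal.ofReal_mul (by positivity),
      ← ENNReal.ofReal_mul (by positivity), ← ENNReal.ofReal_add (by positivity) (by positivity)]
    congr 1
    rw [show 7 / 2 * s - 3 * s = s / 2 by ring]
    field_simp
  have e2 : ∫⁻ X in ball X₀ (2 * (s / 4)), ENNReal.ofReal (F (u X)) ≤
      ∫⁻ X in ball y (3 * s), ‖F (u X)‖ₑ := by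
    simp only [Real.enorm_eq_ofReal (h0 _)]
    exact lintegral_mono_set hsub
  refine e2.trans (t1.trans ((mul_le_mul_right e1 _).trans ?_))
  rw [← ENNReal.ofReal_mul (by positivity)]
  refine ENNReal.ofReal_le_ofReal ?_
  have hd := D.hd
  have e3 : (3 * s) ^ ((n:ℝ) - D.d) ≤ (4 * s) ^ ((n:ℝ) - D.d) :=
    Real.rpow_le_rpow (by positivity) (by linarith) (by linarith)
  have e4 : (4 * s) ^ ((n:ℝ) - D.d) * (4 * s) ^ (D.d + 1) = 4 ^ (n + 1) * s ^ n * s := by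
    rw [← Real.rpow_add (by positivity), show (n:ℝ) - D.d + (D.d + 1) = ((n + 1 : ℕ) : ℝ) by push_cast; ring,
      Real.rpow_natCast, mul_pow, pow_succ s]; ring
  calc K * (3 * s) ^ ((n:ℝ) - D.d) * (1 / s * (K2 * (4 * s) ^ (D.d + 1)) * (1 + 4 * D.C₃ ^ 4 * (2 * Lc) ^ 2))
      ≤ K * (4 * s) ^ ((n:ℝ) - D.d) * (1 / s * (K2 * (4 * s) ^ (D.d + 1)) * (1 + 4 * D.C₃ ^ 4 * (2 * Lc) ^ 2)) := by
        gcongr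
    _ = K * ((4 * s) ^ ((n:ℝ) - D.d) * (4 * s) ^ (D.d + 1)) * (1 / s * K2 * (1 + 4 * D.C₃ ^ 4 * (2 * Lc) ^ 2)) := by ring
    _ = 4 ^ n * k1 * (s / 4) ^ n := by
        rw [e4, hk1, div_pow]; field_simp

end Part12

section Part13
variable {n : ℕ} {D : Dat n} {u u' g g' : EE n → ℝ} {G G' : EE n → EE n} {v v' : ℕ → EE n → ℝ}

theorem psi_facts : ∃ Ψ : ℝ → ℝ, ContDiff ℝ 1 Ψ ∧ (∀ t, |Ψ t| ≤ 2 ∧ |deriv Ψ t| ≤ 2) ∧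
    (∀ t, 0 ≤ deriv Ψ t) ∧ (∀ t, 0 ≤ t → Ψ t = 0) ∧ (∀ t, t < 0 → Ψ t ≠ 0) := by
  let m : ℝ → ℝ := fun t => max (-t) 0
  have hm0 : ∀ t, 0 ≤ m t := fun t => le_max_right _ _
  have hmc : Continuous m := by fun_prop
  have hp : ∀ t, 0 < 1 + m t ^ 2 := fun t => by positivity
  have hd : ∀ t, HasDerivAt (fun t => (1 + m t ^ 2)⁻¹ - 1) (2 * m t / (1 + m t ^ 2) ^ 2) t := by
    intro t
    have h1 := (hd_max 0 (-t)).comp t (hasDerivAt_neg t)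
    have h2 := ((h1.const_add 1).inv (by simpa using (hp t).ne')).sub_const 1
    refine h2.congr_deriv ?_
    simp [m]
  refine ⟨fun t => (1 + m t ^ 2)⁻¹ - 1, cd1 hd ?_, fun t => ⟨?_, ?_⟩, fun t => ?_, fun t ht => ?_,
    fun t ht => ?_⟩
  · exact (by fun_prop : Continuous fun t => 2 * m t).div (by fun_prop) fun t => by
      have := hp t; positivity
  · have h1 : (1 + m t ^ 2)⁻¹ ≤ 1 := inv_le_one_of_one_le₀ (by nlinarith [hm0 t])
    have h2 : 0 ≤ (1 + m t ^ 2)⁻¹ := (inv_pos.2 (hp t)).le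
    rw [abs_le]; constructor <;> linarith
  · rw [(hd t).deriv, abs_of_nonneg (div_nonneg (by linarith [hm0 t]) (sq_nonneg _)),
      div_le_iff₀ (pow_pos (hp t) 2)]
    nlinarith [sq_nonneg (m t - 1), sq_nonneg (m t ^ 2), hm0 t]
  · rw [(hd t).deriv]; exact div_nonneg (by linarith [hm0 t]) (sq_nonneg _)
  · simp [m, ht]
  · have h1 : (1 + m t ^ 2)⁻¹ < 1 := inv_lt_one_of_one_lt₀ (by
      have : 0 < m t := lt_max_of_lt_left (by linarith)
      nlinarith)
    simp only; linarith

theorem MP {f : EE n → ℝ} {F : EE n → EE n} (h : App0 D f F g v) (hW : Wk D F) {χ : EE n → ℝ}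
    {X' : EE n → EE n} {vχ : ℕ → EE n → ℝ}
    (hχ : App D χ X' χ vχ) (h0 : ∀ X, 0 ≤ χ X ∧ χ X ≤ 1) (hg : ∀ X, χ X ≠ 0 → 0 ≤ g X)
    (hf : ∀ᵐ X, X' X ≠ 0 → 0 ≤ f X) : ∀ᵐ X, χ X ≠ 0 → 0 ≤ f X := by
  obtain ⟨Ψ, c1, c2, c3, c4, c5⟩ := psi_facts
  have hc := h.comp c1 (M := 2) fun j X => c2 _
  have hm := hχ.mul hc
  have hz : ∀ X, χ X * Ψ (g X) = 0 := fun X => by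
    by_cases hX : χ X = 0
    · simp [hX]
    · rw [c4 _ (hg X hX), mul_zero]
  have ht := test0 hW h.hG hm.toApp0 ⟨∅, isCompact_empty, empty_subset _, fun X _ => hz X⟩
  set ψ : EE n → ℝ := fun X => χ X * deriv Ψ (f X) with hψ
  have hψ0 : ∀ X, 0 ≤ ψ X := fun X => mul_nonneg (h0 X).1 (c3 _)
  have hψ2 : ∀ X, |ψ X| ≤ 2 := fun X => by
    rw [hψ, abs_mul, abs_of_nonneg (h0 X).1]
    exact (mul_le_of_le_one_left (abs_nonneg _) (h0 X).2).trans (c2 _).2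
  have hE : (fun X => χ X • deriv Ψ (f X) • F X + Ψ (f X) • X' X) =ᵐ[volume]
      fun X => ψ X • F X := by
    filter_upwards [hf] with X hX
    by_cases hx : X' X = 0
    · simp [hx, hψ, smul_smul]
    · simp [c4 _ (hX hx), hψ, smul_smul]
  have hψm : AEStronglyMeasurable ψ volume := hχ.aem.mul
    ((c1.continuous_deriv le_rfl).comp_aestronglyMeasurable h.aem)
  have hI : Integrable (fun X => ‖F X‖ ^ 2) D.ν := h.hG.norm.integrable_sq
  have hI' : Integrable (fun X => ψ X * ‖F X‖ ^ 2) D.ν :=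
    hI.bdd_mul (hψm.mono_ac D.ν_ac) (c := 2) (Eventually.of_forall hψ2)
  have ha := D.a_ge (ψ := ψ) (F := F) (Eventually.of_forall hψ0) hI'
  rw [D.a_congr (ae_eq_refl F) hE] at ht
  rw [ht] at ha
  have hC := inv_pos.2 D.hC₃
  have hI0 : ∫ X, ψ X * ‖F X‖ ^ 2 ∂D.ν = 0 := by
    refine le_antisymm ?_ (integral_nonneg fun X => mul_nonneg (hψ0 X) (sq_nonneg _))
    by_contra hh
    push Not at hh
    have := mul_pos hC hh
    linarith
  rw [integral_eq_zero_iff_of_nonneg (fun X => mul_nonneg (hψ0 X) (sq_nonneg _)) hI'] at hI0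
  have hz2 : (fun X => χ X • deriv Ψ (f X) • F X + Ψ (f X) • X' X) =ᵐ[D.ν] 0 := by
    refine (D.ν_ac.ae_eq hE).trans ?_
    filter_upwards [hI0] with X hX
    simp only [Pi.zero_apply, mul_eq_zero] at hX ⊢
    rcases hX with hX | hX
    · simp [hX]
    · have : ‖F X‖ = 0 := by simpa using hX
      simp [norm_eq_zero.1 this]
  obtain ⟨K, hK, hT⟩ := tpApp D
  obtain ⟨y, hy⟩ := D.hne
  have hall : ∀ k : ℕ, ∀ᵐ X, X ∈ ball y (k + 1) → χ X * Ψ (f X) = 0 := fun k => by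
    have := hT _ _ _ _ hm.toApp0 y hy (k + 1) (by positivity) (fun z _ _ => hz z)
    have hz3 : ∫⁻ Z in ball y (k + 1), ‖χ Z • deriv Ψ (f Z) • F Z + Ψ (f Z) • X' Z‖ₑ ∂D.ν = 0 := by
      refine (lintegral_congr_ae (g := fun _ => (0 : ℝ≥0∞)) (ae_restrict_of_ae ?_)).trans (by simp)
      filter_upwards [hz2] with X hX
      rw [hX]; simp
    rw [hz3, mul_zero, nonpos_iff_eq_zero] at this
    rw [lintegral_eq_zero_iff' hm.toApp0.aem.enorm.restrict,
      EventuallyEq, ae_restrict_iff' measurableSet_ball] at this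
    filter_upwards [this] with X hX hX'
    simpa using hX hX'
  filter_upwards [ae_all_iff.2 hall] with X hX hX0
  obtain ⟨k, hk⟩ := exists_nat_gt (dist X y)
  have := hX k (by rw [mem_ball]; linarith)
  rcases mul_eq_zero.1 this with h1 | h1
  · exact absurd h1 hX0
  · by_contra hh
    exact c5 _ (not_le.1 hh) h1

theorem App.one : App D (fun _ => 1) (fun _ => 0) (fun _ => 1) (fun _ _ => 1) := by
  have e : gradient (fun _ : EE n => (1 : ℝ)) = fun _ => 0 := by
    ext1 X; simp [gradient]
  refine ⟨⟨contDiff_const, fun _ => contDiff_const,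
    fun j => ⟨∅, isCompact_empty, empty_subset _, fun X _ => rfl⟩,
    Eventually.of_forall fun X => tendsto_const_nhds, by simp, fun j => by simp [e],
    by simp [e]⟩, 1, by simp⟩

theorem MP1 {f : EE n → ℝ} {F : EE n → EE n} (h : App0 D f F g v) (hW : Wk D F)
    (hg : ∀ X, 0 ≤ g X) : ∀ᵐ X, 0 ≤ f X := by
  filter_upwards [MP h hW App.one (by simp) (fun X _ => hg X)
    (Eventually.of_forall fun X h => absurd rfl h)] with X hX
  exact hX one_ne_zero

end Part13

section Part14
variable {n : ℕ} {D : Dat n} {u u' g g' : EE n → ℝ} {G G' : EE n → EE n} {v v' : ℕ → EE n → ℝ}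

/-- the form on `L²(ν)` -/
noncomputable def aL (D : Dat n) : Lp (EE n) 2 D.ν →L[ℝ] Lp (EE n) 2 D.ν →L[ℝ] ℝ :=
  LinearMap.mkContinuous₂ (LinearMap.mk₂ ℝ (fun F G : Lp (EE n) 2 D.ν => D.a F G)
    (fun F F' G => by
      rw [D.a_congr (D.ac_ν.ae_eq (Lp.coeFn_add F F')) (ae_eq_refl _)]; exact D.a_add_left _ _ _)
    (fun c F G => by
      rw [D.a_congr (D.ac_ν.ae_eq (Lp.coeFn_smul c F)) (ae_eq_refl _)]; exact D.a_smul_left _ _ _)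
    (fun F G G' => by
      rw [D.a_congr (ae_eq_refl _) (D.ac_ν.ae_eq (Lp.coeFn_add G G'))]; exact D.a_add_right _ _ _)
    (fun c F G => by
      rw [D.a_congr (ae_eq_refl _) (D.ac_ν.ae_eq (Lp.coeFn_smul c G))]
      exact D.a_smul_right _ _ _))
    D.C₃ fun F G => by
      rw [LinearMap.mk₂_apply, mul_assoc]
      exact D.a_bound (Lp.memLp F) (Lp.memLp G)

theorem aL_apply (F G : Lp (EE n) 2 D.ν) : aL D F G = D.a F G := rfl

/-- gradients of test functions -/
noncomputable def gS (D : Dat n) : Submodule ℝ (Lp (EE n) 2 D.ν) where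
  carrier := {f | ∃ φ : EE n → ℝ, ContDiff ℝ 1 φ ∧
    (∃ K : Set (EE n), IsCompact K ∧ K ⊆ D.Γᶜ ∧ ∀ X ∉ K, φ X = 0) ∧ f =ᵐ[D.ν] gradient φ}
  zero_mem' := ⟨fun _ => 0, contDiff_const, ⟨∅, isCompact_empty, empty_subset _, fun _ _ => rfl⟩, by
    filter_upwards [Lp.coeFn_zero (EE n) 2 D.ν] with X hX
    refine hX.trans ?_
    simp [gradient]⟩
  add_mem' := by
    rintro f f' ⟨φ, h1, ⟨K, k1, k2, k3⟩, h2⟩ ⟨φ', h1', ⟨K', k1', k2', k3'⟩, h2'⟩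
    refine ⟨fun X => φ X + φ' X, h1.add h1', ⟨K ∪ K', k1.union k1', union_subset k2 k2',
      fun X hX => ?_⟩, ?_⟩
    · simp only [k3 X fun h => hX (Or.inl h), k3' X fun h => hX (Or.inr h), add_zero]
    · filter_upwards [Lp.coeFn_add f f', h2, h2'] with X e1 e2 e3
      rw [e1, gr_add h1 h1' X, Pi.add_apply, e2, e3]
  smul_mem' := by
    rintro c f ⟨φ, h1, ⟨K, k1, k2, k3⟩, h2⟩
    refine ⟨fun X => c * φ X, contDiff_const.mul h1, ⟨K, k1, k2, fun X hX => by simp [k3 X hX]⟩, ?_⟩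
    filter_upwards [Lp.coeFn_smul c f, h2] with X e1 e2
    have : gradient (fun X => c * φ X) X = c • gradient φ X := by
      rw [gr_mul contDiff_const h1 X]; simp [gradient]
    rw [e1, this, Pi.smul_apply, e2]

theorem lax (D : Dat n) (G0 : EE n → EE n) (h0 : MemLp G0 2 D.ν) :
    ∃ F : Lp (EE n) 2 D.ν, F ∈ (gS D).topologicalClosure ∧
      ∀ f ∈ gS D, D.a (fun X => F X + G0 X) f = 0 := by
  set V := (gS D).topologicalClosure with hV
  have : CompleteSpace V := (gS D).isClosed_topologicalClosure.completeSpace_coe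
  let B : V →L[ℝ] V →L[ℝ] ℝ := (aL D).bilinearComp V.subtypeL V.subtypeL
  have hB : ∀ x y : V, B x y = D.a (x : Lp (EE n) 2 D.ν) (y : Lp (EE n) 2 D.ν) := fun x y => rfl
  have hco : IsCoercive B := by
    refine ⟨D.C₃⁻¹, inv_pos.2 D.hC₃, fun x => ?_⟩
    have hx := Lp.memLp (x : Lp (EE n) 2 D.ν)
    have := D.a_ge (ψ := fun _ => 1) (F := (x : Lp (EE n) 2 D.ν))
      (Eventually.of_forall fun _ => zero_le_one) (by simpa using hx.norm.integrable_sq)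
    simp only [one_mul, one_smul] at this
    rw [← D.N_sq hx] at this
    rw [hB, mul_assoc, ← sq]
    exact this
  let ℓ : V →L[ℝ] ℝ := (-(aL D (h0.toLp G0))).comp V.subtypeL
  let f := (InnerProductSpace.toDual ℝ V).symm ℓ
  let F := hco.continuousLinearEquivOfBilin.symm f
  refine ⟨F, F.2, fun k hk => ?_⟩
  have h1 := hco.continuousLinearEquivOfBilin_apply F ⟨k, (gS D).le_topologicalClosure hk⟩
  rw [ContinuousLinearEquiv.apply_symm_apply, InnerProductSpace.toDual_symm_apply] at h1
  have h2 : ℓ ⟨k, (gS D).le_topologicalClosure hk⟩ = - D.a (h0.toLp G0) k := rfl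
  rw [h2, hB, D.a_congr (D.ac_ν.ae_eq h0.coeFn_toLp) (ae_eq_refl _)] at h1
  rw [D.a_add_left, ← h1]; ring

theorem approx (D : Dat n) (F : Lp (EE n) 2 D.ν) (hF : F ∈ (gS D).topologicalClosure) :
    ∃ φ : ℕ → EE n → ℝ, (∀ j, ContDiff ℝ 1 (φ j)) ∧
      (∀ j, ∃ K : Set (EE n), IsCompact K ∧ K ⊆ D.Γᶜ ∧ ∀ X ∉ K, φ j X = 0) ∧
      (∀ j, MemLp (gradient (φ j)) 2 D.ν) ∧
      (∀ j, eLpNorm (fun X => gradient (φ j) X - F X) 2 D.ν ≤ (2⁻¹ : ℝ≥0∞) ^ j) := by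
  have h1 : ∀ j : ℕ, ∃ f ∈ gS D, dist F f < (2⁻¹ : ℝ) ^ j := fun j =>
    Metric.mem_closure_iff.1 hF _ (by positivity)
  choose f hf hd using h1
  choose φ h1 h2 h3 using hf
  refine ⟨φ, h1, h2, fun j => (Lp.memLp (f j)).ae_eq (h3 j), fun j => ?_⟩
  have := (hd j).le
  rw [dist_comm, Lp.dist_def] at this
  have e : eLpNorm (fun X => gradient (φ j) X - F X) 2 D.ν = eLpNorm (⇑(f j) - ⇑F) 2 D.ν :=
    eLpNorm_congr_ae (by filter_upwards [h3 j] with X hX; simp [hX])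
  rw [e]
  have ht : eLpNorm (⇑(f j) - ⇑F) 2 D.ν ≠ ⊤ := ((Lp.memLp (f j)).sub (Lp.memLp F)).2.ne
  rw [← ENNReal.ofReal_toReal ht]
  refine (ENNReal.ofReal_le_ofReal this).trans (le_of_eq ?_)
  rw [ENNReal.ofReal_pow (by norm_num), ENNReal.ofReal_inv_of_pos two_pos]; simp

theorem approx_lim (D : Dat n) {F : EE n → EE n} (hF : MemLp F 2 D.ν) {φ : ℕ → EE n → ℝ}
    (h1 : ∀ j, ContDiff ℝ 1 (φ j))
    (h2 : ∀ j, ∃ K : Set (EE n), IsCompact K ∧ K ⊆ D.Γᶜ ∧ ∀ X ∉ K, φ j X = 0)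
    (h3 : ∀ j, MemLp (gradient (φ j)) 2 D.ν)
    (h4 : ∀ j, eLpNorm (fun X => gradient (φ j) X - F X) 2 D.ν ≤ (2⁻¹ : ℝ≥0∞) ^ j) :
    ∃ u : EE n → ℝ, ∀ᵐ X, Tendsto (fun j => φ j X) atTop (𝓝 (u X)) := by
  obtain ⟨K, hK, hT⟩ := D.tp
  obtain ⟨y, hy⟩ := D.hne
  have hall : ∀ k : ℕ, ∀ᵐ X, X ∈ ball y (k + 1) → ∃ l, Tendsto (fun j => φ j X) atTop (𝓝 l) := by
    intro k
    have hk : (0 : ℝ) < k + 1 := by positivity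
    set C : ℝ≥0∞ := ENNReal.ofReal (K * (k + 1 : ℝ) ^ ((n : ℝ) - D.d)) *
      D.ν (ball y (k + 1)) ^ (2⁻¹ : ℝ) with hC
    have hCt : C ≠ ⊤ := ENNReal.mul_ne_top ENNReal.ofReal_ne_top
      (ENNReal.rpow_ne_top_of_nonneg (by norm_num) (D.ν_ball_lt _ _).ne)
    rw [← ae_restrict_iff' measurableSet_ball]
    refine Lp.ae_tendsto_of_cauchy_eLpNorm (p := 1) (B := fun j => (C * 2 + 1) * (2⁻¹ : ℝ≥0∞) ^ j)
      (fun j => (h1 j).continuous.aestronglyMeasurable) le_rfl ?_ fun N j m hj hm => ?_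
    · rw [ENNReal.tsum_mul_left, ENNReal.tsum_geometric]
      simp [ENNReal.mul_eq_top, hCt]
    · have e : gradient (fun X => φ j X - φ m X) = fun X => gradient (φ j) X - gradient (φ m) X := by
        ext1 X
        have e1 : (fun X => φ j X - φ m X) = fun X => φ j X + -(φ m X) := by ext1; ring
        rw [e1, gr_add (h1 j) (h1 m).neg]
        simp [gradient, sub_eq_add_neg, fderiv_fun_neg]
      have t := hT (fun X => φ j X - φ m X) ((h1 j).sub (h1 m)) y hy (k + 1) hk (fun z hz _ => by
        obtain ⟨A1, -, a1, a2⟩ := h2 j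
        obtain ⟨A2, -, b1, b2⟩ := h2 m
        rw [a2 z fun h => a1 h hz, b2 z fun h => b1 h hz, sub_zero])
      have t2 : ∫⁻ Z in ball y (k + 1), ‖fderiv ℝ (fun X => φ j X - φ m X) Z‖ₑ ∂D.ν ≤
          D.ν (ball y (k + 1)) ^ (2⁻¹ : ℝ) * (2 * (2⁻¹ : ℝ≥0∞) ^ N) := by
        have hm1 : MemLp (fun X => gradient (φ j) X - gradient (φ m) X) 2 D.ν := (h3 j).sub (h3 m)
        have s1 := eLpNorm_le_eLpNorm_mul_rpow_measure_univ (p := 1) (q := 2)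
          (μ := D.ν.restrict (ball y (k + 1))) (by norm_num) hm1.1.restrict
        rw [eLpNorm_one_eq_lintegral_enorm] at s1
        simp_rw [← gr_enorm, e]
        refine s1.trans ?_
        rw [mul_comm]
        have e2 : (1 / (1 : ℝ≥0∞).toReal - 1 / (2 : ℝ≥0∞).toReal) = (2⁻¹ : ℝ) := by norm_num
        rw [e2, Measure.restrict_apply_univ]
        refine mul_le_mul_right ((eLpNorm_mono_measure _ Measure.restrict_le_self).trans ?_) _
        have s2 := eLpNorm_sub_le (p := 2) (μ := D.ν) ((h3 j).1.sub hF.1) ((h3 m).1.sub hF.1)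
          (by norm_num)
        have e3 : ((gradient (φ j) - F) - (gradient (φ m) - F)) =
          fun X => gradient (φ j) X - gradient (φ m) X := by ext1 X; simp
        rw [e3] at s2
        refine s2.trans ?_
        rw [two_mul]
        exact add_le_add ((h4 j).trans (pow_le_pow_right_of_le_one' (by simp) hj))
          ((h4 m).trans (pow_le_pow_right_of_le_one' (by simp) hm))
      rw [eLpNorm_one_eq_lintegral_enorm]
      have t3 : ∫⁻ X in ball y (k + 1), ‖φ j X - φ m X‖ₑ ≤ C * 2 * (2⁻¹ : ℝ≥0∞) ^ N := by
        refine (t.trans (mul_le_mul_right t2 _)).trans (le_of_eq ?_)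
        rw [hC]; ring
      refine t3.trans_lt ?_
      rw [add_mul, one_mul]
      refine ENNReal.lt_add_right ?_ (pow_ne_zero _ (by simp))
      exact ENNReal.mul_ne_top (ENNReal.mul_ne_top hCt (by simp)) (ENNReal.pow_ne_top (by simp))
  have : ∀ᵐ X, ∃ l, Tendsto (fun j => φ j X) atTop (𝓝 l) := by
    filter_upwards [ae_all_iff.2 hall] with X hX
    obtain ⟨k, hk⟩ := exists_nat_gt (dist X y)
    exact hX k (by rw [mem_ball]; linarith)
  refine ⟨fun X => limUnder atTop fun j => φ j X, ?_⟩
  filter_upwards [this] with X hX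
  exact tendsto_nhds_limUnder hX

theorem App0.neg1 (h : App0 D u G g v) : App0 D (fun X => 1 - u X) (fun X => -G X)
    (fun X => 1 - g X) (fun j X => 1 - v j X) := by
  have e : ∀ j, gradient (fun X => 1 - v j X) = fun X => -gradient (v j) X := fun j => by
    ext1 X; simp [gradient, fderiv_const_sub]
  refine ⟨contDiff_const.sub h.hg, fun j => contDiff_const.sub (h.hv j), fun j => ?_, ?_, h.hG.neg,
    fun j => by rw [e]; exact (h.hvG j).neg, ?_⟩
  · obtain ⟨K, a, b, c⟩ := h.hK j
    exact ⟨K, a, b, fun X hX => by rw [c X hX]⟩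
  · filter_upwards [h.hl] with X hX
    exact tendsto_const_nhds.sub hX
  · convert h.hc using 2 with j
    rw [e, ← eLpNorm_neg]; congr 1; ext1 X; simp; abel

theorem exSol (D : Dat n) (hg : ContDiff ℝ 1 g) (hs : HasCompactSupport g)
    (h01 : ∀ X, 0 ≤ g X ∧ g X ≤ 1) :
    ∃ u G, Sol D u G g ∧ (∀ᵐ X, 0 ≤ u X ∧ u X ≤ 1) := by
  have hgm : MemLp (gradient g) 2 D.ν := gr_memLp hg hs
  obtain ⟨F, hF, hW⟩ := lax D (gradient g) hgm
  obtain ⟨φ, h1, h2, h3, h4⟩ := approx D F hF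
  obtain ⟨u0, hu0⟩ := approx_lim D (Lp.memLp F) h1 h2 h3 h4
  set G0 : EE n → EE n := fun X => F X + gradient g X
  have e : ∀ j, gradient (fun X => φ j X + g X) = fun X => gradient (φ j) X + gradient g X :=
    fun j => funext fun X => gr_add (h1 j) hg X
  have hA : App0 D (fun X => u0 X + g X) G0 g (fun j X => φ j X + g X) := by
    refine ⟨hg, fun j => (h1 j).add hg, fun j => ?_, ?_, (Lp.memLp F).add hgm, fun j => ?_, ?_⟩
    · obtain ⟨K, a, b, c⟩ := h2 j
      exact ⟨K, a, b, fun X hX => by rw [c X hX, zero_add]⟩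
    · filter_upwards [hu0] with X hX
      exact hX.add_const _
    · rw [e]; exact (h3 j).add hgm
    · simp_rw [e]
      have e2 : ∀ j, (fun X => gradient (φ j) X + gradient g X - G0 X) =
        fun X => gradient (φ j) X - F X := fun j => by ext1 X; simp [G0]
      simp_rw [e2]
      exact tendsto_of_tendsto_of_tendsto_of_le_of_le tendsto_const_nhds
        (ENNReal.tendsto_pow_atTop_nhds_zero_of_lt_one (by norm_num)) (fun _ => zero_le) h4
  have hWk : Wk D G0 := fun φ a b c => by
    have hm : MemLp (gradient φ) 2 D.ν := gr_memLp a b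
    have := hW (hm.toLp _) ⟨φ, a, ⟨tsupport φ, b, c, fun X hX => image_eq_zero_of_notMem_tsupport hX⟩,
      hm.coeFn_toLp⟩
    rwa [D.a_congr (ae_eq_refl _) (D.ac_ν.ae_eq hm.coeFn_toLp)] at this
  have p1 := MP1 hA hWk fun X => (h01 X).1
  have p2 := MP1 hA.neg1 (fun φ a b c => by
    have := D.a_smul_left (-1) G0 (gradient φ)
    rw [hWk φ a b c] at this
    simpa using this) fun X => sub_nonneg.2 (h01 X).2
  let b : ContDiffBump (0 : ℝ) := ⟨2, 3, by norm_num, by norm_num⟩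
  have hT : ContDiff ℝ 1 fun t : ℝ => t * b t := contDiff_id.mul b.contDiff
  have hTs : HasCompactSupport fun t : ℝ => t * b t := b.hasCompactSupport.mul_left
  obtain ⟨M1, hM1⟩ := hTs.exists_bound_of_continuous hT.continuous
  obtain ⟨M2, hM2⟩ := hTs.deriv.exists_bound_of_continuous (hT.continuous_deriv le_rfl)
  have hA2 := hA.comp hT (M := max M1 M2) fun j X =>
    ⟨(hM1 _).trans (le_max_left _ _), (hM2 _).trans (le_max_right _ _)⟩
  have hTd : ∀ t : ℝ, 0 ≤ t → t ≤ 1 → t * b t = t ∧ deriv (fun t : ℝ => t * b t) t = 1 := by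
    intro t t0 t1
    have : ∀ᶠ s in 𝓝 t, s * b s = s := by
      filter_upwards [isOpen_ball.mem_nhds (show t ∈ ball (0 : ℝ) 2 by
        rw [mem_ball, dist_zero_right, Real.norm_eq_abs, abs_lt]; constructor <;> linarith)] with s hs
      rw [b.one_of_mem_closedBall (ball_subset_closedBall hs), mul_one]
    exact ⟨this.self_of_nhds, by
      rw [EventuallyEq.deriv_eq (f := fun s : ℝ => s) this]; simp⟩
  have hgT : (fun X => g X * b (g X)) = g := funext fun X => (hTd _ (h01 X).1 (h01 X).2).1
  simp only [hgT] at hA2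
  refine ⟨fun X => u0 X + g X, G0, ⟨⟨_, hA2.congr ?_ ?_⟩, hWk⟩, ?_⟩
  · filter_upwards [p1, p2] with X x1 x2
    exact (hTd _ x1 (by linarith)).1
  · filter_upwards [p1, p2] with X x1 x2
    rw [(hTd _ x1 (by linarith)).2, one_smul]
  · filter_upwards [p1, p2] with X x1 x2
    exact ⟨x1, by linarith⟩

end Part14

section Part15
variable {n : ℕ} {D : Dat n} {u u' g g' : EE n → ℝ} {G G' : EE n → EE n} {v v' : ℕ → EE n → ℝ}

theorem ae_local (D : Dat n) {U : Set (EE n)} {p : EE n → Prop}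
    (h : ∀ X₀ ∈ U, X₀ ∉ D.Γ → ∃ r : ℝ, 0 < r ∧ ∀ᵐ X, X ∈ ball X₀ r → p X) :
    ∀ᵐ X, X ∈ U → p X := by
  have : volume {X | X ∈ U ∧ X ∉ D.Γ ∧ ¬ p X} = 0 := by
    refine measure_null_of_locally_null _ fun X hX => ?_
    obtain ⟨r, hr, h1⟩ := h X hX.1 hX.2.1
    refine ⟨ball X r ∩ {X | X ∈ U ∧ X ∉ D.Γ ∧ ¬ p X}, ?_, ?_⟩
    · exact inter_mem (mem_nhdsWithin_of_mem_nhds (ball_mem_nhds _ hr)) self_mem_nhdsWithin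
    · refine measure_mono_null (fun Z hZ => ?_) h1
      exact fun hh => hZ.2.2.2 (hh hZ.1)
  filter_upwards [D.ae_notΓ, measure_eq_zero_iff_ae_notMem.1 this] with X h1 h2 h3
  by_contra h4
  exact h2 ⟨h3, h1, h4⟩

theorem bdstep (D : Dat n) : ∃ c : ℝ, 0 < c ∧ c < 1 ∧ ∀ (u : EE n → ℝ) (G : EE n → EE n)
    (g : EE n → ℝ), Sol D u G g → ∀ y : EE n, ∀ s a : ℝ, 0 ≤ a →
    (∀ᵐ X, X ∈ ball y s → -a ≤ u X) → (∀ z ∈ D.Γ, z ∈ ball y s → 0 ≤ g z) →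
    ∀ X₀ ∉ D.Γ, dist X₀ y + 5 * D.δ X₀ ≤ s →
    ∀ᵐ X, X ∈ ball X₀ (D.δ X₀ / 4) → -(a * (1 - c)) ≤ u X := by
  obtain ⟨c, hc, h⟩ := BD D
  refine ⟨min c (1 / 2), by positivity, (min_le_right _ _).trans_lt (by norm_num),
    fun u G g hS y s a ha h1 h2 X₀ hX hs => ?_⟩
  have hδ := D.δ_pos hX
  rcases ha.eq_or_lt with h0 | h0
  · filter_upwards [h1] with X hX hX'
    subst h0
    have : X ∈ ball y s := ball_subset_ball' (by linarith) hX'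
    simpa using hX this
  · obtain ⟨z, hz, hz'⟩ := D.exists_near X₀
    have hsub : ball z (4 * D.δ X₀) ⊆ ball y s := ball_subset_ball' (by
      have := dist_triangle z X₀ y
      rw [dist_comm z X₀] at this
      linarith)
    have := h _ _ _ (hS.affine a⁻¹ 1) X₀ hX z hz hz'.symm (by
      filter_upwards [h1] with X hX hX'
      have := hX (hsub hX')
      have := mul_le_mul_of_nonneg_left this (inv_pos.2 h0).le
      rw [mul_neg, inv_mul_cancel₀ h0.ne'] at this
      linarith) (fun w hw hw' => by
      have := mul_nonneg (inv_pos.2 h0).le (h2 w hw (hsub hw'))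
      linarith)
    filter_upwards [this] with X hX hX'
    have e := mul_le_mul_of_nonneg_left ((min_le_left c (1 / 2)).trans (hX hX')) h0.le
    rw [mul_add, mul_inv_cancel_left₀ h0.ne'] at e
    linarith

theorem bditer (D : Dat n) : ∃ c : ℝ, 0 < c ∧ c < 1 ∧ ∀ (u : EE n → ℝ) (G : EE n → EE n)
    (g : EE n → ℝ), Sol D u G g → ∀ y ∈ D.Γ, ∀ s a : ℝ, 0 < s → 0 ≤ a →
    (∀ᵐ X, X ∈ ball y s → -a ≤ u X) → (∀ z ∈ D.Γ, z ∈ ball y s → 0 ≤ g z) →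
    ∀ N : ℕ, ∀ᵐ X, X ∈ ball y (s / 6 ^ N) → -(a * (1 - c) ^ N) ≤ u X := by
  obtain ⟨c, hc, hc1, h⟩ := bdstep D
  refine ⟨c, hc, hc1, fun u G g hS y hy s a hs ha h1 h2 N => ?_⟩
  induction N with
  | zero => simpa using h1
  | succ N ih =>
    have hsN : s / 6 ^ N ≤ s := div_le_self hs.le (one_le_pow₀ (by norm_num))
    refine ae_local D fun X₀ hX hX' => ⟨D.δ X₀ / 4, by have := D.δ_pos hX'; positivity, ?_⟩
    have := h u G g hS y (s / 6 ^ N) (a * (1 - c) ^ N)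
      (mul_nonneg ha (pow_nonneg (by linarith) _)) ih
      (fun z hz hz' => h2 z hz (ball_subset_ball hsN hz')) X₀ hX' (by
        have e : s / 6 ^ (N + 1) = (s / 6 ^ N) / 6 := by rw [pow_succ]; field_simp
        rw [e, mem_ball] at hX
        have := D.δ_le (X := X₀) hy
        linarith)
    rw [pow_succ, ← mul_assoc]
    exact this

theorem oscstep (D : Dat n) : ∃ c : ℝ, 0 < c ∧ c < 1 ∧ ∀ (u : EE n → ℝ) (G : EE n → EE n)
    (g : EE n → ℝ), Sol D u G g → ∀ (P : EE n) (ρ : ℝ), 0 < ρ → 16 * ρ ≤ D.δ P → ∀ m L : ℝ, 0 ≤ L →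
    (∀ᵐ X, X ∈ ball P (8 * ρ) → m ≤ u X ∧ u X ≤ m + L) →
    ∃ m' : ℝ, ∀ᵐ X, X ∈ ball P (2 * ρ) → m' ≤ u X ∧ u X ≤ m' + L * (1 - c) := by
  obtain ⟨c, hc, h⟩ := IP D
  refine ⟨min c (1 / 2), by positivity, (min_le_right _ _).trans_lt (by norm_num),
    fun u G g hS P ρ hρ hP m L hL h1 => ?_⟩
  have hsub : ball P (2 * ρ) ⊆ ball P (8 * ρ) := ball_subset_ball (by linarith)
  have hmc := min_le_left c (1 / 2)
  rcases hL.eq_or_lt with h0 | h0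
  · refine ⟨m, ?_⟩
    filter_upwards [h1] with X hX hX'
    have := hX (hsub hX')
    subst h0
    simpa using this
  have hum := hS.aem
  set u₁ := hum.mk u
  have hu₁ : StronglyMeasurable u₁ := hum.stronglyMeasurable_mk
  have hae : u =ᵐ[volume] u₁ := hum.ae_eq_mk
  set E : Set (EE n) := ball P ρ ∩ {X | m + L / 2 ≤ u₁ X} with hE
  set E' : Set (EE n) := ball P ρ ∩ {X | u₁ X ≤ m + L / 2} with hE'
  have hEm : MeasurableSet E :=
    measurableSet_ball.inter (measurableSet_le measurable_const hu₁.measurable)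
  have hEm' : MeasurableSet E' :=
    measurableSet_ball.inter (measurableSet_le hu₁.measurable measurable_const)
  have hs2 : ball P ρ ⊆ ball P (2 * ρ) := ball_subset_ball (by linarith)
  have hi : L⁻¹ * L = 1 := inv_mul_cancel₀ h0.ne'
  have hLi := inv_pos.2 h0
  have hcov : volume (ball P ρ) ≤ volume E + volume E' := by
    refine (measure_mono fun X hX => ?_).trans (measure_union_le E E')
    rcases le_total (m + L / 2) (u₁ X) with h | h
    · exact Or.inl ⟨hX, h⟩
    · exact Or.inr ⟨hX, h⟩
  rcases le_total (volume E') (volume E) with hle | hle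
  · have := h _ _ _ (hS.affine L⁻¹ (-(L⁻¹ * m))) P ρ hρ hP (by
      filter_upwards [h1] with X hX hX'
      have := mul_le_mul_of_nonneg_left (hX hX').1 hLi.le
      linarith) E hEm (inter_subset_left.trans hs2)
      (hcov.trans (by rw [two_mul]; exact add_le_add_right hle _)) (by
      filter_upwards [hae] with X hX hX'
      have h3 : m + L / 2 ≤ u₁ X := hX'.2
      rw [hX]
      have := mul_le_mul_of_nonneg_left h3 hLi.le
      rw [mul_add, ← mul_div_assoc, hi] at this
      linarith)
    refine ⟨m + L * min c (1 / 2), ?_⟩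
    filter_upwards [this, h1] with X hX hX1 hX'
    have h3 := mul_le_mul_of_nonneg_left (hmc.trans (hX hX')) h0.le
    have e : L * (L⁻¹ * u X + -(L⁻¹ * m)) = u X - m := by field_simp; ring
    rw [e] at h3
    have := hX1 (hsub hX')
    constructor <;> linarith
  · have := h _ _ _ (hS.affine (-L⁻¹) (L⁻¹ * (m + L))) P ρ hρ hP (by
      filter_upwards [h1] with X hX hX'
      have := mul_le_mul_of_nonneg_left (hX hX').2 hLi.le
      linarith) E' hEm' (inter_subset_left.trans hs2)
      (hcov.trans (by rw [two_mul]; exact add_le_add_left hle _)) (by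
      filter_upwards [hae] with X hX hX'
      have h3 : u₁ X ≤ m + L / 2 := hX'.2
      rw [hX]
      have := mul_le_mul_of_nonneg_left h3 hLi.le
      rw [mul_add, ← mul_div_assoc, hi] at this
      rw [mul_add, hi]
      linarith)
    refine ⟨m, ?_⟩
    filter_upwards [this, h1] with X hX hX1 hX'
    have h3 := mul_le_mul_of_nonneg_left (hmc.trans (hX hX')) h0.le
    have e : L * (-L⁻¹ * u X + L⁻¹ * (m + L)) = m + L - u X := by field_simp; ring
    rw [e] at h3
    have := hX1 (hsub hX')
    constructor <;> linarith

theorem osc_int (hS : Sol D u G g) {P : EE n} (hP : P ∉ D.Γ) {ε : ℝ} (hε : 0 < ε) :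
    ∃ m r : ℝ, 0 < r ∧ ∀ᵐ X, X ∈ ball P r → |u X - m| ≤ ε := by
  obtain ⟨c, hc, hc1, h⟩ := oscstep D
  obtain ⟨B, hB, hb⟩ := hS.bd continuous_id
  have hδ := D.δ_pos hP
  have key : ∀ k : ℕ, ∃ m : ℝ, ∀ᵐ X, X ∈ ball P (D.δ P / 2 / 4 ^ k) →
      m ≤ u X ∧ u X ≤ m + (2 * B) * (1 - c) ^ k := by
    intro k
    induction k with
    | zero =>
      refine ⟨-B, ?_⟩
      filter_upwards [hb] with X hX _
      have := abs_le.1 hX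
      simp only [id] at this
      constructor <;> linarith
    | succ k ih =>
      obtain ⟨m, hm⟩ := ih
      have hk : (1 : ℝ) ≤ 4 ^ k := one_le_pow₀ (by norm_num)
      have h16 : D.δ P / 4 ^ k ≤ D.δ P := div_le_self hδ.le hk
      obtain ⟨m', hm'⟩ := h u G g hS P (D.δ P / 2 / 4 ^ k / 8) (by positivity) (by
        calc 16 * (D.δ P / 2 / 4 ^ k / 8) = D.δ P / 4 ^ k := by ring
          _ ≤ _ := h16) m ((2 * B) * (1 - c) ^ k)
        (mul_nonneg (by linarith) (pow_nonneg (by linarith) _)) (by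
          rw [mul_div_cancel₀ _ (by norm_num : (8 : ℝ) ≠ 0)]; exact hm)
      refine ⟨m', ?_⟩
      have e : D.δ P / 2 / 4 ^ (k + 1) = 2 * (D.δ P / 2 / 4 ^ k / 8) := by
        rw [pow_succ]; field_simp; norm_num
      rw [e, pow_succ, ← mul_assoc]
      exact hm'
  have hlim : Tendsto (fun k : ℕ => (2 * B) * (1 - c) ^ k) atTop (𝓝 (2 * B * 0)) :=
    (tendsto_pow_atTop_nhds_zero_of_lt_one (by linarith) (by linarith)).const_mul _
  rw [mul_zero] at hlim
  obtain ⟨k, hk⟩ := (hlim.eventually_lt_const hε).exists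
  obtain ⟨m, hm⟩ := key k
  refine ⟨m, D.δ P / 2 / 4 ^ k, by positivity, hm.mono fun X hX hX' => ?_⟩
  have := hX hX'
  rw [abs_le]; constructor <;> linarith

theorem osc_bd1 (hS : Sol D u G g) {y : EE n} (hy : y ∈ D.Γ) {ε : ℝ} (hε : 0 < ε) :
    ∃ r : ℝ, 0 < r ∧ ∀ᵐ X, X ∈ ball y r → g y - ε ≤ u X := by
  obtain ⟨c, hc, hc1, h⟩ := bditer D
  obtain ⟨B, hB, hb⟩ := hS.bd continuous_id
  obtain ⟨R, hR, hg⟩ := Metric.continuousAt_iff.1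
    (hS.cd.continuous.continuousAt (x := y)) (ε / 2) (by positivity)
  set a := B + |g y|
  have key := h _ _ _ (hS.affine 1 (-(g y - ε / 2))) y hy R a hR (by positivity) (by
    filter_upwards [hb] with X hX _
    have h1 := (abs_le.1 hX).1
    simp only [id] at h1
    have := le_abs_self (g y)
    simp only [a]
    linarith) (fun z hz hz' => by
      have := hg hz'
      rw [Real.dist_eq, abs_lt] at this
      linarith)
  have hlim : Tendsto (fun k : ℕ => a * (1 - c) ^ k) atTop (𝓝 (a * 0)) :=
    (tendsto_pow_atTop_nhds_zero_of_lt_one (by linarith) (by linarith)).const_mul _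
  rw [mul_zero] at hlim
  obtain ⟨k, hk⟩ := (hlim.eventually_lt_const (half_pos hε)).exists
  refine ⟨R / 6 ^ k, by positivity, (key k).mono fun X hX hX' => ?_⟩
  have := hX hX'
  linarith

theorem osc_bd (hS : Sol D u G g) {y : EE n} (hy : y ∈ D.Γ) {ε : ℝ} (hε : 0 < ε) :
    ∃ r : ℝ, 0 < r ∧ ∀ᵐ X, X ∈ ball y r → |u X - g y| ≤ ε := by
  obtain ⟨r, hr, h1⟩ := osc_bd1 hS hy hε
  obtain ⟨r', hr', h2⟩ := osc_bd1 (hS.affine (-1) 0) hy hε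
  refine ⟨min r r', lt_min hr hr', ?_⟩
  filter_upwards [h1, h2] with X h1 h2 hX
  have h1 := h1 (ball_subset_ball (min_le_left _ _) hX)
  have h2 := h2 (ball_subset_ball (min_le_right _ _) hX)
  rw [abs_le]; constructor <;> linarith

theorem ae_open {f : EE n → ℝ} (hf : Continuous f) {U : Set (EE n)} (hU : IsOpen U) {a : ℝ}
    (h : ∀ᵐ X, X ∈ U → a ≤ f X) : ∀ X ∈ U, a ≤ f X := by
  by_contra! hh
  obtain ⟨X, hX, hX'⟩ := hh
  have ho : IsOpen (U ∩ {X | f X < a}) := hU.inter (isOpen_lt hf continuous_const)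
  refine (ho.measure_pos volume ⟨X, hX, hX'⟩).ne' (measure_mono_null (fun Z hZ => ?_) h)
  exact fun h4 => absurd (h4 hZ.1) (not_le.2 hZ.2)

theorem contRep (D : Dat n) (h : ∀ X, ∀ ε : ℝ, 0 < ε → ∃ m r : ℝ, 0 < r ∧ ∀ᵐ Z, Z ∈ ball X r → |u Z - m| ≤ ε) :
    ∃ f : EE n → ℝ, Continuous f ∧ u =ᵐ[volume] f := by
  let S : EE n → Set ℝ := fun X => {q | ∃ r : ℝ, 0 < r ∧ ∀ᵐ Z, Z ∈ ball X r → q ≤ u Z}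
  have key : ∀ X, ∀ m r ε : ℝ, 0 < r → (∀ᵐ Z, Z ∈ ball X r → |u Z - m| ≤ ε) → |sSup (S X) - m| ≤ ε := by
    intro X m r ε hr hm
    have h1 : m - ε ∈ S X := ⟨r, hr, hm.mono fun Z hZ hZ' => by linarith [(abs_le.1 (hZ hZ')).1]⟩
    have h2 : ∀ q ∈ S X, q ≤ m + ε := by
      rintro q ⟨r', hr', hq⟩
      by_contra hlt
      refine (measure_ball_pos volume X (lt_min hr hr')).ne' (measure_mono_null (fun Z hZ => ?_)
        (hm.and hq))
      rintro ⟨a1, a2⟩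
      have a1 := (abs_le.1 (a1 (ball_subset_ball (min_le_left _ _) hZ))).2
      have a2 := a2 (ball_subset_ball (min_le_right _ _) hZ)
      linarith
    have h3 := le_csSup ⟨_, h2⟩ h1
    have h4 := csSup_le ⟨_, h1⟩ h2
    rw [abs_le]; constructor <;> linarith
  have key2 : ∀ X, ∀ m r ε : ℝ, (∀ᵐ Z, Z ∈ ball X r → |u Z - m| ≤ ε) →
      ∀ Y ∈ ball X r, |sSup (S Y) - m| ≤ ε := by
    intro X m r ε hm Y hY
    refine key Y m (r - dist Y X) ε (sub_pos.2 hY) (hm.mono fun Z hZ hZ' => hZ ?_)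
    exact ball_subset_ball' (by linarith) hZ'
  refine ⟨fun X => sSup (S X), ?_, ?_⟩
  · refine Metric.continuous_iff.2 fun X ε hε => ?_
    obtain ⟨m, r, hr, hm⟩ := h X (ε / 3) (by positivity)
    refine ⟨r, hr, fun Y hY => ?_⟩
    have h1 := abs_le.1 (key2 X m r _ hm Y hY)
    have h2 := abs_le.1 (key2 X m r _ hm X (mem_ball_self hr))
    rw [Real.dist_eq, abs_lt]; constructor <;> linarith
  · have : ∀ k : ℕ, ∀ᵐ Z, Z ∈ (univ : Set (EE n)) → |u Z - sSup (S Z)| ≤ 2 * (1 / ((k : ℝ) + 1)) := fun k => by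
      refine ae_local D fun X _ _ => ?_
      obtain ⟨m, r, hr, hm⟩ := h X (1 / ((k : ℝ) + 1)) (by positivity)
      refine ⟨r, hr, hm.mono fun Z hZ hZ' => ?_⟩
      have h1 := abs_le.1 (key2 X m r _ hm Z hZ')
      have h2 := abs_le.1 (hZ hZ')
      rw [abs_le]; constructor <;> linarith
    filter_upwards [ae_all_iff.2 this] with Z hZ
    have h1 : |u Z - sSup (S Z)| ≤ 2 * 0 := ge_of_tendsto'
      ((tendsto_one_div_add_atTop_nhds_zero_nat (𝕜 := ℝ)).const_mul 2) fun k => hZ k (mem_univ _)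
    rw [mul_zero, abs_nonpos_iff, sub_eq_zero] at h1
    exact h1

theorem exCont (D : Dat n) (hg : ContDiff ℝ 1 g) (hs : HasCompactSupport g)
    (h01 : ∀ X, 0 ≤ g X ∧ g X ≤ 1) :
    ∃ u G, Sol D u G g ∧ Continuous u ∧ (∀ X, 0 ≤ u X ∧ u X ≤ 1) ∧ ∀ y ∈ D.Γ, u y = g y := by
  obtain ⟨u₀, G, hS, hb⟩ := exSol D hg hs h01
  obtain ⟨u, hu, hae⟩ := contRep (u := u₀) D (fun X ε hε => by
    by_cases hX : X ∈ D.Γ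
    · obtain ⟨r, hr, h⟩ := osc_bd hS hX hε
      exact ⟨g X, r, hr, h⟩
    · exact osc_int hS hX hε)
  have hS' : Sol D u G g := ⟨⟨_, hS.1.choose_spec.congr hae (ae_eq_refl _)⟩, hS.2⟩
  refine ⟨u, G, hS', hu, fun X => ⟨?_, ?_⟩, fun y hy => ?_⟩
  · refine ae_open hu isOpen_univ ?_ X (mem_univ X)
    filter_upwards [hb, hae] with Z h1 h2 _
    rw [← h2]; exact h1.1
  · have := ae_open (a := -1) hu.neg isOpen_univ (by
      filter_upwards [hb, hae] with Z h1 h2 _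
      rw [Pi.neg_apply, ← h2]; linarith [h1.2]) X (mem_univ X)
    simp only [Pi.neg_apply] at this
    linarith
  · refine eq_of_forall_dist_le fun ε hε => ?_
    obtain ⟨r, hr, h⟩ := osc_bd hS' hy hε
    have h1 := ae_open (f := fun X => -|u X - g y|) (a := -ε) (by fun_prop) isOpen_ball (U := ball y r) (by
      filter_upwards [h] with Z h1 h2
      linarith [h1 h2]) y (mem_ball_self hr)
    rw [Real.dist_eq]; linarith

end Part15

section Part16
variable {n : ℕ} {D : Dat n} {u u' g g' : EE n → ℝ} {G G' : EE n → EE n} {v v' : ℕ → EE n → ℝ}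

theorem test_bound (D : Dat n) {φ : EE n → ℝ} (h1 : Continuous φ) (h2 : HasCompactSupport φ)
    (h3 : tsupport φ ⊆ D.Γᶜ) : ∃ C : ℝ, ∀ (F : EE n → EE n) (i : Fin n),
      AEStronglyMeasurable F volume →
      ∫⁻ X, ‖F X i * φ X‖ₑ ≤ ENNReal.ofReal C * ∫⁻ X in tsupport φ, ‖F X‖ₑ ∂D.ν := by
  obtain ⟨B, hB⟩ := h2.exists_bound_of_continuous h1
  have hwc : ContinuousOn (fun X => (D.w X)⁻¹) (tsupport φ) := by
    refine ContinuousOn.inv₀ (D.δ_cont.continuousOn.rpow_const fun X hX => Or.inl ?_) fun X hX =>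
      (D.w_pos (h3 hX)).ne'
    exact (D.δ_pos (h3 hX)).ne'
  obtain ⟨C, hC⟩ := IsCompact.exists_bound_of_continuousOn h2 hwc
  refine ⟨B * C, fun F i hF => ?_⟩
  have hm : MeasurableSet (tsupport φ) := (isClosed_tsupport φ).measurableSet
  rw [D.lint_ν hF.enorm hm, ← lintegral_const_mul' _ _ ENNReal.ofReal_ne_top,
    ← lintegral_indicator hm]
  refine lintegral_mono fun X => ?_
  by_cases hX : X ∈ tsupport φ
  · rw [indicator_of_mem hX]
    have hw := D.w_pos (h3 hX)
    have hB0 : 0 ≤ B := (norm_nonneg _).trans (hB X)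
    have e : ‖φ X‖ ≤ B * C * D.w X := by
      have h4 := hC X hX
      rw [Real.norm_eq_abs, abs_of_pos (inv_pos.2 hw)] at h4
      have h5 := mul_le_mul_of_nonneg_left (mul_le_mul_of_nonneg_right h4 hw.le) hB0
      rw [inv_mul_cancel₀ hw.ne', mul_one] at h5
      linarith [hB X]
    have hC0 : 0 ≤ C := (norm_nonneg _).trans (hC X hX)
    calc ‖F X i * φ X‖ₑ ≤ ENNReal.ofReal (‖F X‖ * (B * C * D.w X)) := by
          rw [← ofReal_norm, norm_mul]
          exact ENNReal.ofReal_le_ofReal (mul_le_mul (PiLp.norm_apply_le (F X) i) e (norm_nonneg _)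
            (norm_nonneg _))
      _ = _ := by
          rw [ENNReal.ofReal_mul (norm_nonneg _), ENNReal.ofReal_mul (mul_nonneg hB0 hC0),
            ofReal_norm]; ring
  · simp [image_eq_zero_of_notMem_tsupport hX]

theorem Sol.weak (hS : Sol D u G g) {φ : EE n → ℝ} (h1 : ContDiff ℝ 1 φ)
    (h2 : HasCompactSupport φ) (h3 : tsupport φ ⊆ D.Γᶜ) (i : Fin n) :
    ∫ X, u X * fderiv ℝ φ X (EuclideanSpace.single i 1) = - ∫ X, G X i * φ X := by
  obtain ⟨⟨v, hv⟩, -⟩ := hS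
  set e : EE n := EuclideanSpace.single i 1
  have hfc : ∀ f : EE n → ℝ, ContDiff ℝ 1 f → Continuous fun X => fderiv ℝ f X e := fun f hf =>
    (hf.continuous_fderiv (by norm_num)).clm_apply continuous_const
  have hdc := hfc φ h1
  have hds : HasCompactSupport fun X => fderiv ℝ φ X e := h2.fderiv_apply (𝕜 := ℝ) e
  have ibp : ∀ j, ∫ X, v j X * fderiv ℝ φ X e = - ∫ X, gradient (v j) X i * φ X := fun j => by
    simp_rw [gr_apply]
    refine integral_mul_fderiv_eq_neg_fderiv_mul_of_integrable ?_ ?_ ?_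
      (fun X _ => ((hv.hv j).differentiable (by norm_num)) X)
      (fun X _ => (h1.differentiable (by norm_num)) X)
    · exact ((hfc _ (hv.hv j)).mul h1.continuous).integrable_of_hasCompactSupport h2.mul_left
    · exact ((hv.hv j).continuous.mul hdc).integrable_of_hasCompactSupport hds.mul_left
    · exact ((hv.hv j).continuous.mul h1.continuous).integrable_of_hasCompactSupport h2.mul_left
  obtain ⟨M, hM⟩ := hv.hb
  have t1 : Tendsto (fun j => ∫ X, v j X * fderiv ℝ φ X e) atTop (𝓝 (∫ X, u X * fderiv ℝ φ X e)) := by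
    refine tendsto_integral_of_dominated_convergence (fun X => M * ‖fderiv ℝ φ X e‖)
      (fun j => ((hv.hv j).continuous.mul hdc).aestronglyMeasurable)
      ((hdc.integrable_of_hasCompactSupport hds).norm.const_mul _)
      (fun j => Eventually.of_forall fun X => ?_) ?_
    · rw [norm_mul]; exact mul_le_mul_of_nonneg_right (hM j X) (norm_nonneg _)
    · filter_upwards [hv.hl] with X hX
      exact hX.mul_const _
  obtain ⟨C, hC⟩ := test_bound D h1.continuous h2 h3
  have hGm : AEStronglyMeasurable G volume := hv.hG.1.mono_ac D.ac_ν
  have hci : Continuous fun x : EE n => x i := by fun_prop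
  have hνK : D.ν (tsupport φ) ≠ ⊤ := (IsCompact.measure_lt_top h2).ne
  have hK : D.ν.restrict (tsupport φ) univ ≠ ⊤ := by simpa using hνK
  have : IsFiniteMeasure (D.ν.restrict (tsupport φ)) := ⟨hK.lt_top⟩
  have hGi : Integrable (fun X => G X i * φ X) := by
    refine ⟨(hci.comp_aestronglyMeasurable hGm).mul h1.continuous.aestronglyMeasurable, ?_⟩
    refine (hC G i hGm).trans_lt (ENNReal.mul_lt_top ENNReal.ofReal_lt_top ?_)
    have : MemLp G 1 (D.ν.restrict (tsupport φ)) := (hv.hG.restrict _).mono_exponent (by norm_num)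
    have := this.2
    rwa [eLpNorm_one_eq_lintegral_enorm] at this
  have t2 : Tendsto (fun j => ∫ X, gradient (v j) X i * φ X) atTop (𝓝 (∫ X, G X i * φ X)) := by
    refine tendsto_integral_of_L1 _ hGi.1 (Eventually.of_forall fun j => ?_) ?_
    · exact ((hci.comp (gr_cont (hv.hv j))).mul h1.continuous).integrable_of_hasCompactSupport
        h2.mul_left
    · have t3 := ENNReal.Tendsto.const_mul (a := ENNReal.ofReal C) (hv.toApp0.err hνK)
        (Or.inr ENNReal.ofReal_ne_top)
      rw [mul_zero] at t3
      refine tendsto_of_tendsto_of_tendsto_of_le_of_le tendsto_const_nhds t3 (fun _ => zero_le)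
        fun j => ?_
      refine le_trans (le_of_eq ?_) (hC (fun X => gradient (v j) X - G X) i
        ((gr_cont (hv.hv j)).aestronglyMeasurable.sub hGm))
      refine lintegral_congr fun X => ?_
      rw [← sub_mul]; rfl
  exact tendsto_nhds_unique t1 ((t2.neg).congr fun j => (ibp j).symm)

theorem Sol.energy (hS : Sol D u G g) : (∫⁻ X in D.Γᶜ,
    ENNReal.ofReal (‖G X‖ ^ 2 * Metric.infDist X D.Γ ^ (D.d + 1 - (n : ℝ)))) < ⊤ := by
  have h := hS.memLp.norm.integrable_sq
  rw [D.int_ν_iff] at h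
  refine (setLIntegral_le_lintegral _ _).trans_lt ?_
  refine lt_of_eq_of_lt (lintegral_congr fun X => ?_) h.2
  rw [← ofReal_norm, Real.norm_eq_abs, abs_of_nonneg (mul_nonneg (D.w_nonneg X) (sq_nonneg _)),
    mul_comm]
  rfl

theorem Sol.weakeq (hS : Sol D u G g) {φ : EE n → ℝ} (h1 : ContDiff ℝ 1 φ)
    (h2 : HasCompactSupport φ) (h3 : tsupport φ ⊆ D.Γᶜ) :
    ∫ X, ∑ i, (∑ j, D.A X i j * G X j) * fderiv ℝ φ X (EuclideanSpace.single i 1) = 0 := by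
  have h := hS.2 φ h1 h2 h3
  have e : (fun X => ∑ i, (∑ j, D.A X i j * G X j) * fderiv ℝ φ X (EuclideanSpace.single i 1)) =
      fun X => ∑ i, ∑ j, D.A X i j * G X j * gradient φ X i := by
    ext1 X
    refine Finset.sum_congr rfl fun i _ => ?_
    rw [Finset.sum_mul, gr_apply]
  rw [e]
  by_cases hi : Integrable fun X => ∑ i, ∑ j, D.A X i j * G X j * gradient φ X i
  · rw [← Lam_int hi]; exact h
  · exact integral_undef hi

end Part16

section Part17
variable {n : ℕ} {D : Dat n} {u u' g g' : EE n → ℝ} {G G' : EE n → EE n} {v v' : ℕ → EE n → ℝ}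

theorem harn (D : Dat n) : ∃ c : ℝ, 0 < c ∧ c ≤ 1 ∧ ∀ (u : EE n → ℝ) (G : EE n → EE n)
    (g : EE n → ℝ), Sol D u G g → ∀ (P : EE n) (ρ : ℝ), 0 < ρ → 16 * ρ ≤ D.δ P →
    (∀ᵐ X, X ∈ ball P (8 * ρ) → 0 ≤ u X) → ∀ t : ℝ, 0 ≤ t → (∀ᵐ X, X ∈ ball P ρ → t ≤ u X) →
    ∀ᵐ X, X ∈ ball P (2 * ρ) → c * t ≤ u X := by
  obtain ⟨c, hc, h⟩ := IP D
  refine ⟨min c 1, by positivity, min_le_right _ _, fun u G g hS P ρ hρ hP h0 t ht ht' => ?_⟩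
  rcases ht.eq_or_lt with rfl | ht0
  · filter_upwards [h0] with X hX hX'
    simpa using hX (ball_subset_ball (by linarith) hX')
  · have := h _ _ _ (hS.affine (2 * t)⁻¹ 0) P ρ hρ hP (by
      filter_upwards [h0] with X hX hX'
      have := hX hX'
      positivity) (ball P ρ) measurableSet_ball (ball_subset_ball (by linarith))
      (by rw [two_mul]; exact le_self_add) (by
      filter_upwards [ht'] with X hX hX'
      have := mul_le_mul_of_nonneg_left (hX hX') (by positivity : 0 ≤ (2 * t)⁻¹)
      have e : (2 * t)⁻¹ * t = 1 / 2 := by field_simp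
      linarith)
    filter_upwards [this] with X hX hX'
    have h1 := mul_le_mul_of_nonneg_left (hX hX') (by positivity : 0 ≤ 2 * t)
    rw [mul_add, mul_inv_cancel_left₀ (by positivity)] at h1
    have h2 := mul_le_mul_of_nonneg_right (min_le_left c 1) ht0.le
    nlinarith

theorem line (D : Dat n) : ∃ c : ℝ, 0 < c ∧ c ≤ 1 ∧ ∀ (u : EE n → ℝ) (G : EE n → EE n)
    (g : EE n → ℝ), Sol D u G g → ∀ (N : ℕ) (X Y : EE n) (ρ : ℝ), 0 < N → 0 < ρ → dist X Y ≤ N * ρ →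
    (∀ i ≤ N, 16 * ρ ≤ D.δ (AffineMap.lineMap X Y ((i : ℝ) / N)) ∧
      ∀ᵐ Z, Z ∈ ball (AffineMap.lineMap X Y ((i : ℝ) / N)) (8 * ρ) → 0 ≤ u Z) →
    ∀ t : ℝ, 0 ≤ t → (∀ᵐ Z, Z ∈ ball X ρ → t ≤ u Z) → ∀ᵐ Z, Z ∈ ball Y ρ → c ^ N * t ≤ u Z := by
  obtain ⟨c, hc, hc1, h⟩ := harn D
  refine ⟨c, hc, hc1, fun u G g hS N X Y ρ hN hρ hd hi t ht h0 => ?_⟩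
  have hN' : (0 : ℝ) < N := by exact_mod_cast hN
  have key : ∀ i ≤ N, ∀ᵐ Z, Z ∈ ball (AffineMap.lineMap X Y ((i : ℝ) / N) : EE n) ρ → c ^ i * t ≤ u Z := by
    intro i
    induction i with
    | zero => intro _; simpa using h0
    | succ i ih =>
      intro hiN
      have h1 := h u G g hS _ ρ hρ (hi i (by omega)).1 (hi i (by omega)).2 (c ^ i * t)
        (by positivity) (ih (by omega))
      filter_upwards [h1] with Z hZ hZ'
      have := hZ (ball_subset_ball' (by
        rw [dist_lineMap_lineMap, Real.dist_eq, ← sub_div]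
        push_cast
        rw [add_sub_cancel_left, abs_of_pos (by positivity)]
        have : 1 / (N : ℝ) * dist X Y ≤ ρ := by
          rw [one_div, inv_mul_le_iff₀ hN']; exact hd
        linarith) hZ')
      rwa [pow_succ', mul_assoc]
  have := key N le_rfl
  rwa [div_self hN'.ne', AffineMap.lineMap_apply_one] at this

/-- a good shift -/
theorem shift (D : Dat n) {η : ℝ} (hη : 0 < η) (hη1 : η ≤ 1) : ∃ N : ℕ, 0 < N ∧ 64 / η ≤ N ∧
    ∀ (X Y : EE n) (s : ℝ), 0 < s → ∃ z : EE n, ‖z‖ < η * s / 4 ∧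
      ∀ i ≤ N, 16 * (s / N) ≤ D.δ (AffineMap.lineMap X Y ((i : ℝ) / N) + z) := by
  obtain ⟨K, hK, hv⟩ := D.vol_nbhd
  have hd := D.hd
  have hvB := vB_pos n
  have hlim : Tendsto (fun N : ℕ => 2 * K * 16 ^ ((n : ℝ) - D.d) * (N : ℝ) ^ (-((n : ℝ) - D.d - 1)))
      atTop (𝓝 (2 * K * 16 ^ ((n : ℝ) - D.d) * 0)) :=
    ((tendsto_rpow_neg_atTop (by linarith)).comp tendsto_natCast_atTop_atTop).const_mul _
  rw [mul_zero] at hlim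
  obtain ⟨N, h1, h2, h3⟩ := ((hlim.eventually_lt_const (by positivity : 0 < (η / 4) ^ n * vB n)).and
    ((tendsto_natCast_atTop_atTop.eventually_ge_atTop (64 / η)).and
      (eventually_gt_atTop 0))).exists
  refine ⟨N, h3, h2, fun X Y s hs => ?_⟩
  have hN : (0 : ℝ) < N := by exact_mod_cast h3
  have hN1 : (1 : ℝ) ≤ N := by exact_mod_cast h3
  have h4 : 64 ≤ N * η := by rwa [div_le_iff₀ hη] at h2
  set R := η * s / 4 with hR
  have hRp : 0 < R := by positivity
  set ε := 16 * (s / N) with hε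
  have hεp : 0 < ε := by positivity
  have hεs : ε ≤ s / 4 := by
    rw [hε, mul_div_assoc', div_le_iff₀ hN]; nlinarith
  by_contra! hcon
  have hcov : ball (0 : EE n) R ⊆ ⋃ i ∈ Finset.range (N + 1),
      (fun z => AffineMap.lineMap X Y ((i : ℝ) / N) + z) ⁻¹'
        ({Z | D.δ Z < ε} ∩ ball (AffineMap.lineMap X Y ((i : ℝ) / N)) R) := by
    intro z hz
    rw [mem_ball_zero_iff] at hz
    obtain ⟨i, hi, hi'⟩ := hcon z hz
    simp only [mem_iUnion]
    exact ⟨i, Finset.mem_range.2 (by omega), hi', by simpa [mem_ball, dist_eq_norm] using hz⟩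
  have hm := (measure_mono (μ := volume) hcov).trans (measure_biUnion_finset_le _ _)
  simp only [measure_preimage_add] at hm
  have hm2 := hm.trans (Finset.sum_le_sum fun i _ => hv (AffineMap.lineMap X Y ((i : ℝ) / N)) ε R hεp hRp)
  rw [Finset.sum_const, Finset.card_range, nsmul_eq_mul, vol_ball _ hRp, ← ENNReal.ofReal_natCast,
    ← ENNReal.ofReal_mul (by positivity), ENNReal.ofReal_le_ofReal_iff (by positivity)] at hm2
  have e1 : (R + 2 * ε) ^ D.d ≤ s ^ D.d :=
    Real.rpow_le_rpow (by positivity) (by rw [hR]; nlinarith) D.hd0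
  have e2 : ε ^ ((n : ℝ) - D.d) = 16 ^ ((n : ℝ) - D.d) * s ^ ((n : ℝ) - D.d) *
      (N : ℝ) ^ (-((n : ℝ) - D.d)) := by
    rw [hε, Real.mul_rpow (by norm_num) (by positivity), Real.div_rpow hs.le hN.le,
      Real.rpow_neg hN.le]; ring
  have e3 : s ^ ((n : ℝ) - D.d) * s ^ D.d = s ^ n := by
    rw [← Real.rpow_add hs, sub_add_cancel, Real.rpow_natCast]
  have e4 : (N : ℝ) * (N : ℝ) ^ (-((n : ℝ) - D.d)) = (N : ℝ) ^ (-((n : ℝ) - D.d - 1)) := by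
    nth_rewrite 1 [← Real.rpow_one (N : ℝ)]
    rw [← Real.rpow_add hN]; ring_nf
  have e5 : ((N + 1 : ℕ) : ℝ) * (K * (ε ^ ((n : ℝ) - D.d) * (R + 2 * ε) ^ D.d)) ≤
      (2 * K * 16 ^ ((n : ℝ) - D.d) * (N : ℝ) ^ (-((n : ℝ) - D.d - 1))) * s ^ n := by
    calc _ ≤ (2 * (N : ℝ)) * (K * (ε ^ ((n : ℝ) - D.d) * s ^ D.d)) := by
          push_cast
          refine mul_le_mul (by linarith) ?_ (by positivity) (by positivity)
          exact mul_le_mul_of_nonneg_left (mul_le_mul_of_nonneg_left e1 (by positivity)) hK.le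
      _ = 2 * K * 16 ^ ((n : ℝ) - D.d) * ((N : ℝ) * (N : ℝ) ^ (-((n : ℝ) - D.d))) *
          (s ^ ((n : ℝ) - D.d) * s ^ D.d) := by rw [e2]; ring
      _ = _ := by rw [e3, e4]
  have e6 := mul_lt_mul_of_pos_right h1 (pow_pos hs n)
  have e7 : R ^ n * vB n = (η / 4) ^ n * vB n * s ^ n := by
    rw [hR, show η * s / 4 = (η / 4) * s by ring, mul_pow]; ring
  linarith

theorem chain (D : Dat n) {η : ℝ} (hη : 0 < η) (hη1 : η ≤ 1) : ∃ κ σ : ℝ, 0 < κ ∧ κ ≤ 1 ∧ 0 < σ ∧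
    σ ≤ η / 64 ∧ ∀ (u : EE n → ℝ) (G : EE n → EE n) (g : EE n → ℝ), Sol D u G g →
    ∀ (X Y : EE n) (s : ℝ), 0 < s → η * s ≤ D.δ X → η * s ≤ D.δ Y → dist X Y ≤ s →
    (∀ᵐ Z, Z ∈ ball X (2 * s) → 0 ≤ u Z) → ∀ t : ℝ, 0 ≤ t → (∀ᵐ Z, Z ∈ ball X (σ * s) → t ≤ u Z) →
    ∀ᵐ Z, Z ∈ ball Y (σ * s) → κ * t ≤ u Z := by
  obtain ⟨c, hc, hc1, h⟩ := line D
  obtain ⟨N, hN, hN64, hsh⟩ := shift D hη hη1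
  have hN' : (0 : ℝ) < N := by exact_mod_cast hN
  have h4 : 64 ≤ N * η := by rwa [div_le_iff₀ hη] at hN64
  refine ⟨(c ^ N) ^ 3, 1 / N, by positivity, pow_le_one₀ (by positivity) (pow_le_one₀ hc.le hc1),
    by positivity, ?_, fun u G g hS X Y s hs hX hY hXY h0 t ht h1 => ?_⟩
  · rw [div_le_div_iff₀ hN' (by norm_num)]; linarith
  obtain ⟨z, hz, hz'⟩ := hsh X Y s hs
  set ρ := s / N with hρ
  have hρp : 0 < ρ := by positivity
  have hρη : ρ ≤ η * s / 64 := by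
    rw [hρ, div_le_div_iff₀ hN' (by norm_num)]; nlinarith
  have e : 1 / (N : ℝ) * s = ρ := by rw [hρ]; ring
  have hηs : η * s ≤ s := by nlinarith
  have eN : (N : ℝ) * ρ = s := by rw [hρ]; field_simp
  rw [e] at h1 ⊢
  have hpos : ∀ W : EE n, dist W X ≤ s + η * s / 4 → ∀ᵐ Z, Z ∈ ball W (8 * ρ) → 0 ≤ u Z := by
    intro W hW
    filter_upwards [h0] with Z hZ hZ'
    exact hZ (ball_subset_ball' (by linarith) hZ')
  have hfrac : ∀ i ≤ N, (0 : ℝ) ≤ (i : ℝ) / N ∧ (i : ℝ) / N ≤ 1 := fun i hi =>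
    ⟨by positivity, by rw [div_le_one hN']; exact_mod_cast hi⟩
  have hline : ∀ P Q : EE n, ∀ i ≤ N, dist (AffineMap.lineMap P Q ((i : ℝ) / N) : EE n) P ≤ dist P Q := by
    intro P Q i hi
    rw [dist_lineMap_left, Real.norm_eq_abs, abs_of_nonneg (hfrac i hi).1]
    exact mul_le_of_le_one_left dist_nonneg (hfrac i hi).2
  have hzd : ∀ P : EE n, dist P (P + z) = ‖z‖ := fun P => by simp [dist_eq_norm]
  have s1 := h u G g hS N X (X + z) ρ hN hρp (by rw [hzd, eN]; linarith) (fun i hi => by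
    have := hline X (X + z) i hi
    rw [hzd] at this
    refine ⟨?_, hpos _ (by linarith)⟩
    have h5 := D.δ_lip X (AffineMap.lineMap X (X + z) ((i : ℝ) / N))
    rw [dist_comm] at h5
    linarith) t ht h1
  have s2 := h u G g hS N (X + z) (Y + z) ρ hN hρp (by rw [dist_add_right, eN]; exact hXY)
    (fun i hi => by
      have e2 : (AffineMap.lineMap (X + z) (Y + z) ((i : ℝ) / N) : EE n) =
          AffineMap.lineMap X Y ((i : ℝ) / N) + z := by
        simp only [AffineMap.lineMap_apply_module]; module
      rw [e2]
      refine ⟨hz' i hi, hpos _ ?_⟩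
      have h5 := hline X Y i hi
      have h6 := dist_triangle (AffineMap.lineMap X Y ((i : ℝ) / N) + z)
        (AffineMap.lineMap X Y ((i : ℝ) / N)) X
      rw [dist_comm _ (AffineMap.lineMap X Y ((i : ℝ) / N)), hzd] at h6
      linarith) (c ^ N * t) (by positivity) s1
  have s3 := h u G g hS N (Y + z) Y ρ hN hρp (by rw [dist_comm, hzd, eN]; linarith) (fun i hi => by
    have e2 : dist (AffineMap.lineMap (Y + z) Y ((i : ℝ) / N) : EE n) Y ≤ ‖z‖ := by
      rw [dist_lineMap_right, dist_comm, hzd, Real.norm_eq_abs,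
        abs_of_nonneg (by linarith [(hfrac i hi).2])]
      exact mul_le_of_le_one_left (norm_nonneg _) (by linarith [(hfrac i hi).1])
    refine ⟨?_, hpos _ ?_⟩
    · have h5 := D.δ_lip Y (AffineMap.lineMap (Y + z) Y ((i : ℝ) / N))
      rw [dist_comm] at h5
      linarith
    · have h6 := dist_triangle (AffineMap.lineMap (Y + z) Y ((i : ℝ) / N)) Y X
      rw [dist_comm Y X] at h6
      linarith) (c ^ N * (c ^ N * t)) (by positivity) s2
  filter_upwards [s3] with Z hZ hZ'
  have := hZ hZ'
  linarith

theorem cork (D : Dat n) : ∃ c : ℝ, 0 < c ∧ c ≤ 1 ∧ ∀ (y : EE n) (s : ℝ), 0 < s →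
    ∃ X ∈ ball y s, c * s ≤ D.δ X := by
  obtain ⟨K, hK, hv⟩ := D.vol_nbhd
  have hd := D.hd
  have hd0 := D.hd0
  have hvB := vB_pos n
  have hlim : Tendsto (fun c : ℝ => K * (c ^ ((n : ℝ) - D.d) * 3 ^ D.d)) (𝓝[>] 0)
      (𝓝 (K * (0 ^ ((n : ℝ) - D.d) * 3 ^ D.d))) := by
    have : ContinuousAt (fun c : ℝ => c ^ ((n : ℝ) - D.d)) 0 :=
      Real.continuousAt_rpow_const _ _ (Or.inr (by linarith))
    exact ((this.tendsto.mul_const _).const_mul K).mono_left nhdsWithin_le_nhds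
  rw [Real.zero_rpow (by linarith), zero_mul, mul_zero] at hlim
  obtain ⟨c, h1, h2, h3⟩ := ((hlim.eventually_lt_const hvB).and
    ((eventually_nhdsWithin_of_eventually_nhds (eventually_le_nhds (zero_lt_one' ℝ))).and
      (eventually_mem_nhdsWithin (a := (0 : ℝ)) (s := Ioi 0)))).exists
  have h3 : 0 < c := h3
  refine ⟨c, h3, h2, fun y s hs => ?_⟩
  by_contra! hcon
  have hm := (measure_mono (μ := volume) (fun X hX => ⟨hcon X hX, hX⟩ :
    ball y s ⊆ {Z | D.δ Z < c * s} ∩ ball y s)).trans (hv y (c * s) s (by positivity) hs)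
  rw [vol_ball _ hs, ENNReal.ofReal_le_ofReal_iff (by positivity)] at hm
  have e1 : (s + 2 * (c * s)) ^ D.d ≤ 3 ^ D.d * s ^ D.d := by
    rw [← Real.mul_rpow (by norm_num) hs.le]
    exact Real.rpow_le_rpow (by positivity) (by nlinarith) D.hd0
  have e3 : s ^ ((n : ℝ) - D.d) * s ^ D.d = s ^ n := by
    rw [← Real.rpow_add hs, sub_add_cancel, Real.rpow_natCast]
  have e5 : K * ((c * s) ^ ((n : ℝ) - D.d) * (s + 2 * (c * s)) ^ D.d) ≤
      (K * (c ^ ((n : ℝ) - D.d) * 3 ^ D.d)) * s ^ n := by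
    rw [← e3, Real.mul_rpow h3.le hs.le]
    calc _ ≤ K * (c ^ ((n : ℝ) - D.d) * s ^ ((n : ℝ) - D.d) * (3 ^ D.d * s ^ D.d)) :=
          mul_le_mul_of_nonneg_left (mul_le_mul_of_nonneg_left e1 (by positivity)) hK.le
      _ = _ := by ring
  have e6 := mul_lt_mul_of_pos_right h1 (pow_pos hs n)
  linarith

end Part17

section Part18
variable {n : ℕ} {D : Dat n} {u u' g g' : EE n → ℝ} {G G' : EE n → EE n} {v v' : ℕ → EE n → ℝ}

theorem dssStep (D : Dat n) : ∃ η L θ : ℝ, 0 < η ∧ η ≤ 1 / 4 ∧ 0 < L ∧ 0 ≤ θ ∧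
    ∀ (f : EE n → ℝ) (G : EE n → EE n) (g : EE n → ℝ), Sol D f G g → Continuous f →
    ∀ y : EE n, ∀ s a : ℝ, 0 < s → 0 ≤ a → (∀ z ∈ D.Γ, z ∈ ball y s → 0 ≤ g z) →
    (∀ X ∈ ball y s, -a ≤ f X) → (∀ X ∈ ball y s, η * s ≤ D.δ X → L * a ≤ f X) →
    (∀ X ∈ ball y (s / 2), -(a * θ) ≤ f X) ∧
    (∀ X ∈ ball y (s / 2), η * (s / 2) ≤ D.δ X → L * (a * θ) ≤ f X) := by
  obtain ⟨c, hc, hc1, hit⟩ := bditer D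
  obtain ⟨c₁, hc₁, hc₁1, hck⟩ := cork D
  set q : ℝ := 1 + 4 / c₁ with hq
  have hq1 : 1 ≤ q := by rw [hq]; have : 0 < 4 / c₁ := by positivity
                         linarith
  have hqp : 0 < q := by linarith
  obtain ⟨κ, σ, hκ, hκ1, hσ, hσ1, hch⟩ := chain D (η := 1 / q) (by positivity) (by
    rw [div_le_one hqp]; exact hq1)
  obtain ⟨N, hN⟩ := exists_pow_lt_of_lt_one (show 0 < κ / 2 by positivity) (show 1 - c < 1 by linarith)
  have hθ : 0 ≤ (1 - c) ^ N := pow_nonneg (by linarith) _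
  have h6 : (0 : ℝ) < 6 ^ N := by positivity
  have h61 : (1 : ℝ) ≤ 6 ^ N := one_le_pow₀ (by norm_num)
  set η : ℝ := min (1 / (4 * 6 ^ N)) (1 / (6 * q)) with hη
  have hηp : 0 < η := by positivity
  have hη1 : η * 6 ^ N ≤ 1 / 4 := by
    have := min_le_left (1 / (4 * 6 ^ N)) (1 / (6 * q))
    rw [← hη, le_div_iff₀ (by positivity)] at this
    linarith
  have hη2 : η * q ≤ 1 / 6 := by
    have := min_le_right (1 / (4 * 6 ^ N)) (1 / (6 * q))
    rw [← hη, le_div_iff₀ (by positivity)] at this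
    linarith
  have hη4 : η ≤ 1 / 4 := le_trans (by nlinarith) hη1
  refine ⟨η, 2 / κ, (1 - c) ^ N, hηp, hη4, by positivity, hθ,
    fun f G g hS hf y s a hs ha hg h1 h2 => ?_⟩
  have hL : 0 ≤ 2 / κ * a := by positivity
  have hLκ : κ * (2 / κ * a) = 2 * a := by field_simp
  have hLθ : 2 / κ * (a * (1 - c) ^ N) ≤ a := by
    have : 2 / κ * (1 - c) ^ N ≤ 1 := by
      rw [div_mul_eq_mul_div, div_le_one hκ]; linarith
    nlinarith
  have haθ : a * (1 - c) ^ N ≤ 2 / κ * a := by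
    have : (1 - c) ^ N ≤ 2 / κ := by
      rw [le_div_iff₀ hκ]
      nlinarith [pow_le_one₀ (n := N) (show 0 ≤ 1 - c by linarith) (by linarith)]
    nlinarith
  have hsub2 : ball y (s / 2) ⊆ ball y s := ball_subset_ball (by linarith)
  refine ⟨fun X hX => ?_, fun X hX hδ => ?_⟩
  · by_cases hδ : η * s ≤ D.δ X
    · have := h2 X (hsub2 hX) hδ
      have : 0 ≤ a * (1 - c) ^ N := by positivity
      linarith
    · push Not at hδ
      obtain ⟨z, hz, hz'⟩ := D.exists_near X
      have hXy := mem_ball.1 hX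
      have hzy : dist z y ≤ D.δ X + dist X y := by
        rw [hz', dist_comm X z]; exact dist_triangle _ _ _
      have hηs : η * s ≤ s / 4 := by nlinarith
      have hsb : ball z (s / 2 - η * s) ⊆ ball y s := ball_subset_ball' (by linarith)
      have := hit f G g hS z hz (s / 2 - η * s) a (by linarith) ha
        (Eventually.of_forall fun Z hZ => h1 Z (hsb hZ)) (fun w hw hw' => hg w hw (hsb hw')) N
      refine ae_open hf isOpen_ball this X ?_
      rw [mem_ball, ← hz', lt_div_iff₀ h6]
      have : D.δ X * 6 ^ N < η * s * 6 ^ N := by gcongr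
      have : η * s * 6 ^ N ≤ s / 4 := by nlinarith
      linarith
  · by_cases hδ' : η * s ≤ D.δ X
    · have := h2 X (hsub2 hX) hδ'
      have : 2 / κ * (a * (1 - c) ^ N) ≤ 2 / κ * a := by
        gcongr
        exact mul_le_of_le_one_right ha (pow_le_one₀ (by linarith) (by linarith))
      linarith
    · push Not at hδ'
      set t := D.δ X with ht
      have htp : 0 < t := lt_of_lt_of_le (by positivity) hδ
      obtain ⟨z, hz, hz'⟩ := D.exists_near X
      obtain ⟨X', hX', hX'δ⟩ := hck z (4 * t / c₁) (by positivity)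
      have e1 : c₁ * (4 * t / c₁) = 4 * t := by field_simp
      rw [e1] at hX'δ
      have e2 : t * q = t + 4 * t / c₁ := by rw [hq]; ring
      have hd1 : dist X' X ≤ t * q := by
        have := dist_triangle X' z X
        rw [dist_comm z X, ← hz'] at this
        have := mem_ball.1 hX'
        linarith
      have hd2 : dist X' y ≤ t * q + s / 2 := by
        have := dist_triangle X' X y
        have := mem_ball.1 hX
        linarith
      have e3 : t * q ≤ s / 6 := by nlinarith
      have e4 : 1 / q * (t * q) = t := by field_simp
      have e5 : σ * (t * q) ≤ t / 64 := by
        have : σ * (t * q) ≤ 1 / q / 64 * (t * q) := by gcongr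
        have : 1 / q / 64 * (t * q) = t / 64 := by field_simp
        linarith
      have hsb : ball X' (2 * (t * q)) ⊆ ball y s := ball_subset_ball' (by linarith)
      have hσs : ball X' (σ * (t * q)) ⊆ ball X' (2 * (t * q)) := ball_subset_ball (by nlinarith)
      have := hch _ _ _ (hS.affine 1 a) X' X (t * q) (by positivity) (by rw [e4]; linarith)
        (by rw [e4]) hd1 (Eventually.of_forall fun Z hZ => by linarith [h1 Z (hsb hZ)])
        (2 / κ * a) hL (Eventually.of_forall fun Z hZ => by
          have := h2 Z (hsb (hσs hZ)) (by
            have := D.δ_lip X' Z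
            have := mem_ball.1 hZ
            rw [dist_comm] at this
            linarith)
          linarith)
      have := ae_open (f := fun X => 1 * f X + a) (by fun_prop) isOpen_ball this X
        (mem_ball_self (by positivity))
      simp only [hLκ] at this
      linarith only [this, hLθ]

theorem dss (D : Dat n) : ∃ η L : ℝ, 0 < η ∧ η ≤ 1 / 4 ∧ 0 < L ∧
    ∀ (f : EE n → ℝ) (G : EE n → EE n) (g : EE n → ℝ), Sol D f G g → Continuous f →
    ∀ y : EE n, ∀ s a : ℝ, 0 < s → 0 ≤ a → (∀ z ∈ D.Γ, z ∈ ball y s → 0 ≤ g z) →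
    (∀ X ∈ ball y s, -a ≤ f X) → (∀ X ∈ ball y s, η * s ≤ D.δ X → L * a ≤ f X) →
    ∀ X ∉ D.Γ, dist X y = D.δ X → D.δ X < s → 0 ≤ f X := by
  obtain ⟨η, L, θ, hη, hη1, hL, hθ, h⟩ := dssStep D
  refine ⟨η, L, hη, hη1, hL, fun f G g hS hf y s a hs ha hg h1 h2 X hX hXy hXs => ?_⟩
  have key : ∀ k : ℕ, (∀ X ∈ ball y (s / 2 ^ k), -(a * θ ^ k) ≤ f X) ∧
      (∀ X ∈ ball y (s / 2 ^ k), η * (s / 2 ^ k) ≤ D.δ X → L * (a * θ ^ k) ≤ f X) := by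
    intro k
    induction k with
    | zero => simpa using ⟨fun X hX => h1 X (by simpa using hX), fun X hX h' => h2 X (by simpa using hX) h'⟩
    | succ k ih =>
      have hk : s / 2 ^ k ≤ s := div_le_self hs.le (one_le_pow₀ (by norm_num))
      have := h f G g hS hf y (s / 2 ^ k) (a * θ ^ k) (by positivity) (by positivity)
        (fun z hz hz' => hg z hz (ball_subset_ball hk hz')) ih.1 ih.2
      rw [div_div, ← pow_succ, mul_assoc, ← pow_succ] at this
      exact this
  have hδ := D.δ_pos hX
  obtain ⟨k, hk1, hk2⟩ := exists_nat_pow_near (y := (2:ℝ)) (x := s / D.δ X)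
    (by rw [le_div_iff₀ hδ]; linarith) (by norm_num)
  rw [le_div_iff₀ hδ] at hk1
  rw [div_lt_iff₀ hδ] at hk2
  rcases k with _ | k
  · refine le_trans (by positivity) ((key 0).2 X (by rw [mem_ball, hXy]; simpa using hXs) ?_)
    simp only [pow_zero, div_one]
    norm_num at hk2
    nlinarith
  · have hp : (0 : ℝ) < 2 ^ k := by positivity
    have hq := mul_pos hp hδ
    have e1 : (2 : ℝ) ^ (k + 1) = 2 * 2 ^ k := by ring
    have e2 : (2 : ℝ) ^ (k + 1 + 1) = 4 * 2 ^ k := by ring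
    rw [e1] at hk1
    rw [e2] at hk2
    refine le_trans (by positivity) ((key k).2 X ?_ ?_)
    · rw [mem_ball, hXy, lt_div_iff₀ hp]
      linarith
    · rw [← mul_div_assoc, div_le_iff₀ hp]
      nlinarith

end Part18

section Part19
variable {n : ℕ} {D : Dat n} {u u' g g' : EE n → ℝ} {G G' : EE n → EE n} {v v' : ℕ → EE n → ℝ}

theorem low (D : Dat n) {η : ℝ} (hη : 0 < η) (hη1 : η ≤ 1) : ∃ c : ℝ, 0 < c ∧
    ∀ (u : EE n → ℝ) (G : EE n → EE n) (g : EE n → ℝ), Sol D u G g → Continuous u →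
    (∀ X, 0 ≤ u X) → ∀ x : EE n, x ∈ D.Γ → ∀ r : ℝ, 0 < r →
    (∀ z ∈ ball x (r / 2), 1 ≤ g z) → ∀ X ∈ ball x (4 * r), η * (r / 10) ≤ D.δ X → c ≤ u X := by
  obtain ⟨c, hc, hBD⟩ := BD D
  obtain ⟨c₁, hc₁, hc₁1, hck⟩ := cork D
  obtain ⟨κ, σ, hκ, hκ1, hσ, hσ1, hch⟩ := chain D (η := min (η / 50) (c₁ / 100)) (by positivity)
    ((min_le_left _ _).trans (by linarith))
  have m1 := min_le_left (η / 50) (c₁ / 100)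
  have m2 := min_le_right (η / 50) (c₁ / 100)
  set η' := min (η / 50) (c₁ / 100)
  refine ⟨κ * c, by positivity, fun u G g hS hu h0 x hx r hr hg X hX hδ => ?_⟩
  obtain ⟨X₀, hX₀, hδ₀⟩ := hck x (r / 20) (by positivity)
  have hδp : 0 < D.δ X₀ := lt_of_lt_of_le (by positivity) hδ₀
  have hX₀' := mem_ball.1 hX₀
  have hδ1 : D.δ X₀ ≤ r / 20 := (D.δ_le hx).trans hX₀'.le
  obtain ⟨y, hy, hy'⟩ := D.exists_near X₀
  have hyx : dist y x ≤ D.δ X₀ + dist X₀ x := by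
    rw [hy', dist_comm X₀ y]; exact dist_triangle _ _ _
  have hX₀Γ : X₀ ∉ D.Γ := fun h => by
    have := D.δ_le (X := X₀) h
    rw [dist_self] at this; linarith
  have h1 := hBD u G g hS X₀ hX₀Γ y hy hy'.symm (Eventually.of_forall fun Z _ => h0 Z)
    (fun z _ hz => hg z (ball_subset_ball' (by linarith) hz))
  have e1 : η' * (5 * r) ≤ c₁ / 100 * (5 * r) := by gcongr
  have e2 : η' * (5 * r) ≤ η / 50 * (5 * r) := by gcongr
  have e3 : σ * (5 * r) ≤ η' / 64 * (5 * r) := by gcongr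
  have hX' := mem_ball.1 hX
  have h2 := hch u G g hS X₀ X (5 * r) (by positivity) (by linarith) (by linarith)
    ((dist_triangle_right X₀ X x).trans (by linarith)) (Eventually.of_forall fun Z _ => h0 Z)
    c hc.le (by
      filter_upwards [h1] with Z hZ hZ'
      exact hZ (ball_subset_ball (by linarith) hZ'))
  exact ae_open hu isOpen_ball h2 X (mem_ball_self (by positivity))

theorem cmpD (D : Dat n) : ∃ M : ℝ, 0 < M ∧ ∀ x ∈ D.Γ, ∀ r : ℝ, 0 < r →
    ∀ (u : EE n → ℝ) (G : EE n → EE n) (g : EE n → ℝ) (v : EE n → ℝ) (G' : EE n → EE n)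
    (g' : EE n → ℝ) (Λ Λ' : ℝ), Sol D u G g → Sol D v G' g' → Continuous u → Continuous v →
    (∀ X, 0 ≤ u X) → (∀ X, v X ≤ 1) → Cut g x (r / 2) r Λ → Cut g' x (2 * r) (5 / 2 * r) Λ' →
    ∀ X, 4 * r ≤ dist X x → v X ≤ M * u X := by
  obtain ⟨η, L, hη, hη1, hL, hdss⟩ := dss D
  obtain ⟨c, hc, hlow⟩ := low D hη (by linarith)
  refine ⟨(L + 1) / c, by positivity, fun x hx r hr u G g v G' g' Λ Λ' hu hv cu cv hu0 hv1 hg hg' X hX => ?_⟩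
  set M := (L + 1) / c with hM
  have hMp : 0 < M := by positivity
  have hMc : M * c = L + 1 := by rw [hM]; field_simp
  have hS := (hu.affine M 0).add (hv.affine (-1) 0)
  have hf : Continuous fun X => M * u X + 0 + (-1 * v X + 0) := by fun_prop
  have hf1 : ∀ X, -1 ≤ M * u X + 0 + (-1 * v X + 0) := fun X => by
    have := mul_nonneg hMp.le (hu0 X)
    linarith [hv1 X]
  have hf2 : ∀ X ∈ ball x (4 * r), η * (r / 10) ≤ D.δ X → L ≤ M * u X + 0 + (-1 * v X + 0) := by
    intro X hX hδ
    have h1 := hlow u G g hu cu hu0 x hx r hr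
      (fun z hz => (hg.h1 z (mem_ball.1 hz).le).ge) X hX hδ
    have : M * c ≤ M * u X := by gcongr
    linarith [hv1 X]
  have hg0 : ∀ X, 5 / 2 * r ≤ dist X x → 0 ≤ M * g X + 0 + (-1 * g' X + 0) := fun X hX => by
    have := mul_nonneg hMp.le (hg.h01 X).1
    rw [(hg'.h0 X hX).1]; linarith
  have hann : ∀ X ∉ D.Γ, 3.2 * r ≤ dist X x → dist X x ≤ 3.6 * r →
      0 ≤ M * u X + 0 + (-1 * v X + 0) := by
    intro X hXΓ h1 h2
    by_cases hδ : r / 10 ≤ D.δ X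
    · exact hL.le.trans (hf2 X (by rw [mem_ball]; linarith) (le_trans (by nlinarith) hδ))
    · push Not at hδ
      obtain ⟨y, hy, hy'⟩ := D.exists_near X
      have hyx : dist y x ≤ D.δ X + dist X x := by
        rw [hy', dist_comm X y]; exact dist_triangle _ _ _
      have hxy : dist X x ≤ D.δ X + dist y x := by
        rw [hy']; exact dist_triangle _ _ _
      have hsb : ball y (r / 10) ⊆ ball x (4 * r) := ball_subset_ball' (by linarith)
      refine hdss _ _ _ hS hf y (r / 10) 1 (by positivity) zero_le_one (fun z _ hz => hg0 z ?_)
        (fun Z _ => hf1 Z) (fun Z hZ hδZ => by rw [mul_one]; exact hf2 Z (hsb hZ) hδZ) X hXΓ hy'.symm hδ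
      have := mem_ball'.1 hz
      have := dist_triangle y z x
      linarith
  obtain ⟨e, he⟩ := exCut x (a := 3.2 * r) (b := 3.6 * r) (by positivity) (by linarith)
  have hχ := (App.cut (D := D) he.cd he.hs).comp (K := fun t => 1 - t) (by fun_prop)
  obtain ⟨⟨w, hw⟩, hW⟩ := hS
  have hmp := MP hw.toApp0 hW hχ (fun X => by
      have := he.h01 X
      constructor <;> linarith) (fun X hX => by
      refine hg0 X ?_
      by_contra h
      push Not at h
      exact hX (by rw [he.h1 X (by linarith)]; norm_num)) (by
      filter_upwards [D.ae_notΓ] with X hXΓ hX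
      have hgr : gradient e X ≠ 0 := fun h => hX (by simp [h])
      refine hann X hXΓ ?_ ?_
      · by_contra h
        push Not at h
        have hm : IsLocalMax e X := Eventually.of_forall fun Z => by
          change e Z ≤ e X
          rw [he.h1 X h.le]; exact (he.h01 Z).2
        exact hgr (by simp [gradient, hm.fderiv_eq_zero])
      · by_contra h
        push Not at h
        exact hgr (he.h0 X h.le).2)
  have := ae_open hf (U := {X | 3.6 * r < dist X x}) (isOpen_lt (by fun_prop) (by fun_prop)) (a := 0) (by
    filter_upwards [hmp] with Z hZ hZ'
    refine hZ ?_
    rw [(he.h0 Z (le_of_lt hZ')).1]; norm_num) X (by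
    change 3.6 * r < dist X x
    linarith)
  linarith

end Part19

theorem elliptic_measure_doubling
    (n : ℕ) (d C₀ C₃ : ℝ) (hd₀ : 0 ≤ d) (hd : d < (n : ℝ) - 1) (hC₀ : 0 < C₀) (hC₃ : 0 < C₃)
    (Γ : Set (EuclideanSpace ℝ (Fin n))) (hclosed : IsClosed Γ) (hΓne : Γ.Nonempty)
    (hunb : ¬ Bornology.IsBounded Γ)
    (hAR : ∀ x ∈ Γ, ∀ r : ℝ, 0 < r →
      ENNReal.ofReal (C₀⁻¹ * r ^ d) ≤ μH[d] (Γ ∩ ball x r) ∧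
      μH[d] (Γ ∩ ball x r) ≤ ENNReal.ofReal (C₀ * r ^ d))
    (A : EuclideanSpace ℝ (Fin n) → Matrix (Fin n) (Fin n) ℝ)
    -- degenerate ellipticity and boundedness with weight w(X) = dist(X,Γ)^{d+1-n}
    (hell : ∀ X ∉ Γ, ∀ ξ ζ : EuclideanSpace ℝ (Fin n),
      C₃⁻¹ * Metric.infDist X Γ ^ (d + 1 - (n : ℝ)) * ‖ξ‖ ^ 2 ≤
          ∑ i, ∑ j, A X i j * ξ j * ξ i ∧
      |∑ i, ∑ j, A X i j * ξ j * ζ i| ≤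
          C₃ * Metric.infDist X Γ ^ (d + 1 - (n : ℝ)) * ‖ξ‖ * ‖ζ‖)
    (ω : EuclideanSpace ℝ (Fin n) → Measure (EuclideanSpace ℝ (Fin n)))
    -- ω X is a Borel probability measure carried by Γ, for each pole X ∈ Ω
    (hprob : ∀ X ∉ Γ, IsProbabilityMeasure (ω X) ∧ ω X Γᶜ = 0)
    -- defining property of the elliptic measure: it represents continuous solutions
    -- of Lu = 0 in Ω lying in the energy space W, via their boundary values
    (hrepr : ∀ (u : EuclideanSpace ℝ (Fin n) → ℝ)
      (G : EuclideanSpace ℝ (Fin n) → EuclideanSpace ℝ (Fin n)),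
      Continuous u →
      (∀ φ : EuclideanSpace ℝ (Fin n) → ℝ, ContDiff ℝ (⊤ : ℕ∞) φ → HasCompactSupport φ →
        tsupport φ ⊆ Γᶜ → ∀ i : Fin n,
          ∫ X, u X * fderiv ℝ φ X (EuclideanSpace.single i 1) = - ∫ X, G X i * φ X) →
      ((∫⁻ X in Γᶜ,
          ENNReal.ofReal (‖G X‖ ^ 2 * Metric.infDist X Γ ^ (d + 1 - (n : ℝ)))) < ⊤) →
      (∀ φ : EuclideanSpace ℝ (Fin n) → ℝ, ContDiff ℝ (⊤ : ℕ∞) φ → HasCompactSupport φ →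
        tsupport φ ⊆ Γᶜ →
          ∫ X, ∑ i, (∑ j, A X i j * G X j) * fderiv ℝ φ X (EuclideanSpace.single i 1) = 0) →
      ∀ X ∉ Γ, u X = ∫ y, u y ∂(ω X))
 :
    ∃ C : ℝ, 0 < C ∧
      ∀ x ∈ Γ, ∀ r : ℝ, 0 < r →
        ∀ X ∉ Γ, X ∉ ball x (4 * r) →
          ω X (ball x (2 * r) ∩ Γ) ≤ ENNReal.ofReal C * ω X (ball x r ∩ Γ) := by
  let D : Dat n := ⟨d, C₀, C₃, hd₀, hd, hC₀, hC₃, Γ, hclosed, hΓne, hAR, A, hell⟩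
  obtain ⟨M, hM, hcmp⟩ := cmpD D
  refine ⟨M, hM, fun x hx r hr X hX hX4 => ?_⟩
  obtain ⟨g, hg⟩ := exCut x (a := r / 2) (b := r) (by positivity) (by linarith)
  obtain ⟨g', hg'⟩ := exCut x (a := 2 * r) (b := 5 / 2 * r) (by positivity) (by linarith)
  obtain ⟨u, G, hS, hu, hu01, hug⟩ := exCont D hg.cd hg.hs hg.h01
  obtain ⟨v, G', hS', hv, hv01, hvg⟩ := exCont D hg'.cd hg'.hs hg'.h01
  have hc := hcmp x hx r hr u G g v G' g' _ _ hS hS' hu hv (fun X => (hu01 X).1)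
    (fun X => (hv01 X).2) hg hg' X (by rw [mem_ball] at hX4; push Not at hX4; exact hX4)
  have ru := hrepr u G hu (fun φ h1 h2 h3 i => hS.weak (h1.of_le (by simp)) h2 h3 i) hS.energy
    (fun φ h1 h2 h3 => hS.weakeq (h1.of_le (by simp)) h2 h3) X hX
  have rv := hrepr v G' hv (fun φ h1 h2 h3 i => hS'.weak (h1.of_le (by simp)) h2 h3 i) hS'.energy
    (fun φ h1 h2 h3 => hS'.weakeq (h1.of_le (by simp)) h2 h3) X hX
  obtain ⟨hp, hΓ0⟩ := hprob X hX
  have hae : ∀ᵐ y ∂(ω X), y ∈ Γ := hΓ0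
  have hm : ∀ s : ℝ, MeasurableSet (ball x s ∩ Γ) := fun s =>
    measurableSet_ball.inter hclosed.measurableSet
  have iu : Integrable u (ω X) := (integrable_const (1 : ℝ)).mono' hu.aestronglyMeasurable
    (Eventually.of_forall fun y => by
      rw [Real.norm_eq_abs, abs_of_nonneg (hu01 y).1]; exact (hu01 y).2)
  have iv : Integrable v (ω X) := (integrable_const (1 : ℝ)).mono' hv.aestronglyMeasurable
    (Eventually.of_forall fun y => by
      rw [Real.norm_eq_abs, abs_of_nonneg (hv01 y).1]; exact (hv01 y).2)
  have h1 : u X ≤ (ω X).real (ball x r ∩ Γ) := by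
    rw [ru, ← integral_indicator_one (hm r)]
    refine integral_mono_ae iu ((integrable_const (1 : ℝ)).indicator (hm r)) ?_
    filter_upwards [hae] with y hy
    by_cases hyr : y ∈ ball x r
    · rw [indicator_of_mem (show y ∈ ball x _ ∩ Γ from ⟨hyr, hy⟩)]; exact (hu01 y).2
    · rw [indicator_of_notMem (fun h => hyr h.1), hug y hy,
        (hg.h0 y (by rw [mem_ball] at hyr; push Not at hyr; exact hyr)).1]
  have h2 : (ω X).real (ball x (2 * r) ∩ Γ) ≤ v X := by
    rw [rv, ← integral_indicator_one (hm (2 * r))]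
    refine integral_mono_ae ((integrable_const (1 : ℝ)).indicator (hm _)) iv ?_
    filter_upwards [hae] with y hy
    by_cases hyr : y ∈ ball x (2 * r)
    · rw [indicator_of_mem (show y ∈ ball x _ ∩ Γ from ⟨hyr, hy⟩), hvg y hy, hg'.h1 y (mem_ball.1 hyr).le]; rfl
    · rw [indicator_of_notMem (fun h => hyr h.1)]; exact (hv01 y).1
  have h3 : (ω X).real (ball x (2 * r) ∩ Γ) ≤ M * (ω X).real (ball x r ∩ Γ) :=
    h2.trans (hc.trans (by gcongr))
  rw [← ofReal_measureReal (μ := ω X) (s := ball x (2 * r) ∩ Γ),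
    ← ofReal_measureReal (μ := ω X) (s := ball x r ∩ Γ), ← ENNReal.ofReal_mul hM.le]
  exact ENNReal.ofReal_le_ofReal h3
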